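/- arXiv:1712.06392 — 2 statements merged into one kernel-verified Lean document; each statement's English description precedes it below -/
import Mathlib

section
/- Let K be an algebraically closed field with char(K) ≠ 2, 3, let R = K[x1,…,x7] be the standard graded polynomial ring, and let I ⊆ R be a homogeneous ideal such that the graded K-algebra A = R/I has Hilbert function (1,7,7,1) and is Gorenstein. Then A is smoothable (with d = 16). -/
open TensorProduct in
/-- A commutative `K`-algebra `A` (of dimension `d`) is *smoothable* if there is a commutative
`K[[t]]`-algebra `B`, free of rank `d` as a `K[[t]]`-module, with `B/(t)B ≅ A` as a `K`-algebra
and `B ⊗_{K[[t]]} K((t))` étale over the Laurent series field `K((t))`. -/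
def IsSmoothable (K : Type) [Field K] (A : Type) [CommRing A] [Algebra K A] (d : ℕ) : Prop :=
  ∃ (B : Type) (_ : CommRing B) (_ : Algebra (PowerSeries K) B) (_ : Algebra K B)
    (_ : IsScalarTower K (PowerSeries K) B),
    Module.Free (PowerSeries K) B ∧
    Module.finrank (PowerSeries K) B = d ∧
    Nonempty ((B ⧸ Ideal.span {(algebraMap (PowerSeries K) B) PowerSeries.X}) ≃ₐ[K] A) ∧
    Algebra.Etale (LaurentSeries K) ((LaurentSeries K) ⊗[PowerSeries K] B)

/-- The degree-`t` graded piece of `R/I`: the image in `R/I` of the space of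
degree-`t` homogeneous polynomials. -/
noncomputable def gradedPiece (K : Type) [Field K] (n : ℕ)
    (I : Ideal (MvPolynomial (Fin n) K)) (t : ℕ) :
    Submodule K (MvPolynomial (Fin n) K ⧸ I) :=
  Submodule.map (Ideal.Quotient.mkₐ K I).toLinearMap (MvPolynomial.homogeneousSubmodule (Fin n) K t)

/-- The socle of `A = R/I`: the subspace `{a ∈ A : a · x̄ᵢ = 0 for all i}`. -/
noncomputable def socle (K : Type) [Field K] (n : ℕ) (I : Ideal (MvPolynomial (Fin n) K)) :
    Submodule K (MvPolynomial (Fin n) K ⧸ I) :=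
  ⨅ i : Fin n, LinearMap.ker (LinearMap.mulRight K (Ideal.Quotient.mk I (MvPolynomial.X i)))

section PowerSeriesExpansion

variable {K O : Type*} [Field K] [CommRing O] [Algebra K O]
  {res : O →ₐ[K] K} {π : O}

/-- The coefficients of the `π`-adic expansion with respect to the section `K → O` of `res`. -/
noncomputable def adicQuotient (hker : ∀ x, res x = 0 → π ∣ x) (x : O) : O :=
  Classical.choose (hker (x - algebraMap K O (res x)) (by simp))

lemma eq_add_mul_adicQuotient (hker : ∀ x, res x = 0 → π ∣ x) (x : O) :
    x = algebraMap K O (res x) + π * adicQuotient hker x :=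
  (sub_eq_iff_eq_add'.mp (Classical.choose_spec (hker (x - algebraMap K O (res x)) (by simp))))

lemma adicQuotient_eq [IsDomain O] (hker : ∀ x, res x = 0 → π ∣ x) (hπ : res π = 0) (hπ0 : π ≠ 0)
    {x y : O} {a : K} (h : x = algebraMap K O a + π * y) : adicQuotient hker x = y := by
  have h1 : res x = a := by simp [h, hπ]
  have h2 := eq_add_mul_adicQuotient hker x
  rw [h1] at h2
  exact mul_left_cancel₀ hπ0 (add_left_cancel (h2.symm.trans h))

/-- The power series whose coefficients are the digits of the `π`-adic expansion. -/
noncomputable def adicExpansion (hker : ∀ x, res x = 0 → π ∣ x) (x : O) : PowerSeries K :=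
  PowerSeries.mk fun n => res ((adicQuotient hker)^[n] x)

lemma constantCoeff_adicExpansion (hker : ∀ x, res x = 0 → π ∣ x) (x : O) :
    PowerSeries.constantCoeff (adicExpansion hker x) = res x := by
  simp [adicExpansion, ← PowerSeries.coeff_zero_eq_constantCoeff_apply,
    -PowerSeries.coeff_zero_eq_constantCoeff]

lemma coeff_succ_adicExpansion (hker : ∀ x, res x = 0 → π ∣ x) (x : O) (n : ℕ) :
    PowerSeries.coeff (n + 1) (adicExpansion hker x) =
      PowerSeries.coeff n (adicExpansion hker (adicQuotient hker x)) := by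
  simp [adicExpansion]

lemma adicExpansion_eq (hker : ∀ x, res x = 0 → π ∣ x) (x : O) :
    adicExpansion hker x = PowerSeries.C (res x) +
      PowerSeries.X * adicExpansion hker (adicQuotient hker x) := by
  ext n
  cases n with
  | zero => simp [constantCoeff_adicExpansion]
  | succ n => simp [coeff_succ_adicExpansion, PowerSeries.coeff_succ_X_mul]

lemma adicExpansion_add [IsDomain O] (hker : ∀ x, res x = 0 → π ∣ x) (hπ : res π = 0)
    (hπ0 : π ≠ 0) (x y : O) :
    adicExpansion hker (x + y) = adicExpansion hker x + adicExpansion hker y := by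
  ext n
  induction n generalizing x y with
  | zero => simp [constantCoeff_adicExpansion]
  | succ n ih =>
    have h : adicQuotient hker (x + y) = adicQuotient hker x + adicQuotient hker y := by
      apply adicQuotient_eq hker hπ hπ0 (a := res x + res y)
      nth_rw 1 [eq_add_mul_adicQuotient hker x, eq_add_mul_adicQuotient hker y, map_add]
      ring
    rw [coeff_succ_adicExpansion, h, ih]
    simp only [map_add, coeff_succ_adicExpansion]

lemma adicExpansion_algebraMap [IsDomain O] (hker : ∀ x, res x = 0 → π ∣ x) (hπ : res π = 0)
    (hπ0 : π ≠ 0) (a : K) : adicExpansion hker (algebraMap K O a) = PowerSeries.C a := by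
  have h0 : adicExpansion hker (0 : O) = 0 := by
    have := adicExpansion_add hker hπ hπ0 0 0
    simpa using this
  have h : adicQuotient hker (algebraMap K O a) = 0 :=
    adicQuotient_eq hker hπ hπ0 (a := a) (by simp)
  rw [adicExpansion_eq, h, h0]
  simp

lemma adicExpansion_mul [IsDomain O] (hker : ∀ x, res x = 0 → π ∣ x) (hπ : res π = 0)
    (hπ0 : π ≠ 0) (x y : O) :
    adicExpansion hker (x * y) = adicExpansion hker x * adicExpansion hker y := by
  have hC (a : K) (y : O) : adicExpansion hker (algebraMap K O a * y) =
      PowerSeries.C a * adicExpansion hker y := by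
    ext n
    induction n generalizing y with
    | zero => simp [constantCoeff_adicExpansion]
    | succ n ih =>
      have h : adicQuotient hker (algebraMap K O a * y) =
          algebraMap K O a * adicQuotient hker y := by
        apply adicQuotient_eq hker hπ hπ0 (a := a * res y)
        nth_rw 1 [eq_add_mul_adicQuotient hker y, map_mul]
        ring
      rw [coeff_succ_adicExpansion, h, ih]
      simp only [PowerSeries.coeff_C_mul, coeff_succ_adicExpansion]
  ext n
  induction n generalizing x y with
  | zero => simp [constantCoeff_adicExpansion]
  | succ n ih =>
    have h : adicQuotient hker (x * y) = adicQuotient hker x * y +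
        algebraMap K O (res x) * adicQuotient hker y := by
      apply adicQuotient_eq hker hπ hπ0 (a := res x * res y)
      calc x * y = (algebraMap K O (res x) + π * adicQuotient hker x) * y := by
            rw [← eq_add_mul_adicQuotient hker x]
        _ = algebraMap K O (res x) * (algebraMap K O (res y) + π * adicQuotient hker y) +
            π * adicQuotient hker x * y := by
            rw [← eq_add_mul_adicQuotient hker y]; ring
        _ = _ := by rw [map_mul]; ring
    rw [coeff_succ_adicExpansion, h, adicExpansion_add hker hπ hπ0, map_add, ih, hC,
      adicExpansion_eq hker x, add_mul, map_add, mul_assoc, PowerSeries.coeff_succ_X_mul,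
      PowerSeries.coeff_C_mul, PowerSeries.coeff_C_mul, coeff_succ_adicExpansion]
    ring

/-- The `π`-adic expansion as a ring homomorphism. -/
noncomputable def adicExpansionHom [IsDomain O] (hker : ∀ x, res x = 0 → π ∣ x) (hπ : res π = 0)
    (hπ0 : π ≠ 0) : O →ₐ[K] PowerSeries K where
  toFun := adicExpansion hker
  map_one' := by simpa using adicExpansion_algebraMap hker hπ hπ0 1
  map_zero' := by simpa using adicExpansion_algebraMap hker hπ hπ0 0
  map_mul' := adicExpansion_mul hker hπ hπ0
  map_add' := adicExpansion_add hker hπ hπ0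
  commutes' a := by rw [adicExpansion_algebraMap hker hπ hπ0]; rfl

end PowerSeriesExpansion

/-- A discrete valuation ring over `K` with residue field `K` embeds in `K⟦X⟧` compatibly with
the residue maps. -/
lemma IsDiscreteValuationRing.exists_injective_powerSeries {K O : Type*} [Field K] [CommRing O]
    [IsDomain O] [IsDiscreteValuationRing O] [Algebra K O] (res : O →ₐ[K] K) :
    ∃ f : O →ₐ[K] PowerSeries K, Function.Injective f ∧
      ∀ x, PowerSeries.constantCoeff (f x) = res x := by
  obtain ⟨π, hirr⟩ := IsDiscreteValuationRing.exists_irreducible O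
  have hunit (x : O) (hx : IsUnit x) : res x ≠ 0 := (hx.map res).ne_zero
  have hsurj : Function.Surjective res := fun a => ⟨algebraMap K O a, by simp⟩
  have hmax : (RingHom.ker res).IsMaximal := RingHom.ker_isMaximal_of_surjective _ hsurj
  have hm : RingHom.ker res = Ideal.span {π} := by
    rw [IsLocalRing.eq_maximalIdeal hmax, hirr.maximalIdeal_eq]
  have hker (x : O) (hx : res x = 0) : π ∣ x := by
    rw [← Ideal.mem_span_singleton, ← hm]; exact hx
  have hπ : res π = 0 := by
    have : π ∈ RingHom.ker res := by rw [hm]; exact Ideal.mem_span_singleton_self π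
    exact this
  let f := adicExpansionHom hker hπ hirr.ne_zero
  have hf (x : O) : PowerSeries.constantCoeff (f x) = res x := constantCoeff_adicExpansion hker x
  refine ⟨f, (injective_iff_map_eq_zero f).mpr fun x hx => ?_, hf⟩
  by_contra hx0
  obtain ⟨n, u, rfl⟩ := IsDiscreteValuationRing.eq_unit_mul_pow_irreducible hx0 hirr
  have hfu : f u ≠ 0 := fun h => hunit _ u.isUnit (by rw [← hf, h, map_zero])
  have hfπ : f π ≠ 0 := fun h => by
    have h1 : f π = PowerSeries.X * f 1 := by
      have h2 := adicExpansion_eq hker π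
      rw [adicQuotient_eq hker hπ hirr.ne_zero (a := 0) (y := 1) (by simp), hπ] at h2
      have h3 : adicExpansion hker 1 = 1 := map_one f
      rw [h3, map_zero, zero_add, mul_one] at h2
      rw [map_one, mul_one]
      exact h2
    rw [h, map_one, mul_one] at h1
    exact PowerSeries.X_ne_zero h1.symm
  rw [map_mul, map_pow] at hx
  exact mul_ne_zero hfu (pow_ne_zero n hfπ) hx

open Polynomial in
/-- A finite separable extension of the rational function field `K(X)`, with `K` algebraically
closed, embeds over `K` in `K((t))` in such a way that `X` maps to a power series with
prescribed constant coefficient. -/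
lemma exists_algHom_laurentSeries_of_ratFunc {K L : Type*} [Field K] [IsAlgClosed K] [Field L]
    [Algebra (RatFunc K) L] [Algebra K[X] L] [IsScalarTower K[X] (RatFunc K) L]
    [Algebra K L] [IsScalarTower K K[X] L]
    [FiniteDimensional (RatFunc K) L] [Algebra.IsSeparable (RatFunc K) L] (a : K) :
    ∃ (j : L →+* LaurentSeries K) (s : PowerSeries K), PowerSeries.constantCoeff s = a ∧
      (∀ c : K, j (algebraMap K L c) =
        algebraMap (PowerSeries K) (LaurentSeries K) (PowerSeries.C c)) ∧
      j (algebraMap K[X] L X) = algebraMap (PowerSeries K) (LaurentSeries K) s := by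
  let C := integralClosure K[X] L
  have : IsDedekindDomain C := integralClosure.isDedekindDomain K[X] (RatFunc K) L
  have : IsFractionRing C L :=
    IsIntegralClosure.isFractionRing_of_finite_extension K[X] (RatFunc K) L C
  have hinj : Function.Injective (algebraMap K[X] L) := by
    rw [IsScalarTower.algebraMap_eq K[X] (RatFunc K) L]
    exact (algebraMap (RatFunc K) L).injective.comp (IsFractionRing.injective _ _)
  have hinjC : Function.Injective (algebraMap K[X] C) := by
    rw [IsScalarTower.algebraMap_eq K[X] C L, RingHom.coe_comp] at hinj
    exact hinj.of_comp
  let m : Ideal K[X] := RingHom.ker (aeval a : K[X] →ₐ[K] K)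
  have hm : m.IsMaximal := RingHom.ker_isMaximal_of_surjective _ fun b => ⟨Polynomial.C b, by simp⟩
  obtain ⟨P, hP, hPm⟩ := Ideal.exists_ideal_over_maximal_of_isIntegral (S := C) m
    (by rw [(RingHom.injective_iff_ker_eq_bot _).mp hinjC]; exact bot_le)
  have hXm : X - Polynomial.C a ∈ m := by
    change aeval a _ = _
    simp
  have hP0 : P ≠ ⊥ := by
    rintro rfl
    rw [← hPm, Ideal.mem_comap, Ideal.mem_bot, ← map_zero (algebraMap K[X] C)] at hXm
    exact X_sub_C_ne_zero a (hinjC hXm)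
  have hbij : Function.Bijective (algebraMap K (C ⧸ P)) := by
    have : IsDomain (C ⧸ P) := Ideal.Quotient.isDomain P
    have hintegral : Algebra.IsIntegral K (C ⧸ P) := by
      constructor
      intro x
      obtain ⟨x, rfl⟩ := Ideal.Quotient.mk_surjective x
      obtain ⟨p, hp, hpx⟩ := Algebra.IsIntegral.isIntegral (R := K[X]) x
      refine ⟨p.map (aeval a : K[X] →ₐ[K] K).toRingHom, hp.map _, ?_⟩
      have key : (algebraMap K (C ⧸ P)).comp (aeval a : K[X] →ₐ[K] K).toRingHom =
          (Ideal.Quotient.mk P).comp (algebraMap K[X] C) := by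
        apply Polynomial.ringHom_ext
        · intro b
          simp only [RingHom.comp_apply, AlgHom.toRingHom_eq_coe, RingHom.coe_coe, aeval_C,
            Algebra.algebraMap_self, RingHom.id_apply]
          rw [← Polynomial.algebraMap_eq, ← IsScalarTower.algebraMap_apply K K[X] C]
          rfl
        · simp only [RingHom.comp_apply, AlgHom.toRingHom_eq_coe, RingHom.coe_coe, aeval_X]
          have h1 : algebraMap K[X] C (X - Polynomial.C a) ∈ P := by
            rw [← Ideal.mem_comap, hPm]; exact hXm
          rw [map_sub, ← Polynomial.algebraMap_eq, ← IsScalarTower.algebraMap_apply K K[X] C] at h1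
          exact ((Ideal.Quotient.eq).mpr h1).symm
      rw [Polynomial.eval₂_map, key, ← Polynomial.hom_eval₂, hpx, map_zero]
    exact IsAlgClosed.algebraMap_bijective_of_isIntegral
  let e : K ≃ₐ[K] C ⧸ P := AlgEquiv.ofBijective (Algebra.ofId K _) hbij
  let r : C →ₐ[K] K := e.symm.toAlgHom.comp (Ideal.Quotient.mkₐ K P)
  have hr (x : C) : r x = 0 ↔ x ∈ P := by
    simp [r, Ideal.Quotient.eq_zero_iff_mem]
  let O := Localization.AtPrime P
  have : IsDiscreteValuationRing O :=
    IsLocalization.AtPrime.isDiscreteValuationRing_of_dedekind_domain C hP0 O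
  have hrunit (y : P.primeCompl) : IsUnit (r y) := by
    rw [isUnit_iff_ne_zero, Ne, hr]; exact y.2
  let res : O →ₐ[K] K := IsLocalization.liftAlgHom (M := P.primeCompl) (f := r) hrunit
  obtain ⟨f, hf, hfres⟩ :=
    IsDiscreteValuationRing.exists_injective_powerSeries (K := K) (O := O) res
  let g : C →ₐ[K] PowerSeries K := f.comp (IsScalarTower.toAlgHom K C O)
  have hCO : Function.Injective (algebraMap C O) :=
    IsLocalization.injective O P.primeCompl_le_nonZeroDivisors
  let h : C →+* LaurentSeries K := (algebraMap (PowerSeries K) (LaurentSeries K)).comp g.toRingHom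
  have hh : Function.Injective h :=
    (IsFractionRing.injective (PowerSeries K) (LaurentSeries K)).comp (hf.comp hCO)
  have hgres (x : C) : PowerSeries.constantCoeff (g x) = r x := by
    change PowerSeries.constantCoeff (f (algebraMap C O x)) = r x
    rw [hfres]
    exact IsLocalization.lift_eq (M := P.primeCompl) hrunit x
  refine ⟨IsFractionRing.lift hh, g (algebraMap K[X] C X), ?_, fun c => ?_, ?_⟩
  · rw [hgres]
    have h1 : r (algebraMap K[X] C (X - Polynomial.C a)) = 0 := by
      rw [hr, ← Ideal.mem_comap, hPm]; exact hXm
    rw [map_sub, ← Polynomial.algebraMap_eq, ← IsScalarTower.algebraMap_apply K K[X] C,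
      map_sub, AlgHom.commutes, sub_eq_zero] at h1
    exact h1
  · rw [IsScalarTower.algebraMap_apply K C L, IsFractionRing.lift_algebraMap hh]
    change algebraMap _ _ (g (algebraMap K C c)) = _
    rw [AlgHom.commutes]
    rfl
  · rw [IsScalarTower.algebraMap_apply K[X] C L]
    exact IsFractionRing.lift_algebraMap hh _

section MultivariateHensel

open MvPolynomial

variable {K σ : Type*} [Field K]

lemma MvPolynomial.dvd_aeval_sub {S : Type*} [CommRing S] [Algebra K S] {x x' : σ → S} {d : S}
    (h : ∀ i, d ∣ x i - x' i) (r : MvPolynomial σ K) : d ∣ aeval x r - aeval x' r := by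
  induction r using MvPolynomial.induction_on with
  | C a => simp
  | add p q hp hq =>
    rw [map_add, map_add, add_sub_add_comm]
    exact dvd_add hp hq
  | mul_X p i hp =>
    have h1 : aeval x (p * X i) - aeval x' (p * X i) =
        (aeval x p - aeval x' p) * x i + aeval x' p * (x i - x' i) := by
      simp only [map_mul, aeval_X]; ring
    rw [h1]
    exact dvd_add (hp.mul_right _) ((h i).mul_left _)

lemma MvPolynomial.dvd_aeval_of_mem_span_X {S : Type*} [CommRing S] [Algebra K S] {x : σ → S}
    {d : S} (h : ∀ i, d ∣ x i) {r : MvPolynomial σ K}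
    (hr : r ∈ Ideal.span (Set.range (X : σ → MvPolynomial σ K))) : d ∣ aeval x r := by
  induction hr using Submodule.span_induction with
  | mem r hr => obtain ⟨i, rfl⟩ := hr; simpa using h i
  | zero => simp
  | add p q _ _ hp hq => rw [map_add]; exact dvd_add hp hq
  | smul a p _ hp => rw [smul_eq_mul, map_mul]; exact hp.mul_left _

lemma MvPolynomial.mul_dvd_aeval_sub_of_mem_sq {S : Type*} [CommRing S] [Algebra K S]
    {x x' : σ → S} {c d : S} (hx : ∀ i, c ∣ x i) (hx' : ∀ i, c ∣ x' i)
    (h : ∀ i, d ∣ x i - x' i) {r : MvPolynomial σ K}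
    (hr : r ∈ Ideal.span (Set.range (X : σ → MvPolynomial σ K)) ^ 2) :
    c * d ∣ aeval x r - aeval x' r := by
  rw [pow_two] at hr
  refine Submodule.mul_induction_on hr (fun p hp q hq => ?_) fun p q hp hq => ?_
  · have h1 : aeval x (p * q) - aeval x' (p * q) =
        aeval x p * (aeval x q - aeval x' q) + aeval x' q * (aeval x p - aeval x' p) := by
      simp only [map_mul]; ring
    rw [h1]
    exact dvd_add (mul_dvd_mul (dvd_aeval_of_mem_span_X hx hp) (dvd_aeval_sub h q))
      (mul_dvd_mul (dvd_aeval_of_mem_span_X hx' hq) (dvd_aeval_sub h p))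
  · rw [map_add, map_add, add_sub_add_comm]
    exact dvd_add hp hq

/-- A polynomial self-map of affine space tangent to the identity at the origin can be inverted
along lines through the origin by formal power series. -/
lemma exists_powerSeries_aeval_eq {p : σ → MvPolynomial σ K}
    (hp : ∀ i, p i - X i ∈ Ideal.span (Set.range (X : σ → MvPolynomial σ K)) ^ 2) (y : σ → K) :
    ∃ x : σ → PowerSeries K, (∀ i, PowerSeries.X ∣ x i) ∧
      ∀ i, aeval x (p i) = PowerSeries.X * PowerSeries.C (y i) := by
  let u : PowerSeries K := PowerSeries.X
  let step : (σ → PowerSeries K) → σ → PowerSeries K :=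
    fun x i => u * PowerSeries.C (y i) - aeval x (p i - X i)
  let x : ℕ → σ → PowerSeries K := fun n => step^[n] 0
  have hxs (n : ℕ) : x (n + 1) = step (x n) := Function.iterate_succ_apply' _ _ _
  have hdvd (n : ℕ) (i : σ) : u ∣ x n i := by
    induction n generalizing i with
    | zero => exact dvd_zero u
    | succ n ih =>
      rw [hxs]
      exact dvd_sub (dvd_mul_right _ _)
        (dvd_aeval_of_mem_span_X ih (Ideal.pow_le_self two_ne_zero (hp i)))
  have hstep (n : ℕ) (i : σ) : u ^ (n + 1) ∣ x (n + 1) i - x n i := by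
    induction n generalizing i with
    | zero => simpa using dvd_sub (hdvd 1 i) (hdvd 0 i)
    | succ n ih =>
      have h1 : x (n + 1 + 1) i - x (n + 1) i =
          -(aeval (x (n + 1)) (p i - X i) - aeval (x n) (p i - X i)) := by
        rw [hxs (n + 1)]
        nth_rw 2 [hxs n]
        simp only [step]
        ring
      rw [h1, dvd_neg, pow_succ']
      exact mul_dvd_aeval_sub_of_mem_sq (hdvd _) (hdvd _) ih (hp i)
  have hcoeff (i : σ) (k n : ℕ) :
      PowerSeries.coeff k (x (k + n) i) = PowerSeries.coeff k (x k i) := by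
    induction n with
    | zero => rfl
    | succ n ih =>
      have h1 := PowerSeries.X_pow_dvd_iff.mp (hstep (k + n) i) k (by omega)
      rw [map_sub, sub_eq_zero] at h1
      rw [← ih, ← h1]
      rfl
  let z : σ → PowerSeries K := fun i => PowerSeries.mk fun k => PowerSeries.coeff k (x k i)
  have hz (n : ℕ) (i : σ) : u ^ (n + 1) ∣ z i - x n i := by
    rw [PowerSeries.X_pow_dvd_iff]
    intro k hk
    obtain ⟨d, rfl⟩ := Nat.exists_eq_add_of_le (Nat.lt_succ_iff.mp hk)
    rw [map_sub, hcoeff, PowerSeries.coeff_mk, sub_self]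
  have hzu (i : σ) : u ∣ z i := by simpa [x] using hz 0 i
  refine ⟨z, hzu, fun i => ?_⟩
  rw [← sub_eq_zero]
  have key (n : ℕ) : u ^ n ∣ aeval z (p i) - u * PowerSeries.C (y i) := by
    have h1 : aeval z (p i) - u * PowerSeries.C (y i) = (z i - x (n + 1) i) +
        (aeval z (p i - X i) - aeval (x n) (p i - X i)) := by
      rw [hxs]
      simp only [step, map_sub, aeval_X]
      ring
    rw [h1]
    refine dvd_add ((pow_dvd_pow u (by omega)).trans (hz (n + 1) i)) ?_
    exact (pow_dvd_pow u (by omega)).trans (dvd_aeval_sub (fun j => hz n j) _)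
  ext n
  exact PowerSeries.X_pow_dvd_iff.mp (key (n + 1)) n (Nat.lt_succ_self n)

end MultivariateHensel

lemma MvPolynomial.derivation_aeval {k A M σ : Type*} [CommRing k] [CommRing A] [Algebra k A]
    [AddCommGroup M] [Module A M] [Module k M] [IsScalarTower k A M] [Fintype σ]
    (D : Derivation k A M) (q : σ → A) (p : MvPolynomial σ k) :
    D (aeval q p) = ∑ j, aeval q (pderiv j p) • D (q j) := by
  classical
  induction p using MvPolynomial.induction_on with
  | C a => simp
  | add p q hp hq => simp only [map_add, hp, hq, add_smul, Finset.sum_add_distrib]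
  | mul_X p i hp =>
    simp only [map_mul, aeval_X, Derivation.leibniz, hp, pderiv_X, smul_eq_mul, map_add, add_smul,
      Finset.sum_add_distrib, Finset.smul_sum, mul_smul]
    congr 1
    rw [Finset.sum_eq_single i]
    · simp
    · intro j _ hj
      simp [Pi.single_eq_of_ne hj.symm]
    · simp

/-- The Jacobian criterion: a field extension generated by a nondegenerate solution of a square
system of polynomial equations is finite and separable. -/
lemma finiteDimensional_and_isSeparable_adjoin_of_jacobian {k F σ : Type*} [Field k] [Field F]
    [Algebra k F] [Fintype σ] [DecidableEq σ] (q : σ → F) (p : σ → MvPolynomial σ k) (c : σ → k)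
    (h : ∀ i, MvPolynomial.aeval q (p i) = algebraMap k F (c i))
    (hJ : (Matrix.of fun i j => MvPolynomial.aeval q (MvPolynomial.pderiv j (p i))).det ≠ 0) :
    FiniteDimensional k (IntermediateField.adjoin k (Set.range q)) ∧
      Algebra.IsSeparable k (IntermediateField.adjoin k (Set.range q)) := by
  let L := IntermediateField.adjoin k (Set.range q)
  let q' : σ → L := fun i => ⟨q i, IntermediateField.subset_adjoin _ _ ⟨i, rfl⟩⟩
  have hq' (r : MvPolynomial σ k) :
      L.val (MvPolynomial.aeval q' r) = MvPolynomial.aeval q r := by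
    rw [← AlgHom.comp_apply, MvPolynomial.comp_aeval]
    rfl
  let J : Matrix σ σ L := Matrix.of fun i j => MvPolynomial.aeval q' (MvPolynomial.pderiv j (p i))
  have hdet : IsUnit J.det := by
    rw [isUnit_iff_ne_zero]
    intro h0
    apply hJ
    have h1 : L.val J.det = 0 := by rw [h0, map_zero]
    rw [AlgHom.map_det] at h1
    rw [← h1]
    congr 1
    ext i j
    exact (hq' _).symm
  let D := KaehlerDifferential.D k L
  have hDq (l : σ) : D (q' l) = 0 := by
    have h1 (i : σ) : ∑ j, J i j • D (q' j) = 0 := by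
      have h2 : MvPolynomial.aeval q' (p i) = algebraMap k L (c i) := by
        refine L.val.injective (?_ : L.val _ = L.val _)
        rw [hq', h, AlgHom.commutes]
      rw [← D.map_algebraMap (c i), ← h2]
      exact (MvPolynomial.derivation_aeval D q' (p i)).symm
    have h3 : ∑ i, J⁻¹ l i • ∑ j, J i j • D (q' j) = D (q' l) := by
      simp only [Finset.smul_sum, smul_smul]
      rw [Finset.sum_comm]
      simp only [← Finset.sum_smul, ← Matrix.mul_apply, Matrix.nonsing_inv_mul J hdet,
        Matrix.one_apply, ite_smul, one_smul, zero_smul, Finset.sum_ite_eq, Finset.mem_univ,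
        if_true]
    rw [← h3]
    simp only [h1, smul_zero, Finset.sum_const_zero]
  have hD (x : L) : D x = 0 := by
    obtain ⟨x, hx⟩ := x
    induction hx using IntermediateField.adjoin_induction with
    | mem x hx => obtain ⟨i, rfl⟩ := hx; exact hDq i
    | algebraMap a => exact D.map_algebraMap a
    | add x y hx hy h1 h2 =>
      have := D.map_add ⟨x, hx⟩ ⟨y, hy⟩
      rw [h1, h2, add_zero] at this
      exact this
    | inv x hx h1 =>
      have := D.leibniz_inv (⟨x, hx⟩ : L)
      rw [h1, smul_zero] at this
      exact this
    | mul x y hx hy h1 h2 =>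
      have := D.leibniz (⟨x, hx⟩ : L) ⟨y, hy⟩
      rw [h1, h2, smul_zero, smul_zero, add_zero] at this
      exact this
  have hΩ : Subsingleton (KaehlerDifferential k L) := by
    have h1 := KaehlerDifferential.span_range_derivation k L
    have h2 : Set.range (KaehlerDifferential.D k L) ⊆ {0} := by
      rintro _ ⟨x, rfl⟩; exact hD x
    rw [← Submodule.subsingleton_iff L]
    refine subsingleton_of_bot_eq_top ?_
    rw [← h1, eq_comm, Submodule.span_eq_bot]
    exact h2
  have hunr : Algebra.FormallyUnramified k L := ⟨hΩ⟩
  have hess : Algebra.EssFiniteType k L := by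
    rw [IntermediateField.essFiniteType_iff]
    exact IntermediateField.fg_adjoin_of_finite (Set.finite_range q)
  exact ⟨Algebra.FormallyUnramified.finite_of_free k L,
    Algebra.FormallyUnramified.isSeparable k L⟩

lemma MvPolynomial.constantCoeff_pderiv_of_mem_sq {R σ : Type*} [CommRing R]
    {r : MvPolynomial σ R}
    (hr : r ∈ Ideal.span (Set.range (MvPolynomial.X : σ → MvPolynomial σ R)) ^ 2) (j : σ) :
    constantCoeff (pderiv j r) = 0 := by
  have h0 {a : MvPolynomial σ R}
      (ha : a ∈ Ideal.span (Set.range (X : σ → MvPolynomial σ R))) : constantCoeff a = 0 := by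
    rw [← RingHom.mem_ker]
    refine Ideal.span_le.mpr ?_ ha
    rintro _ ⟨i, rfl⟩
    simp
  rw [pow_two] at hr
  refine Submodule.mul_induction_on hr (fun a ha b hb => ?_) fun a b ha hb => ?_
  · rw [Derivation.leibniz, smul_eq_mul, smul_eq_mul, map_add, map_mul, map_mul, h0 ha, h0 hb,
      zero_mul, zero_mul, add_zero]
  · rw [map_add, map_add, ha, hb, add_zero]

/-- Let `p` be a polynomial self-map of affine space over an algebraically closed field, tangent
to the identity at the origin. Then every point `y` of the target can be deformed over `K⟦t⟧` to
a point in the image of `p` over `K((t))`, in such a way that the preimage does not satisfy any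
polynomial equation over `K` which fails at the origin. -/
lemma exists_laurentSeries_eval₂_eq {K σ : Type*} [Field K] [IsAlgClosed K] [Fintype σ]
    {p : σ → MvPolynomial σ K}
    (hp : ∀ i, p i - MvPolynomial.X i ∈
      Ideal.span (Set.range (MvPolynomial.X : σ → MvPolynomial σ K)) ^ 2) (y : σ → K) :
    ∃ (x : σ → LaurentSeries K) (s : PowerSeries K), PowerSeries.constantCoeff s = 1 ∧
      (∀ i, MvPolynomial.eval₂ ((algebraMap (PowerSeries K) (LaurentSeries K)).comp PowerSeries.C)
        x (p i) = algebraMap (PowerSeries K) (LaurentSeries K) (s * PowerSeries.C (y i))) ∧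
      ∀ g : MvPolynomial σ K, MvPolynomial.constantCoeff g ≠ 0 →
        MvPolynomial.eval₂ ((algebraMap (PowerSeries K) (LaurentSeries K)).comp PowerSeries.C)
          x g ≠ 0 := by
  classical
  obtain ⟨x₀, hx₀, hpx₀⟩ := exists_powerSeries_aeval_eq hp y

  let ι := algebraMap (PowerSeries K) (LaurentSeries K)
  have hι : Function.Injective ι := IsFractionRing.injective _ _
  let ξ : σ → LaurentSeries K := fun i => ι (x₀ i)
  let κ : K →+* RatFunc K := RatFunc.C
  let φ : Polynomial K →+* LaurentSeries K := ι.comp Polynomial.coeToPowerSeries.ringHom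
  have hφ : Function.Injective φ := hι.comp (Polynomial.coe_injective K)
  let : Algebra (RatFunc K) (LaurentSeries K) := (IsFractionRing.lift hφ).toAlgebra
  have hlift (P : Polynomial K) : algebraMap (RatFunc K) (LaurentSeries K)
      (algebraMap (Polynomial K) (RatFunc K) P) = φ P := IsFractionRing.lift_algebraMap hφ P
  have hκ : (algebraMap (RatFunc K) (LaurentSeries K)).comp κ = ι.comp PowerSeries.C := by
    ext1 c
    rw [RingHom.comp_apply, RingHom.comp_apply, ← Polynomial.coe_C]
    exact hlift (Polynomial.C c)
  have hX : algebraMap (RatFunc K) (LaurentSeries K) RatFunc.X = ι PowerSeries.X := by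
    rw [← Polynomial.coe_X, ← RatFunc.algebraMap_X]
    exact hlift Polynomial.X
  have hξ (r : MvPolynomial σ K) : MvPolynomial.aeval ξ (MvPolynomial.map κ r) =
      ι (MvPolynomial.aeval x₀ r) := by
    rw [MvPolynomial.aeval_def, MvPolynomial.eval₂_map, hκ, MvPolynomial.aeval_def,
      MvPolynomial.hom_eval₂]
    rfl
  have hc (r : MvPolynomial σ K) : PowerSeries.constantCoeff (MvPolynomial.aeval x₀ r) =
      MvPolynomial.constantCoeff r := by
    rw [MvPolynomial.aeval_def, MvPolynomial.hom_eval₂]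
    have h1 : (fun i => PowerSeries.constantCoeff (x₀ i)) = 0 := by
      funext i
      exact PowerSeries.X_dvd_iff.mp (hx₀ i)
    have h2 : PowerSeries.constantCoeff.comp (algebraMap K (PowerSeries K)) = RingHom.id K := by
      ext c
      simp
    rw [h1, h2]
    exact MvPolynomial.eval₂_zero_apply _ _
  have hJ : (Matrix.of fun i j => MvPolynomial.aeval ξ
      (MvPolynomial.pderiv j (MvPolynomial.map κ (p i)))).det ≠ 0 := by
    let J : Matrix σ σ (PowerSeries K) :=
      Matrix.of fun i j => MvPolynomial.aeval x₀ (MvPolynomial.pderiv j (p i))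
    have h1 : (Matrix.of fun i j => MvPolynomial.aeval ξ
      (MvPolynomial.pderiv j (MvPolynomial.map κ (p i)))) = ι.mapMatrix J := by
      ext i j
      simp only [Matrix.of_apply, MvPolynomial.pderiv_map, hξ]
      rfl
    have h2 : PowerSeries.constantCoeff.mapMatrix J = (1 : Matrix σ σ K) := by
      ext i j
      simp only [J, RingHom.mapMatrix_apply, Matrix.map_apply, Matrix.of_apply, hc]
      have h3 : MvPolynomial.constantCoeff (MvPolynomial.pderiv j (p i - MvPolynomial.X i)) = 0 :=
        MvPolynomial.constantCoeff_pderiv_of_mem_sq (hp i) j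
      rw [map_sub, map_sub, sub_eq_zero] at h3
      rw [h3, MvPolynomial.pderiv_X]
      simp [Matrix.one_apply, Pi.single_apply, apply_ite]
    rw [h1, ← RingHom.map_det, Ne, map_eq_zero_iff _ hι]
    intro h3
    have h4 := RingHom.map_det (PowerSeries.constantCoeff (R := K)) J
    rw [h2, h3, map_zero, Matrix.det_one] at h4
    exact zero_ne_one h4
  let L := IntermediateField.adjoin (RatFunc K) (Set.range ξ)
  obtain ⟨hfin, hsep⟩ := finiteDimensional_and_isSeparable_adjoin_of_jacobian ξ
    (fun i => MvPolynomial.map κ (p i)) (fun i => RatFunc.X * κ (y i)) (fun i => by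
      rw [hξ, hpx₀, map_mul, map_mul, hX, ← RingHom.comp_apply, ← hκ]; rfl) hJ
  let : Algebra (Polynomial K) L :=
    ((algebraMap (RatFunc K) L).comp (algebraMap (Polynomial K) (RatFunc K))).toAlgebra
  have : IsScalarTower (Polynomial K) (RatFunc K) L := .of_algebraMap_eq' rfl
  let : Algebra K L := ((algebraMap (RatFunc K) L).comp κ).toAlgebra
  have : IsScalarTower K (Polynomial K) L := .of_algebraMap_eq' rfl
  obtain ⟨j, s, hs, hj, hjX⟩ := exists_algHom_laurentSeries_of_ratFunc (K := K) (L := L) 1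
  let ξ' : σ → L := fun i => ⟨ξ i, IntermediateField.subset_adjoin _ _ ⟨i, rfl⟩⟩
  have hj' : (algebraMap (PowerSeries K) (LaurentSeries K)).comp PowerSeries.C =
    j.comp (algebraMap K L) := RingHom.ext fun c => (hj c).symm
  have hjr (r : MvPolynomial σ K) : MvPolynomial.eval₂
      ((algebraMap (PowerSeries K) (LaurentSeries K)).comp PowerSeries.C) (fun i => j (ξ' i)) r =
      j (MvPolynomial.aeval ξ' r) := by
    rw [MvPolynomial.aeval_def, MvPolynomial.hom_eval₂, hj']
  have hξ' (r : MvPolynomial σ K) : algebraMap L (LaurentSeries K) (MvPolynomial.aeval ξ' r) =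
      ι (MvPolynomial.aeval x₀ r) := by
    rw [← hξ, MvPolynomial.aeval_def, MvPolynomial.hom_eval₂, MvPolynomial.aeval_def,
      MvPolynomial.eval₂_map]
    rfl
  refine ⟨fun i => j (ξ' i), s, hs, fun i => ?_, fun g hg => ?_⟩
  · rw [hjr, map_mul, ← hjX, ← RingHom.comp_apply _ PowerSeries.C, hj', RingHom.comp_apply,
      ← map_mul]
    congr 1
    apply (algebraMap L (LaurentSeries K)).injective
    rw [hξ', hpx₀, map_mul, map_mul]
    congr 1
    · rw [← hX, ← RatFunc.algebraMap_X]; rfl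
    · rw [← RingHom.comp_apply, ← hκ]; rfl
  · rw [hjr, Ne, map_eq_zero_iff j j.injective]
    intro h0
    apply hg
    have h1 := hξ' g
    rw [h0, map_zero, eq_comm, map_eq_zero_iff ι hι] at h1
    rw [← hc, h1, map_zero]

section SumsOfCubes

open MvPolynomial

set_option maxHeartbeats 2000000 in
/-- If the differential of the map sending a family `P` of linear forms to the cubic form
`∑ i, ε i * P i ^ 3` is surjective, then every cubic form (given by a symmetric tensor) deforms
to a sum of cubes over `K((t))`. -/
lemma exists_laurentSeries_sum_cubes_eq {K ι α : Type*} [Field K] [IsAlgClosed K] [Fintype ι]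
    [Fintype α] (h2 : (2 : K) ≠ 0) (h3 : (3 : K) ≠ 0) (ε : ι → K) (P : ι → α → K)
    (hP : ∀ θ : α → α → α → K, (∀ a b c, θ a b c = θ b a c) → (∀ a b c, θ a b c = θ a c b) →
      ∃ l : ι → α → K, ∀ a b c, ∑ i, ε i *
        (P i a * P i b * l i c + P i a * l i b * P i c + l i a * P i b * P i c) = θ a b c)
    (y : α → α → α → K) (hy₁ : ∀ a b c, y a b c = y b a c) (hy₂ : ∀ a b c, y a b c = y a c b)
    (w : α → K) (hw : ∀ i, ∑ a, w a * P i a ≠ 0)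
    {κ : K →+* LaurentSeries K}
    (hκ : κ = (algebraMap (PowerSeries K) (LaurentSeries K)).comp PowerSeries.C) :
    ∃ (x : ι → α → LaurentSeries K) (s : PowerSeries K), PowerSeries.constantCoeff s = 1 ∧
      (∀ a b c, ∑ i, κ (ε i) * (x i a * x i b * x i c) =
        κ (∑ i, ε i * (P i a * P i b * P i c)) +
          algebraMap (PowerSeries K) (LaurentSeries K) (s * PowerSeries.C (y a b c))) ∧
      ∀ i, ∑ a, κ (w a) * x i a ≠ 0 := by
  classical
  let δ (a a' : α) : K := if a = a' then 1 else 0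
  let sym (τ : α × α × α) (a b c : α) : K :=
    (δ τ.1 a * δ τ.2.1 b * δ τ.2.2 c + δ τ.1 b * δ τ.2.1 a * δ τ.2.2 c +
      δ τ.1 a * δ τ.2.1 c * δ τ.2.2 b + δ τ.1 c * δ τ.2.1 b * δ τ.2.2 a +
      δ τ.1 b * δ τ.2.1 c * δ τ.2.2 a + δ τ.1 c * δ τ.2.1 a * δ τ.2.2 b) / 6
  have h6 : (6 : K) ≠ 0 := by
    rw [show (6 : K) = 2 * 3 by norm_num]; exact mul_ne_zero h2 h3
  choose l hl using fun τ => hP (sym τ) (fun a b c => by simp only [sym]; ring)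
    (fun a b c => by simp only [sym]; ring)
  let lin (i : ι) (a : α) : MvPolynomial (α × α × α) K := ∑ τ, C (l τ i a) * X τ
  let m : Ideal (MvPolynomial (α × α × α) K) := Ideal.span (Set.range X)
  have hlin (i a) : lin i a ∈ m :=
    Ideal.sum_mem _ fun τ _ => Ideal.mul_mem_left _ _ (Ideal.subset_span ⟨τ, rfl⟩)
  let Q (a b c : α) : MvPolynomial (α × α × α) K := ∑ i, C (ε i) *
    (C (P i a) * (lin i b * lin i c) + C (P i b) * (lin i a * lin i c) +
      C (P i c) * (lin i a * lin i b) + lin i a * (lin i b * lin i c))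
  have hQ (a b c) : Q a b c ∈ m ^ 2 := by
    have hll (i a b) : lin i a * lin i b ∈ m ^ 2 := by
      rw [pow_two]; exact Ideal.mul_mem_mul (hlin i a) (hlin i b)
    refine Ideal.sum_mem _ fun i _ => Ideal.mul_mem_left _ _ ?_
    exact add_mem (add_mem (add_mem (Ideal.mul_mem_left _ _ (hll _ _ _))
      (Ideal.mul_mem_left _ _ (hll _ _ _))) (Ideal.mul_mem_left _ _ (hll _ _ _)))
      (Ideal.mul_mem_left _ _ (hll _ _ _))
  obtain ⟨z, s, hs, hz, hg⟩ := exists_laurentSeries_eval₂_eq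
    (p := fun τ : α × α × α => X τ + Q τ.1 τ.2.1 τ.2.2)
    (fun τ => by rw [add_sub_cancel_left]; exact hQ _ _ _) (fun τ => y τ.1 τ.2.1 τ.2.2)
  rw [← hκ] at hz hg
  let n (i : ι) (a : α) : LaurentSeries K := ∑ τ, κ (l τ i a) * z τ
  have hn (i a) : eval₂ κ z (lin i a) = n i a := by
    rw [← coe_eval₂Hom]
    simp only [lin, n, map_sum, map_mul, coe_eval₂Hom, eval₂_C, eval₂_X]
  let q (a b c : α) : LaurentSeries K := ∑ i, κ (ε i) *
    (κ (P i a) * (n i b * n i c) + κ (P i b) * (n i a * n i c) +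
      κ (P i c) * (n i a * n i b) + n i a * (n i b * n i c))
  have hz' (a b c) : z (a, b, c) = 
      algebraMap (PowerSeries K) (LaurentSeries K) (s * PowerSeries.C (y a b c)) - q a b c := by
    rw [eq_sub_iff_add_eq, ← hz (a, b, c), eval₂_add, eval₂_X]
    congr 1
    rw [← coe_eval₂Hom]
    simp only [Q, q, map_sum, map_mul, map_add, coe_eval₂Hom, eval₂_C, hn]
  have hz₁ (a b c) : z (a, b, c) = z (b, a, c) := by
    rw [hz', hz', hy₁]
    congr 1
    exact Finset.sum_congr rfl fun i _ => by ring
  have hz₂ (a b c) : z (a, b, c) = z (a, c, b) := by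
    rw [hz', hz', hy₂]
    congr 1
    exact Finset.sum_congr rfl fun i _ => by ring
  have hsym (a b c) : ∑ τ, κ (sym τ a b c) * z τ = z (a, b, c) := by
    have hδ (a b c) : ∑ τ : α × α × α, κ (δ τ.1 a * δ τ.2.1 b * δ τ.2.2 c) * z τ =
        z (a, b, c) := by
      rw [Finset.sum_eq_single (a, b, c)]
      · simp [δ]
      · rintro ⟨a', b', c'⟩ _ h
        by_cases ha : a' = a
        · by_cases hb : b' = b
          · by_cases hc : c' = c
            · exact absurd (by rw [ha, hb, hc]) h
            · simp [δ, hc]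
          · simp [δ, hb]
        · simp [δ, ha]
      · simp
    have h6' : κ 6 ≠ 0 := (map_ne_zero κ).mpr h6
    have h1 : κ 6 * ∑ τ, κ (sym τ a b c) * z τ = κ 6 * z (a, b, c) := by
      rw [Finset.mul_sum]
      have h2 (τ) : κ 6 * (κ (sym τ a b c) * z τ) =
          κ (δ τ.1 a * δ τ.2.1 b * δ τ.2.2 c) * z τ + κ (δ τ.1 b * δ τ.2.1 a * δ τ.2.2 c) * z τ +
          κ (δ τ.1 a * δ τ.2.1 c * δ τ.2.2 b) * z τ + κ (δ τ.1 c * δ τ.2.1 b * δ τ.2.2 a) * z τ +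
          κ (δ τ.1 b * δ τ.2.1 c * δ τ.2.2 a) * z τ +
          κ (δ τ.1 c * δ τ.2.1 a * δ τ.2.2 b) * z τ := by
        simp only [← add_mul, ← mul_assoc, ← map_add, ← map_mul]
        congr 2
        simp only [sym]
        field_simp
      simp only [h2, Finset.sum_add_distrib, hδ]
      rw [hz₁ b a c, hz₂ a c b, hz₁ c b a, hz₂ b c a, hz₁ b a c, hz₂ c a b, hz₁ c b a, hz₂ b c a,
        hz₁ b a c, map_ofNat]
      ring
    exact mul_left_cancel₀ h6' h1
  refine ⟨fun i a => κ (P i a) + n i a, s, hs, fun a b c => ?_, fun i => ?_⟩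
  · have h1 : ∑ i, κ (ε i) * (κ (P i a) * κ (P i b) * n i c + κ (P i a) * n i b * κ (P i c) +
        n i a * κ (P i b) * κ (P i c)) = z (a, b, c) := by
      rw [← hsym]
      simp only [← hl, n, Finset.mul_sum, Finset.sum_mul, map_sum, ← Finset.sum_add_distrib]
      rw [Finset.sum_comm]
      refine Finset.sum_congr rfl fun τ _ => Finset.sum_congr rfl fun i _ => ?_
      simp only [map_mul, map_add]
      ring
    rw [← eq_sub_iff_add_eq.mp (hz' a b c), ← h1, map_sum, ← Finset.sum_add_distrib,
      ← Finset.sum_add_distrib]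
    refine Finset.sum_congr rfl fun i _ => ?_
    simp only [map_mul]
    ring
  · have h1 := hg (∑ a, C (w a) * (C (P i a) + lin i a)) ?_
    · rw [← coe_eval₂Hom] at h1
      simpa only [map_sum, map_mul, map_add, coe_eval₂Hom, eval₂_C, hn] using h1
    · have h2 (a) : constantCoeff (lin i a) = 0 := by simp [lin]
      simpa [h2] using hw i

end SumsOfCubes

section AffineCube

/-- The vector space `𝔽₂³`. -/
abbrev AffineCube : Type := ZMod 2 × ZMod 2 × ZMod 2

namespace AffineCube

/-- The characters of `𝔽₂³`. -/
def chi (j a : AffineCube) : ℤ :=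
  if j.1 * a.1 + j.2.1 * a.2.1 + j.2.2 * a.2.2 = 0 then 1 else -1

lemma chi_add (j a b : AffineCube) : chi j (a + b) = chi j a * chi j b := by
  revert j a b; decide +kernel

lemma sum_chi (a : AffineCube) : ∑ j, chi j a = if a = 0 then 8 else 0 := by
  revert a; decide +kernel

/-- Six times the coefficient of the line `{x, y, x + y}` of the Fano plane in the inverse of the
incidence matrix of the plane, at the point `a`. -/
def fano (a x y : AffineCube) : ℤ :=
  if x = y ∨ x = 0 ∨ y = 0 then 0 else
    3 * ((if a = x then 1 else 0) + (if a = y then 1 else 0) + (if a = x + y then 1 else 0)) - 1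

lemma fano_add_fano_add_fano (a b x y : AffineCube) (hab : a ≠ b) (ha : a ≠ 0) (hb : b ≠ 0) :
    fano a x y + fano b x y + fano (a + b) x y =
      6 * ((if x = a then if y = b then 1 else 0 else 0) +
        (if x = b then if y = a then 1 else 0 else 0) +
        (if x = a then if y = a + b then 1 else 0 else 0) +
        (if x = a + b then if y = a then 1 else 0 else 0) +
        (if x = b then if y = a + b then 1 else 0 else 0) +
        (if x = a + b then if y = b then 1 else 0 else 0)) := by
  revert a b x y; decide +kernel

variable {K : Type*} [Field K]

lemma exists_sum_eq_of_ne (h2 : (2 : K) ≠ 0) (h3 : (3 : K) ≠ 0)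
    {θ : AffineCube → AffineCube → AffineCube → K} (h₁ : ∀ a b c, θ a b c = θ b a c)
    (h₂ : ∀ a b c, θ a b c = θ a c b) :
    ∃ m : AffineCube → AffineCube → K, ∀ a b c, a ≠ b → a ≠ c → b ≠ c →
      m a (b + c) + m b (a + c) + m c (a + b) = θ a b c := by
  refine ⟨fun c d => (∑ x, ∑ y,
      (fano d x y : K) * θ (c + d + x) (c + d + y) (c + d + (x + y))) / 36,
    fun a b c hab hac hbc => ?_⟩
  have e₁ : b + (a + c) = a + (b + c) := by abel
  have e₂ : c + (a + b) = a + (b + c) := by abel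
  have e₃ (a b : AffineCube) : a + b + b = a := by revert a b; decide +kernel
  have e₄ (a b c : AffineCube) : b + c + (a + c) = a + b := by revert a b c; decide +kernel
  have e₇ (a b c : AffineCube) : b + c + (a + b) = a + c := by revert a b c; decide +kernel
  have e₈ (a b c : AffineCube) : a + c + (a + b) = b + c := by revert a b c; decide +kernel
  have e₅ (a b : AffineCube) : a ≠ b → a + b ≠ 0 := by revert a b; decide +kernel
  have e₆ (a b c : AffineCube) : a ≠ b → b + c ≠ a + c := by revert a b c; decide +kernel
  simp only [e₁, e₂]
  rw [← add_div, ← add_div]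
  let G : AffineCube → AffineCube → K := fun x y =>
    θ (a + (b + c) + x) (a + (b + c) + y) (a + (b + c) + (x + y))
  change (∑ x, ∑ y, (fano (b + c) x y : K) * G x y + ∑ x, ∑ y, (fano (a + c) x y : K) * G x y +
    ∑ x, ∑ y, (fano (a + b) x y : K) * G x y) / 36 = θ a b c
  have hsum (a₀ b₀ : AffineCube) :
      ∑ x, ∑ y, (if x = a₀ then if y = b₀ then (1 : K) else 0 else 0) * G x y = G a₀ b₀ := by
    rw [Finset.sum_eq_single a₀, Finset.sum_eq_single b₀] <;> simp +contextual
  have h1 (x y) : (fano (b + c) x y : K) * G x y + fano (a + c) x y * G x y +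
      fano (a + b) x y * G x y = 6 * (
        (if x = b + c then if y = a + c then 1 else 0 else 0) * G x y +
        (if x = a + c then if y = b + c then 1 else 0 else 0) * G x y +
        (if x = b + c then if y = a + b then 1 else 0 else 0) * G x y +
        (if x = a + b then if y = b + c then 1 else 0 else 0) * G x y +
        (if x = a + c then if y = a + b then 1 else 0 else 0) * G x y +
        (if x = a + b then if y = a + c then 1 else 0 else 0) * G x y) := by
    have h := congrArg (Int.cast : ℤ → K)
      (fano_add_fano_add_fano (b + c) (a + c) x y (e₆ a b c hab) (e₅ b c hbc) (e₅ a c hac))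
    rw [e₄] at h
    push_cast at h
    simp only [← add_mul, ← mul_assoc, ← h]
  have hGs (x y) : G x y = G y x := by simp only [G]; rw [h₁, add_comm x y]
  have hG₁ : G (b + c) (a + c) = θ a b c := by
    simp only [G]
    rw [e₄, show a + (b + c) + (a + c) = b by rw [← e₁, e₃], e₃,
      show a + (b + c) + (a + b) = c by rw [← e₂, e₃]]
  have hG₂ : G (b + c) (a + b) = θ a b c := by
    simp only [G]
    rw [e₇,
      show a + (b + c) + (a + c) = b by rw [← e₁, e₃], e₃,
      show a + (b + c) + (a + b) = c by rw [← e₂, e₃], h₂]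
  have hG₃ : G (a + c) (a + b) = θ a b c := by
    simp only [G]
    rw [e₈ a b c,
      show a + (b + c) + (a + c) = b by rw [← e₁, e₃], e₃,
      show a + (b + c) + (a + b) = c by rw [← e₂, e₃], h₂, h₁]
  simp only [← Finset.sum_add_distrib]
  simp only [h1, ← Finset.mul_sum, Finset.sum_add_distrib, hsum]
  rw [hGs (a + c) (b + c), hGs (a + b) (b + c), hGs (a + b) (a + c), hG₁, hG₂, hG₃]
  have h36 : (36 : K) ≠ 0 := by
    rw [show (36 : K) = 2 * 2 * (3 * 3) by norm_num]
    exact mul_ne_zero (mul_ne_zero h2 h2) (mul_ne_zero h3 h3)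
  field_simp
  ring

/-- The coordinate functionals and the characters of `𝔽₂³`, as elements of `K ^ 8`. -/
def linearForm (K : Type*) [Field K] : AffineCube ⊕ AffineCube → AffineCube → K
  | .inl d, a => if d = a then 1 else 0
  | .inr j, a => chi j a

/-- The squares of the forms `linearForm` generate, in degree three, all cubic forms. -/
lemma exists_sum_linearForm_eq (h2 : (2 : K) ≠ 0) (h3 : (3 : K) ≠ 0)
    {θ : AffineCube → AffineCube → AffineCube → K} (h₁ : ∀ a b c, θ a b c = θ b a c)
    (h₂ : ∀ a b c, θ a b c = θ a c b) :
    ∃ l : AffineCube ⊕ AffineCube → AffineCube → K, ∀ a b c, ∑ i,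
      (linearForm K i a * linearForm K i b * l i c + linearForm K i a * l i b * linearForm K i c +
        l i a * linearForm K i b * linearForm K i c) = θ a b c := by
  obtain ⟨m, hm⟩ := exists_sum_eq_of_ne h2 h3 h₁ h₂
  have h8 : (8 : K) ≠ 0 := by
    rw [show (8 : K) = 2 * (2 * 2) by norm_num]
    exact mul_ne_zero h2 (mul_ne_zero h2 h2)
  have e (a b : AffineCube) : a + b = 0 ↔ b = a := by revert a b; decide +kernel
  have hchi (a b : AffineCube) : ∑ j, (chi j a : K) * chi j b = if b = a then 8 else 0 := by
    have h := congrArg (Int.cast : ℤ → K) (sum_chi (a + b))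
    simp only [chi_add, e] at h
    push_cast at h
    exact h
  let r (j c : AffineCube) : K := (∑ d, chi j d * m c d) / 8
  have hr (a b c) : ∑ j, (chi j a : K) * chi j b * r j c = m c (a + b) := by
    have h1 (j) : (chi j a : K) * chi j b * r j c =
        (∑ d, chi j (a + b) * chi j d * m c d) / 8 := by
      simp only [r, chi_add, ← Finset.mul_sum, mul_assoc]
      push_cast
      ring
    simp only [h1, ← Finset.sum_div]
    rw [Finset.sum_comm]
    simp only [← Finset.sum_mul, hchi]
    simp [h8]
  let ρ (a b c : AffineCube) : K := θ a b c - (m a (b + c) + m b (a + c) + m c (a + b))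
  have hρ₁ (a b c) : ρ a b c = ρ b a c := by
    simp only [ρ]; rw [h₁, add_comm a b]; ring
  have hρ₂ (a b c) : ρ a b c = ρ a c b := by
    simp only [ρ]; rw [h₂, add_comm b c]; ring
  let l (a c : AffineCube) : K := if a = c then ρ a a a / 3 else ρ a a c
  refine ⟨Sum.elim l r, fun a b c => ?_⟩
  rw [Fintype.sum_sum_type]
  have h5 : ∑ j, (linearForm K (.inr j) a * linearForm K (.inr j) b * r j c +
      linearForm K (.inr j) a * r j b * linearForm K (.inr j) c +
        r j a * linearForm K (.inr j) b * linearForm K (.inr j) c) = θ a b c - ρ a b c := by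
    simp only [linearForm, ρ, sub_sub_cancel, ← hr, ← Finset.sum_add_distrib]
    exact Finset.sum_congr rfl fun j _ => by ring
  have h6 : ∑ d, (linearForm K (.inl d) a * linearForm K (.inl d) b * l d c +
      linearForm K (.inl d) a * l d b * linearForm K (.inl d) c +
        l d a * linearForm K (.inl d) b * linearForm K (.inl d) c) = ρ a b c := by
    simp only [linearForm, Finset.sum_add_distrib, ite_mul, mul_ite, one_mul, zero_mul, mul_one,
      mul_zero, Finset.sum_ite_eq', Finset.mem_univ,
        if_true]
    by_cases hab : a = b
    · subst hab
      by_cases hac : a = c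
      · subst hac
        simp [l]
        field_simp
        ring
      · simp [l, hac, Ne.symm hac]
    · by_cases hac : a = c
      · subst hac
        simp only [l, hab, Ne.symm hab, if_true, if_false, zero_add, add_zero]
        rw [hρ₂]
      · by_cases hbc : b = c
        · subst hbc
          simp only [l, Ne.symm hac, if_true, if_false, zero_add]
          rw [hρ₁ a, hρ₂]
        · simp [Ne.symm hab, Ne.symm hac, Ne.symm hbc, ρ, hm a b c hab hac hbc]
  simp only [Sum.elim_inl, Sum.elim_inr, h5, h6]
  ring

/-- The vector along which the base point of the deformation is a cone. -/
def apex (a : AffineCube) : ℤ := if a = 0 then 2 else 1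

lemma sum_apex_mul_chi (j : AffineCube) : ∑ a, apex a * chi j a = if j = 0 then 9 else 1 := by
  revert j; decide +kernel

lemma exists_sum_cubes_eq [IsAlgClosed K] (h2 : (2 : K) ≠ 0) (h3 : (3 : K) ≠ 0)
    {T : AffineCube → AffineCube → AffineCube → K}
    (h₁ : ∀ a b c, T a b c = T b a c) (h₂ : ∀ a b c, T a b c = T a c b)
    (hT : ∀ b c, ∑ a, apex a * T a b c = 0)
    {κ : K →+* LaurentSeries K}
    (hκ : κ = (algebraMap (PowerSeries K) (LaurentSeries K)).comp PowerSeries.C) :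
    ∃ (ε : AffineCube ⊕ AffineCube → LaurentSeries K)
      (x : AffineCube ⊕ AffineCube → AffineCube → LaurentSeries K)
      (T' : AffineCube → AffineCube → AffineCube → PowerSeries K),
      (∀ a b c, PowerSeries.constantCoeff (T' a b c) = T a b c) ∧
      (∀ a b c, ∑ i, ε i * (x i a * x i b * x i c) =
        algebraMap (PowerSeries K) (LaurentSeries K) (T' a b c)) ∧
      (∀ b c, ∑ a, (apex a : PowerSeries K) * T' a b c = 0) ∧
      ∀ i, ∑ a, (apex a : LaurentSeries K) * x i a ≠ 0 := by
  have h8 : (8 : K) ≠ 0 := by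
    rw [show (8 : K) = 2 * (2 * 2) by norm_num]
    exact mul_ne_zero h2 (mul_ne_zero h2 h2)
  have h9 : (9 : K) ≠ 0 := by
    rw [show (9 : K) = 3 * 3 by norm_num]
    exact mul_ne_zero h3 h3
  have hapex (a) : (apex a : K) ≠ 0 := by
    unfold apex; split_ifs <;> simp [h2]
  have hchi (j) : ∑ a, (apex a : K) * chi j a ≠ 0 := by
    have h := congrArg (Int.cast : ℤ → K) (sum_apex_mul_chi j)
    push_cast at h
    rw [h]; split_ifs <;> simp [h9]
  let ε : AffineCube ⊕ AffineCube → K :=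
    Sum.elim (fun a => 8 / apex a) fun j => -(∑ a, (apex a : K) * chi j a)⁻¹
  have hε (i) : ε i ≠ 0 := by
    rcases i with a | j
    · exact div_ne_zero h8 (hapex a)
    · exact neg_ne_zero.mpr (inv_ne_zero (hchi j))
  let P := linearForm K
  have hw (i) : ∑ a, (apex a : K) * P i a ≠ 0 := by
    rcases i with a | j
    · simpa [P, linearForm] using hapex a
    · exact hchi j
  let T₀ (a b c : AffineCube) : K := ∑ i, ε i * (P i a * P i b * P i c)
  have hT₀ (b c) : ∑ a, (apex a : K) * T₀ a b c = 0 := by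
    have e (a b : AffineCube) : a + b = 0 ↔ b = a := by revert a b; decide +kernel
    have h := congrArg (Int.cast : ℤ → K) (sum_chi (b + c))
    simp only [chi_add, e] at h
    push_cast at h
    simp only [T₀, Finset.mul_sum]
    rw [Finset.sum_comm]
    have h1 (i) : ∑ a, (apex a : K) * (ε i * (P i a * P i b * P i c)) =
        ε i * (∑ a, (apex a : K) * P i a) * (P i b * P i c) := by
      rw [Finset.mul_sum, Finset.sum_mul]
      exact Finset.sum_congr rfl fun a _ => by ring
    simp only [h1]
    rw [Fintype.sum_sum_type]
    have h4 (a) : ε (.inl a) * ∑ a', (apex a' : K) * P (.inl a) a' = 8 := by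
      simp [ε, P, linearForm, hapex]
    have h5 (j) : ε (.inr j) * ∑ a', (apex a' : K) * P (.inr j) a' = -1 := by
      simp only [ε, Sum.elim_inr, P, linearForm, neg_mul]
      rw [inv_mul_cancel₀ (hchi j)]
    simp only [h4, h5]
    simp only [P, linearForm, neg_mul, one_mul, Finset.sum_neg_distrib]
    rw [h]
    simp
  obtain ⟨x, s, hs, hx, hxw⟩ := exists_laurentSeries_sum_cubes_eq h2 h3 ε P
    (fun θ hθ₁ hθ₂ => by
      obtain ⟨l, hl⟩ := exists_sum_linearForm_eq h2 h3 hθ₁ hθ₂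
      refine ⟨fun i a => (ε i)⁻¹ * l i a, fun a b c => ?_⟩
      rw [← hl]
      refine Finset.sum_congr rfl fun i _ => ?_
      have := hε i
      simp only [P]
      field_simp)
    (fun a b c => T a b c - T₀ a b c)
    (fun a b c => by
      rw [h₁]; congr 1; exact Finset.sum_congr rfl fun i _ => by ring)
    (fun a b c => by
      rw [h₂]; congr 1; exact Finset.sum_congr rfl fun i _ => by ring)
    (fun a => (apex a : K)) hw hκ
  refine ⟨fun i => κ (ε i), x, fun a b c => PowerSeries.C (T₀ a b c) +
    s * PowerSeries.C (T a b c - T₀ a b c), fun a b c => ?_, fun a b c => ?_, fun b c => ?_,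
    fun i => ?_⟩
  · simp [hs]
  · rw [hx, map_add, hκ]; rfl
  · have h1 (r : AffineCube → K) : ∑ a, (apex a : PowerSeries K) * PowerSeries.C (r a) =
        PowerSeries.C (∑ a, (apex a : K) * r a) := by
      simp
    simp only [mul_add, Finset.sum_add_distrib, mul_left_comm _ s, ← Finset.mul_sum, h1]
    simp only [mul_sub, Finset.sum_sub_distrib, hT, hT₀]
    simp
  · simpa using hxw i

/-- Every cubic form in seven variables is the special fibre of a family of cubic forms whose
general member is apolar to sixteen points, with all lower moments vanishing. -/
lemma exists_moments_eq [IsAlgClosed K] (h2 : (2 : K) ≠ 0) (h3 : (3 : K) ≠ 0)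
    {T : Fin 7 → Fin 7 → Fin 7 → K}
    (h₁ : ∀ i j k, T i j k = T j i k) (h₂ : ∀ i j k, T i j k = T i k j) :
    ∃ (φ : AffineCube ⊕ AffineCube → LaurentSeries K)
      (v : Fin 7 → AffineCube ⊕ AffineCube → LaurentSeries K)
      (T' : Fin 7 → Fin 7 → Fin 7 → PowerSeries K),
      (∀ i j k, PowerSeries.constantCoeff (T' i j k) = T i j k) ∧
      ∑ a, φ a = 0 ∧ (∀ i, ∑ a, φ a * v i a = 0) ∧ (∀ i j, ∑ a, φ a * (v i a * v j a) = 0) ∧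
      ∀ i j k, ∑ a, φ a * (v i a * v j a * v k a) =
        algebraMap (PowerSeries K) (LaurentSeries K) (T' i j k) := by
  let f : Fin 7 → AffineCube :=
    ![(0, 0, 1), (0, 1, 0), (0, 1, 1), (1, 0, 0), (1, 0, 1), (1, 1, 0), (1, 1, 1)]
  have hf : ∀ i, f i ≠ 0 := by decide +kernel
  have hf' : ∀ i j, f i = f j ↔ j = i := by decide +kernel
  let π (a : AffineCube) (i : Fin 7) : K := if a = 0 then -1 / 2 else if a = f i then 1 else 0
  have hπ (i) : ∑ a, (apex a : K) * π a i = 0 := by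
    have h5 (a) : (apex a : K) * π a i = (if a = 0 then -1 else 0) + if a = f i then 1 else 0 := by
      by_cases ha : a = 0
      · subst ha
        simp only [apex, π, if_true, (hf i).symm, if_false]
        push_cast
        field_simp
        simp
      · simp [apex, π, ha]
    simp only [h5, Finset.sum_add_distrib, Finset.sum_ite_eq', Finset.mem_univ,
        if_true]
    ring
  let S (a b c : AffineCube) : K := ∑ i, ∑ j, ∑ k, π a i * π b j * π c k * T i j k
  obtain ⟨ε, x, S', hS', hx, hw, hxw⟩ := exists_sum_cubes_eq h2 h3 (T := S)
    (fun a b c => by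
      simp only [S]
      rw [Finset.sum_comm]
      refine Finset.sum_congr rfl fun i _ => Finset.sum_congr rfl fun j _ =>
        Finset.sum_congr rfl fun k _ => ?_
      rw [h₁]; ring)
    (fun a b c => by
      refine Finset.sum_congr rfl fun i _ => ?_
      rw [Finset.sum_comm]
      refine Finset.sum_congr rfl fun j _ => Finset.sum_congr rfl fun k _ => ?_
      rw [h₂]; ring)
    (fun b c => by
      simp only [S, Finset.mul_sum]
      rw [Finset.sum_comm]
      refine Finset.sum_eq_zero fun i _ => ?_
      rw [Finset.sum_comm]
      refine Finset.sum_eq_zero fun j _ => ?_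
      rw [Finset.sum_comm]
      refine Finset.sum_eq_zero fun k _ => ?_
      simp only [← mul_assoc, ← Finset.sum_mul, hπ, zero_mul]) rfl
  let u (i : AffineCube ⊕ AffineCube) : LaurentSeries K := ∑ a, (apex a : LaurentSeries K) * x i a
  have hu (i) : u i ≠ 0 := hxw i
  have hux (b c) : ∑ i, ε i * (u i * x i b * x i c) = 0 := by
    have h6 (i) : ε i * (u i * x i b * x i c) =
        ∑ a, (apex a : LaurentSeries K) * (ε i * (x i a * x i b * x i c)) := by
      simp only [u, Finset.sum_mul, Finset.mul_sum]
      exact Finset.sum_congr rfl fun a _ => by ring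
    simp only [h6]
    rw [Finset.sum_comm]
    simp only [← Finset.mul_sum, hx]
    have h7 := congrArg (algebraMap (PowerSeries K) (LaurentSeries K)) (hw b c)
    simpa using h7
  have huu (c) : ∑ i, ε i * (u i * u i * x i c) = 0 := by
    have h6 (i) : ε i * (u i * u i * x i c) =
        ∑ a, (apex a : LaurentSeries K) * (ε i * (u i * x i a * x i c)) := by
      nth_rw 2 [show u i = ∑ a, (apex a : LaurentSeries K) * x i a from rfl]
      simp only [Finset.sum_mul, Finset.mul_sum]
      exact Finset.sum_congr rfl fun a _ => by ring
    simp only [h6]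
    rw [Finset.sum_comm]
    simp only [← Finset.mul_sum, hux, mul_zero, Finset.sum_const_zero]
  have huuu : ∑ i, ε i * (u i * u i * u i) = 0 := by
    have h6 (i) : ε i * (u i * u i * u i) =
        ∑ a, (apex a : LaurentSeries K) * (ε i * (u i * u i * x i a)) := by
      nth_rw 3 [show u i = ∑ a, (apex a : LaurentSeries K) * x i a from rfl]
      simp only [Finset.mul_sum]
      exact Finset.sum_congr rfl fun a _ => by ring
    simp only [h6]
    rw [Finset.sum_comm]
    simp only [← Finset.mul_sum, huu, mul_zero, Finset.sum_const_zero]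
  refine ⟨fun a => ε a * (u a * u a * u a), fun i a => x a (f i) / u a,
    fun i j k => S' (f i) (f j) (f k), fun i j k => ?_, huuu, fun i => ?_, fun i j => ?_,
    fun i j k => ?_⟩
  · rw [hS']
    simp [S, π, hf, hf']
  · rw [← huu (f i)]
    refine Finset.sum_congr rfl fun a _ => ?_
    have := hu a
    field_simp
  · rw [← hux (f i) (f j)]
    refine Finset.sum_congr rfl fun a _ => ?_
    have := hu a
    field_simp
  · rw [← hx]
    refine Finset.sum_congr rfl fun a _ => ?_
    have := hu a
    field_simp

end AffineCube

end AffineCube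

section FlatFamily

open MvPolynomial Matrix TensorProduct

/-- The Gram matrix of a family of vectors for a diagonal bilinear form. -/
def diagonalGram {F ι : Type*} [CommRing F] [Fintype ι] (φ : ι → F) (e : ι → ι → F) :
    Matrix ι ι F :=
  Matrix.of fun i j => ∑ a, φ a * (e i a * e j a)

lemma diagonalGram_eq_mul {F ι : Type*} [CommRing F] [Fintype ι] [DecidableEq ι] (φ : ι → F)
    (e : ι → ι → F) :
    diagonalGram φ e = Matrix.of e * (diagonal φ * (Matrix.of e)ᵀ) := by
  ext i j
  rw [mul_apply]
  simp only [diagonalGram, of_apply, diagonal_mul, transpose_apply]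
  exact Finset.sum_congr rfl fun a _ => by ring

lemma eq_zero_of_det_diagonalGram_ne_zero {F ι : Type*} [Field F] [Fintype ι] [DecidableEq ι]
    {φ : ι → F} {e : ι → ι → F} (h : (diagonalGram φ e).det ≠ 0) {w : ι → F}
    (hw : ∀ j, ∑ a, φ a * (w a * e j a) = 0) : w = 0 := by
  rw [diagonalGram_eq_mul, det_mul] at h
  refine eq_zero_of_vecMul_eq_zero (right_ne_zero_of_mul h) ?_
  ext j
  simp only [vecMul, dotProduct, diagonal_mul, transpose_apply, of_apply, Pi.zero_apply]
  rw [← hw j]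
  exact Finset.sum_congr rfl fun a _ => by ring

lemma linearIndependent_of_det_diagonalGram_ne_zero {F ι : Type*} [Field F] [Fintype ι]
    [DecidableEq ι] {φ : ι → F} {e : ι → ι → F} (h : (diagonalGram φ e).det ≠ 0) :
    LinearIndependent F e := by
  rw [diagonalGram_eq_mul, det_mul] at h
  exact linearIndependent_rows_of_det_ne_zero (A := Matrix.of e) (left_ne_zero_of_mul h)

lemma det_pairing_ne_zero {K A ι : Type*} [Field K] [CommRing A] [Algebra K A] [Fintype ι]
    [DecidableEq ι] (b : Module.Basis ι K A) (ε : A →ₗ[K] K)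
    (hε : ∀ x, (∀ y, ε (x * y) = 0) → x = 0) :
    (Matrix.of fun i j => ε (b i * b j)).det ≠ 0 := by
  intro h
  obtain ⟨c, hc, hc0⟩ := exists_vecMul_eq_zero_iff.mpr h
  refine hc ?_
  have h1 : ∑ i, c i • b i = 0 := by
    refine hε _ fun y => ?_
    suffices ε ∘ₗ LinearMap.mulLeft K (∑ i, c i • b i) = 0 from LinearMap.congr_fun this y
    refine b.ext fun j => ?_
    have := congrFun hc0 j
    simpa [vecMul, dotProduct, Finset.sum_mul] using this
  funext i
  exact (Fintype.linearIndependent_iff.mp b.linearIndependent) c h1 i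

/-- The moment functional on polynomials. -/
noncomputable def momentFunctional {O σ : Type*} [CommRing O] (M : (σ →₀ ℕ) → O) :
    MvPolynomial σ O →ₗ[O] O :=
  (basisMonomials σ O).constr O M

lemma momentFunctional_monomial {O σ : Type*} [CommRing O] (M : (σ →₀ ℕ) → O) (m : σ →₀ ℕ)
    (x : O) : momentFunctional M (monomial m x) = x * M m := by
  have : momentFunctional M (monomial m 1) = M m := by
    simpa [momentFunctional] using (basisMonomials σ O).constr_basis O M m
  rw [← mul_one x, ← smul_eq_mul, ← smul_monomial, map_smul, this]
  simp

lemma algebraMap_momentFunctional {O F σ ι : Type*} [CommRing O] [Field F] [Algebra O F]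
    [Fintype ι] {φ : ι → F} {v : σ → ι → F} {M : (σ →₀ ℕ) → O}
    (hM : ∀ m : σ →₀ ℕ, ∑ a, φ a * (m.prod fun i k => v i ^ k) a = algebraMap O F (M m))
    (f : MvPolynomial σ O) :
    algebraMap O F (momentFunctional M f) = ∑ a, φ a * aeval v f a := by
  induction f using MvPolynomial.induction_on' with
  | monomial m x =>
    rw [momentFunctional_monomial, map_mul, ← hM, Finset.mul_sum, aeval_monomial]
    refine Finset.sum_congr rfl fun a _ => ?_
    simp only [Pi.mul_apply, Pi.algebraMap_apply]
    ring
  | add p q hp hq =>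
    simp only [map_add, hp, hq, Pi.add_apply, mul_add, Finset.sum_add_distrib]

lemma residue_momentFunctional {K O σ : Type*} [Field K] [CommRing O] [Algebra K O]
    (res : O →ₐ[K] K) {M : (σ →₀ ℕ) → O} {ε : MvPolynomial σ K →ₗ[K] K}
    (hM : ∀ m, res (M m) = ε (monomial m 1)) (f : MvPolynomial σ O) :
    res (momentFunctional M f) = ε (MvPolynomial.map (res : O →+* K) f) := by
  induction f using MvPolynomial.induction_on' with
  | monomial m x =>
    rw [momentFunctional_monomial, map_mul, hM, map_monomial]
    conv_rhs => rw [← mul_one ((res : O →+* K) x), ← smul_eq_mul, ← smul_monomial, map_smul]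
    rfl
  | add p q hp hq => simp only [map_add, hp, hq]

lemma diagonalGram_aeval {O F σ ι : Type*} [CommRing O] [Field F] [Algebra O F]
    [Fintype ι] [DecidableEq ι] {φ : ι → F} {v : σ → ι → F} {M : (σ →₀ ℕ) → O}
    (hM : ∀ m : σ →₀ ℕ, ∑ a, φ a * (m.prod fun i k => v i ^ k) a = algebraMap O F (M m))
    (b : ι → MvPolynomial σ O) :
    diagonalGram φ (fun i => aeval v (b i)) =
      (algebraMap O F).mapMatrix (Matrix.of fun i j => momentFunctional M (b i * b j)) := by
  ext i j
  simp [diagonalGram, algebraMap_momentFunctional hM]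

lemma aeval_eq_sum_of_isUnit_det {O F σ ι : Type*} [CommRing O] [Field F] [Algebra O F]
    [Fintype ι] [DecidableEq ι] {φ : ι → F} {v : σ → ι → F} {M : (σ →₀ ℕ) → O}
    (hM : ∀ m : σ →₀ ℕ, ∑ a, φ a * (m.prod fun i k => v i ^ k) a = algebraMap O F (M m))
    {b : ι → MvPolynomial σ O} {G : Matrix ι ι O}
    (hG : G = Matrix.of fun i j => momentFunctional M (b i * b j)) (hdet : IsUnit G.det)
    (f : MvPolynomial σ O) :
    aeval v f =
      ∑ i, ((fun j => momentFunctional M (f * b j)) ᵥ* G⁻¹) i • aeval v (b i) := by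
  set c : ι → O := (fun j => momentFunctional M (f * b j)) ᵥ* G⁻¹ with hc
  have hcG : c ᵥ* G = fun j => momentFunctional M (f * b j) := by
    rw [hc, vecMul_vecMul, nonsing_inv_mul _ hdet, vecMul_one]
  have hne : (diagonalGram φ (fun i => aeval v (b i))).det ≠ 0 := by
    rw [diagonalGram_aeval hM, ← hG, ← RingHom.map_det]
    exact (hdet.map (algebraMap O F)).ne_zero
  rw [← sub_eq_zero]
  have hsum : aeval v f - ∑ i, c i • aeval v (b i) = aeval v (f - ∑ i, c i • b i) := by
    simp
  rw [hsum]
  refine eq_zero_of_det_diagonalGram_ne_zero hne fun j => ?_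
  have h := congrFun hcG j
  have : momentFunctional M ((f - ∑ i, c i • b i) * b j) = 0 := by
    rw [sub_mul, map_sub, ← h, Finset.sum_mul, map_sum]
    simp [vecMul, dotProduct, hG]
  rw [← map_zero (algebraMap O F), ← this, algebraMap_momentFunctional hM, map_mul]
  rfl

/-- The tensor product with `F` of an `O`-subalgebra of `F^ι` having an `O`-basis that is also an
`F`-basis of `F^ι` is étale. -/
lemma etale_tensorProduct_subalgebra {O F ι : Type*} [CommRing O] [Field F] [Algebra O F]
    [Fintype ι] (B : Subalgebra O (ι → F)) (b : Module.Basis ι O B)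
    (hb : LinearIndependent F fun i => (b i : ι → F)) :
    Algebra.Etale F (F ⊗[O] B) := by
  let θ : F ⊗[O] B →ₐ[F] (ι → F) :=
    Algebra.TensorProduct.lift (Algebra.ofId F (ι → F)) B.val fun _ _ => Commute.all _ _
  let b₁ := Algebra.TensorProduct.basis F b
  let b₂ : Module.Basis ι F (ι → F) := basisOfLinearIndependentOfCardEqFinrank' _ hb (by simp)
  have hθ : ∀ i, θ (b₁ i) = b₂ i := by
    intro i
    simp [θ, b₁, b₂]
  have hbij : Function.Bijective θ := by
    have : θ.toLinearMap = (b₁.equiv b₂ (Equiv.refl ι)).toLinearMap :=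
      b₁.ext fun i => by simp [hθ]
    have h2 : (θ : F ⊗[O] B → ι → F) = b₁.equiv b₂ (Equiv.refl ι) :=
      funext fun x => LinearMap.congr_fun this x
    rw [h2]
    exact LinearEquiv.bijective _
  exact Algebra.Etale.of_equiv (AlgEquiv.ofBijective θ hbij).symm

theorem exists_flat_family {K O F σ ι : Type} [Field K] [CommRing O] [Field F] [Algebra K O]
    [Algebra O F] [FaithfulSMul O F] [Fintype ι] {t : O} {res : O →ₐ[K] K}
    (hres : ∀ x, res x = 0 ↔ t ∣ x) (hunit : ∀ x, res x ≠ 0 → IsUnit x)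
    {I : Ideal (MvPolynomial σ K)} (bI : Module.Basis ι K (MvPolynomial σ K ⧸ I))
    {ε : MvPolynomial σ K →ₗ[K] K} (hε : ∀ f, f ∈ I ↔ ∀ g, ε (f * g) = 0)
    {φ : ι → F} {v : σ → ι → F} {M : (σ →₀ ℕ) → O}
    (hM : ∀ m : σ →₀ ℕ, ∑ a, φ a * (m.prod fun i k => v i ^ k) a = algebraMap O F (M m))
    (hMε : ∀ m, res (M m) = ε (monomial m 1)) :
    ∃ (B : Type) (_ : CommRing B) (_ : Algebra O B) (_ : Algebra K B) (_ : IsScalarTower K O B),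
      Module.Free O B ∧ Module.finrank O B = Fintype.card ι ∧
      Nonempty ((B ⧸ Ideal.span {algebraMap O B t}) ≃ₐ[K] MvPolynomial σ K ⧸ I) ∧
      Algebra.Etale F (F ⊗[O] B) := by
  classical
  have : Nontrivial O := (algebraMap O F).domain_nontrivial
  -- the residue of the moment functional, and lifts of polynomials
  let L : MvPolynomial σ K →ₐ[K] MvPolynomial σ O := MvPolynomial.mapAlgHom (Algebra.ofId K O)
  have hL : ∀ f, MvPolynomial.map (res : O →+* K) (L f) = f := by
    intro f
    have h : (res : O →+* K).comp (algebraMap K O) = RingHom.id K := by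
      ext x; simp
    change MvPolynomial.map (res : O →+* K) (MvPolynomial.map (algebraMap K O) f) = f
    rw [MvPolynomial.map_map, h, MvPolynomial.map_id]
  have hLX : ∀ i, L (X i) = X i := by intro i; simp [L]
  have hmom : ∀ f, res (momentFunctional M f) = ε (MvPolynomial.map (res : O →+* K) f) :=
    residue_momentFunctional res hMε
  -- the basis
  choose b hb using fun i => Ideal.Quotient.mk_surjective (bI i)
  let G : Matrix ι ι O := Matrix.of fun i j => momentFunctional M (L (b i) * L (b j))
  have hdet : IsUnit G.det := by
    apply hunit
    let εI : (MvPolynomial σ K ⧸ I) →ₗ[K] K :=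
      (I.restrictScalars K).liftQ ε fun f hf => by simpa using (hε f).mp hf 1
    have hεI : ∀ f, εI (Ideal.Quotient.mk I f) = ε f := fun f => rfl
    have := det_pairing_ne_zero bI εI (by
      intro x hx
      obtain ⟨f, rfl⟩ := Ideal.Quotient.mk_surjective x
      rw [Ideal.Quotient.eq_zero_iff_mem, hε]
      intro g
      rw [← hεI, map_mul]
      exact hx _)
    rw [AlgHom.map_det]
    convert this using 2
    ext i j
    simp only [G, AlgHom.mapMatrix_apply, map_apply, of_apply, hmom, map_mul, hL, ← hb]
    rw [← map_mul, hεI]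
  have hexp := aeval_eq_sum_of_isUnit_det hM (b := fun i => L (b i)) (G := G) rfl hdet
  let c : MvPolynomial σ O → ι → O :=
    fun f => (fun j => momentFunctional M (f * L (b j))) ᵥ* G⁻¹
  let B : Subalgebra O (ι → F) := (aeval v : MvPolynomial σ O →ₐ[O] (ι → F)).range
  let π : MvPolynomial σ O →ₐ[O] B := (aeval v : MvPolynomial σ O →ₐ[O] (ι → F)).rangeRestrict
  have hπ : Function.Surjective π := AlgHom.rangeRestrict_surjective _
  have hexpB : ∀ f, π f = ∑ i, c f i • π (L (b i)) := by
    intro f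
    apply Subtype.ext
    simpa [π] using hexp f
  have hli : LinearIndependent F fun i => aeval v (L (b i)) := by
    apply linearIndependent_of_det_diagonalGram_ne_zero (φ := φ)
    rw [diagonalGram_aeval hM, ← RingHom.map_det]
    exact (hdet.map (algebraMap O F)).ne_zero
  have hliO : LinearIndependent O fun i => π (L (b i)) := by
    have h1 : LinearIndependent O fun i => aeval v (L (b i)) :=
      hli.restrict_scalars' O
    exact LinearIndependent.of_comp B.val.toLinearMap h1
  let bB : Module.Basis ι O B := Module.Basis.mk hliO (by
    rintro x -
    obtain ⟨f, rfl⟩ := hπ x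
    rw [hexpB]
    exact Submodule.sum_mem _ fun i _ =>
      Submodule.smul_mem _ _ (Submodule.subset_span ⟨i, rfl⟩))
  let algK : Algebra K B := ((algebraMap O B).comp (algebraMap K O)).toAlgebra
  have tower : IsScalarTower K O B := IsScalarTower.of_algebraMap_eq fun _ => rfl
  refine ⟨B, inferInstance, inferInstance, algK, tower, Module.Free.of_basis bB,
    Module.finrank_eq_card_basis bB, ?_, etale_tensorProduct_subalgebra B bB ?_⟩
  swap
  · simpa [bB, π] using hli
  -- the special fibre
  let J : Ideal B := Ideal.span {algebraMap O B t}
  let ψ : MvPolynomial σ K →ₐ[K] B ⧸ J :=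
    ((Ideal.Quotient.mkₐ K J).comp (π.restrictScalars K)).comp L
  have hψ : ∀ f, ψ f = Ideal.Quotient.mk J (π (L f)) := fun f => rfl
  have hsurj : Function.Surjective ψ := by
    have key : ∀ f : MvPolynomial σ O,
        Ideal.Quotient.mk J (π f) = ψ (MvPolynomial.map (res : O →+* K) f) := by
      intro f
      induction f using MvPolynomial.induction_on with
      | C x =>
        have h1 : t ∣ x - algebraMap K O (res x) := by
          rw [← hres]; simp
        obtain ⟨y, hy⟩ := h1
        rw [map_C, hψ]
        have h2 : L (C ((res : O →+* K) x)) = C (algebraMap K O (res x)) := by simp [L]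
        rw [h2, Ideal.Quotient.eq, ← map_sub, ← map_sub, hy]
        have h3 : π (C (t * y)) = algebraMap O B t * algebraMap O B y := by
          rw [← map_mul]; exact π.commutes _
        rw [h3]
        exact Ideal.mul_mem_right _ _ (Ideal.subset_span rfl)
      | add p q hp hq =>
        rw [map_add, RingHom.map_add, hp, hq, RingHom.map_add, map_add]
      | mul_X p i hp =>
        rw [map_mul, RingHom.map_mul, hp, RingHom.map_mul, map_mul, map_X, hψ (X i), hLX]
    intro x
    obtain ⟨y, rfl⟩ := Ideal.Quotient.mk_surjective x
    obtain ⟨f, rfl⟩ := hπ y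
    exact ⟨_, (key f).symm⟩
  have hker : RingHom.ker ψ = I := by
    ext f
    rw [RingHom.mem_ker, hψ, Ideal.Quotient.eq_zero_iff_mem]
    constructor
    · intro hf
      obtain ⟨y, hy⟩ := Ideal.mem_span_singleton'.mp hf
      obtain ⟨h, rfl⟩ := hπ y
      rw [hε]
      intro g
      rw [← hL (f * g), ← hmom, hres, map_mul]
      refine ⟨momentFunctional M (h * L g), FaithfulSMul.algebraMap_injective O F ?_⟩
      rw [RingHom.map_mul, algebraMap_momentFunctional hM, algebraMap_momentFunctional hM,
        Finset.mul_sum]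
      refine Finset.sum_congr rfl fun a _ => ?_
      have := congrFun (congrArg Subtype.val hy) a
      have h4 : aeval v h a * algebraMap O F t = aeval v (L f) a := this
      rw [map_mul, map_mul, Pi.mul_apply, Pi.mul_apply, ← h4]
      ring
    · intro hf
      have hc : ∀ i, t ∣ c (L f) i := by
        intro i
        refine Finset.dvd_sum fun j _ => Dvd.dvd.mul_right ?_ _
        rw [← hres, hmom, map_mul, hL, hL]
        exact (hε f).mp hf _
      rw [hexpB]
      refine Ideal.sum_mem _ fun i _ => ?_
      obtain ⟨y, hy⟩ := hc i
      rw [hy, Algebra.smul_def, map_mul, mul_assoc]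
      exact Ideal.mul_mem_right _ _ (Ideal.subset_span rfl)
  exact ⟨((Ideal.quotientEquivAlgOfEq K hker.symm).trans
    (Ideal.quotientKerAlgEquivOfSurjective hsurj)).symm⟩

end FlatFamily

section Rescaling

open MvPolynomial

lemma Finsupp.exists_eq_single_add_of_degree_eq_succ {σ : Type*} {m : σ →₀ ℕ} {n : ℕ}
    (h : m.degree = n + 1) : ∃ i m', m = Finsupp.single i 1 + m' ∧ m'.degree = n := by
  have hm : m ≠ 0 := by
    rintro rfl
    simp at h
  obtain ⟨i, hi⟩ := Finsupp.ne_iff.mp hm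
  have hle : Finsupp.single i 1 ≤ m := Finsupp.single_le_iff.mpr (Nat.one_le_iff_ne_zero.mpr hi)
  have heq : m = Finsupp.single i 1 + (m - Finsupp.single i 1) :=
    (add_tsub_cancel_of_le hle).symm
  refine ⟨i, _, heq, ?_⟩
  rw [heq, map_add, Finsupp.degree_single] at h
  omega

lemma Finsupp.prod_mul_pow_apply {F σ ι : Type*} [CommRing F] (c : F) (v : σ → ι → F)
    (m : σ →₀ ℕ) (a : ι) :
    (m.prod fun i k => (fun b => c * v i b) ^ k) a =
      c ^ m.degree * (m.prod fun i k => v i ^ k) a := by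
  simp only [Finsupp.prod, Finset.prod_apply, Pi.pow_apply, mul_pow, Finset.prod_mul_distrib,
    Finset.prod_pow_eq_pow_sum, Finsupp.degree_apply]

/-- A weighted point configuration over `F = O[1/t]` whose moments of degree at most three lie
in `O` can be rescaled so that all moments are in `O` and those of degree at least four are
divisible by `t`. -/
lemma exists_rescaled_moments {O F σ ι : Type*} [CommRing O] [Field F] [Algebra O F]
    [FaithfulSMul O F] {t : O} [IsLocalization (Submonoid.powers t) F] [Finite σ] [Fintype ι]
    {φ : ι → F} {v : σ → ι → F} {T : σ → σ → σ → O} (h₀ : ∑ a, φ a = 0)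
    (h₁ : ∀ i, ∑ a, φ a * v i a = 0) (h₂ : ∀ i j, ∑ a, φ a * (v i a * v j a) = 0)
    (h₃ : ∀ i j k, ∑ a, φ a * (v i a * v j a * v k a) = algebraMap O F (T i j k)) :
    ∃ (φ' : ι → F) (v' : σ → ι → F) (M : (σ →₀ ℕ) → O),
      (∀ m : σ →₀ ℕ, ∑ a, φ' a * (m.prod fun i k => v' i ^ k) a = algebraMap O F (M m)) ∧
      (∀ m : σ →₀ ℕ, m.degree < 3 → M m = 0) ∧
      (∀ i j k, M (Finsupp.single i 1 + (Finsupp.single j 1 + Finsupp.single k 1)) = T i j k) ∧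
      ∀ m : σ →₀ ℕ, 3 < m.degree → t ∣ M m := by
  have hinj := FaithfulSMul.algebraMap_injective O F
  set s : F := algebraMap O F t with hs
  have hs0 : s ≠ 0 :=
    (IsLocalization.map_units F (⟨t, Submonoid.mem_powers t⟩ : Submonoid.powers t)).ne_zero
  obtain ⟨⟨_, D, rfl⟩, hD⟩ := IsLocalization.exist_integer_multiples_of_finite
    (Submonoid.powers t) (S := F) (Sum.elim φ fun x : σ × ι => v x.1 x.2)
  choose q hq using fun a => hD (Sum.inl a)
  choose w hw using fun i a => hD (Sum.inr (i, a))
  simp only [Sum.elim_inl, Sum.elim_inr, Algebra.smul_def, map_pow, ← hs] at hq hw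
  have hprod : ∀ (m : σ →₀ ℕ) (a : ι), s ^ (D * (m.degree + 1)) *
      (φ a * (m.prod fun i k => v i ^ k) a) =
      algebraMap O F (q a * m.prod fun i k => w i a ^ k) := by
    intro m a
    have h := Finsupp.prod_mul_pow_apply (s ^ D) v m a
    have h' : (m.prod fun i k => (fun b => s ^ D * v i b) ^ k) a =
        algebraMap O F (m.prod fun i k => w i a ^ k) := by
      simp only [Finsupp.prod, Finset.prod_apply, Pi.pow_apply, ← hw, map_prod, map_pow]
    rw [map_mul, hq, ← h', h]
    ring
  have hmom : ∀ (f : MvPolynomial σ ℤ), ∀ a, aeval v f a = aeval (fun i => v i a) f := by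
    intro f a
    have : (Pi.evalAlgHom ℤ (fun _ : ι => F) a).comp (aeval v) = aeval fun i => v i a := by
      ext i; simp
    exact DFunLike.congr_fun this f
  let N := 6 * D + 1
  have key : ∀ m : σ →₀ ℕ, ∃ y : O,
      ∑ a, (s ^ (3 * N))⁻¹ * φ a * (m.prod fun i k => (fun b => s ^ N * v i b) ^ k) a =
        algebraMap O F y ∧ (m.degree < 3 → y = 0) ∧
      (∀ i j k, m = Finsupp.single i 1 + (Finsupp.single j 1 + Finsupp.single k 1) →
        y = T i j k) ∧ (3 < m.degree → t ∣ y) := by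
    intro m
    have hsum : ∑ a, (s ^ (3 * N))⁻¹ * φ a * (m.prod fun i k => (fun b => s ^ N * v i b) ^ k) a =
        (s ^ (3 * N))⁻¹ * (s ^ (N * m.degree) * ∑ a, φ a * (m.prod fun i k => v i ^ k) a) := by
      rw [Finset.mul_sum, Finset.mul_sum]
      refine Finset.sum_congr rfl fun a _ => ?_
      rw [Finsupp.prod_mul_pow_apply]
      ring
    rw [hsum]
    have haeval : ∀ a, (m.prod fun i k => v i ^ k) a =
        aeval (fun i => v i a) (monomial m (1 : ℤ)) := by
      intro a
      rw [← hmom, aeval_monomial, map_one, one_mul]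
    rcases lt_trichotomy m.degree 3 with hlt | heq | hgt
    · refine ⟨0, ?_, fun _ => rfl, ?_, fun h => absurd hlt h.not_gt⟩
      · have : ∑ a, φ a * (m.prod fun i k => v i ^ k) a = 0 := by
          obtain h | h | h : m.degree = 0 ∨ m.degree = 1 ∨ m.degree = 2 := by omega
          · obtain rfl := (Finsupp.degree_eq_zero_iff m).mp h
            simpa using h₀
          · obtain ⟨i, m', rfl, h'⟩ := Finsupp.exists_eq_single_add_of_degree_eq_succ h
            obtain rfl := (Finsupp.degree_eq_zero_iff m').mp h'
            rw [← h₁ i]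
            refine Finset.sum_congr rfl fun a _ => ?_
            rw [haeval]
            simp [aeval_monomial]
          · obtain ⟨i, m', rfl, h'⟩ := Finsupp.exists_eq_single_add_of_degree_eq_succ h
            obtain ⟨j, m'', rfl, h''⟩ := Finsupp.exists_eq_single_add_of_degree_eq_succ h'
            obtain rfl := (Finsupp.degree_eq_zero_iff m'').mp h''
            rw [← h₂ i j]
            refine Finset.sum_congr rfl fun a _ => ?_
            rw [haeval]
            simp [monomial_single_add, aeval_monomial]
        rw [this]
        simp
      · rintro i j k rfl
        simp at hlt
    · obtain ⟨i, m', rfl, h'⟩ := Finsupp.exists_eq_single_add_of_degree_eq_succ heq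
      obtain ⟨j, m'', rfl, h''⟩ := Finsupp.exists_eq_single_add_of_degree_eq_succ h'
      obtain ⟨k, m₀, rfl, hk⟩ := Finsupp.exists_eq_single_add_of_degree_eq_succ h''
      obtain rfl := (Finsupp.degree_eq_zero_iff m₀).mp hk
      simp only [add_zero] at *
      have hT : (s ^ (3 * N))⁻¹ * (s ^ (N * 3) * ∑ a, φ a * ((Finsupp.single i 1 +
          (Finsupp.single j 1 + Finsupp.single k 1)).prod fun i k => v i ^ k) a) =
          algebraMap O F (T i j k) := by
        rw [mul_comm N 3, inv_mul_cancel_left₀ (pow_ne_zero _ hs0), ← h₃]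
        refine Finset.sum_congr rfl fun a _ => ?_
        rw [haeval]
        simp [monomial_single_add, aeval_monomial, mul_assoc]
      refine ⟨T i j k, ?_, fun h => absurd heq h.ne, ?_, fun h => absurd heq h.ne'⟩
      · rw [heq]
        exact hT
      · intro i' j' k' h
        apply hinj
        rw [← h₃ i' j' k', ← hT, mul_comm N 3, inv_mul_cancel_left₀ (pow_ne_zero _ hs0)]
        refine Finset.sum_congr rfl fun a _ => ?_
        rw [haeval, h]
        simp [monomial_single_add, aeval_monomial, mul_assoc]
    · obtain ⟨r, hr⟩ : ∃ r, N * m.degree = 3 * N + (D * (m.degree + 1) + (1 + r)) := by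
        obtain ⟨d, hd⟩ := Nat.exists_eq_add_of_lt hgt
        refine ⟨5 * D * d + D + d, ?_⟩
        rw [hd]
        simp only [N]
        ring
      refine ⟨t * (t ^ r * ∑ a, q a * m.prod fun i k => w i a ^ k), ?_,
        fun h => absurd hgt h.not_gt, ?_, fun _ => dvd_mul_right _ _⟩
      · rw [hr, pow_add, mul_assoc, inv_mul_cancel_left₀ (pow_ne_zero _ hs0), pow_add,
          mul_comm (s ^ _) (s ^ (1 + r)), mul_assoc, Finset.mul_sum]
        simp only [hprod]
        rw [← map_sum, hs, ← map_pow, ← map_mul]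
        congr 1
        ring
      · rintro i j k rfl
        simp at hgt
  choose M hM using key
  exact ⟨fun a => (s ^ (3 * N))⁻¹ * φ a, fun i b => s ^ N * v i b, M, fun m => (hM m).1,
    fun m => (hM m).2.1, fun i j k => (hM _).2.2.1 i j k rfl, fun m => (hM m).2.2.2⟩

end Rescaling

section GradedGorenstein

open MvPolynomial

variable {K : Type} [Field K] {n : ℕ} {I : Ideal (MvPolynomial (Fin n) K)}

lemma mem_gradedPiece {t : ℕ} {x : MvPolynomial (Fin n) K ⧸ I} :
    x ∈ gradedPiece K n I t ↔ ∃ f, f.IsHomogeneous t ∧ Ideal.Quotient.mk I f = x := by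
  simp [gradedPiece, Submodule.mem_map, mem_homogeneousSubmodule]

lemma mem_socle {x : MvPolynomial (Fin n) K ⧸ I} :
    x ∈ socle K n I ↔ ∀ i, x * Ideal.Quotient.mk I (X i) = 0 := by
  simp [socle, Submodule.mem_iInf]

instance (t : ℕ) : Module.Finite K (gradedPiece K n I t) :=
  Module.Finite.iff_fg.mpr ((homogeneousSubmodule_fg (σ := Fin n) (R := K) t).map _)

lemma mem_of_finrank_gradedPiece_eq_zero {t : ℕ}
    (h : Module.finrank K (gradedPiece K n I t) = 0) {f : MvPolynomial (Fin n) K}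
    (hf : f.IsHomogeneous t) : f ∈ I := by
  rw [Submodule.finrank_eq_zero] at h
  rw [← Ideal.Quotient.eq_zero_iff_mem, ← Submodule.mem_bot K, ← h]
  exact mem_gradedPiece.mpr ⟨f, hf, rfl⟩

lemma sub_homogeneousComponent_mem
    (hhom : ∀ f ∈ I, ∀ d : ℕ, homogeneousComponent d f ∈ I) {t : ℕ}
    {f : MvPolynomial (Fin n) K} (hf : Ideal.Quotient.mk I f ∈ gradedPiece K n I t) :
    f - homogeneousComponent t f ∈ I := by
  obtain ⟨g, hg, hgf⟩ := mem_gradedPiece.mp hf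
  have h1 : f - g ∈ I := by rw [← Ideal.Quotient.eq, hgf]
  have h2 := hhom _ h1 t
  rw [map_sub, homogeneousComponent_of_mem ((mem_homogeneousSubmodule t g).mpr hg),
    if_pos rfl] at h2
  convert I.sub_mem h1 h2 using 1
  ring

/-- The projection of a graded quotient to its graded piece. -/
noncomputable def gradedProjection (hhom : ∀ f ∈ I, ∀ d : ℕ, homogeneousComponent d f ∈ I)
    (t : ℕ) : (MvPolynomial (Fin n) K ⧸ I) →ₗ[K] gradedPiece K n I t :=
  LinearMap.codRestrict _
    ((I.restrictScalars K).liftQ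
      ((Ideal.Quotient.mkₐ K I).toLinearMap ∘ₗ homogeneousComponent t)
      fun f hf => Ideal.Quotient.eq_zero_iff_mem.mpr (hhom f hf t))
    fun x => by
      obtain ⟨f, rfl⟩ := Ideal.Quotient.mk_surjective x
      exact mem_gradedPiece.mpr ⟨_, homogeneousComponent_isHomogeneous t f, rfl⟩

lemma coe_gradedProjection_mk (hhom : ∀ f ∈ I, ∀ d : ℕ, homogeneousComponent d f ∈ I)
    (t : ℕ) (f : MvPolynomial (Fin n) K) :
    (gradedProjection hhom t (Ideal.Quotient.mk I f) : MvPolynomial (Fin n) K ⧸ I) =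
      Ideal.Quotient.mk I (homogeneousComponent t f) :=
  rfl

lemma gradedProjection_mk_eq_zero_iff
    (hhom : ∀ f ∈ I, ∀ d : ℕ, homogeneousComponent d f ∈ I)
    {t : ℕ} {f : MvPolynomial (Fin n) K} :
    gradedProjection hhom t (Ideal.Quotient.mk I f) = 0 ↔ homogeneousComponent t f ∈ I := by
  rw [← Ideal.Quotient.eq_zero_iff_mem, ← coe_gradedProjection_mk hhom,
    ZeroMemClass.coe_eq_zero]

lemma bijective_pi_gradedProjection
    (hhom : ∀ f ∈ I, ∀ d : ℕ, homogeneousComponent d f ∈ I) {N : ℕ}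
    (hN : ∀ t, N ≤ t → ∀ f : MvPolynomial (Fin n) K, f.IsHomogeneous t → f ∈ I) :
    Function.Bijective (LinearMap.pi fun t : Fin N => gradedProjection hhom t) := by
  constructor
  · rw [← LinearMap.ker_eq_bot, LinearMap.ker_eq_bot']
    intro x hx
    obtain ⟨f, rfl⟩ := Ideal.Quotient.mk_surjective x
    rw [Ideal.Quotient.eq_zero_iff_mem, ← sum_homogeneousComponent f]
    refine I.sum_mem fun t _ => ?_
    by_cases ht : t < N
    · exact (gradedProjection_mk_eq_zero_iff hhom).mp (congrFun hx ⟨t, ht⟩)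
    · exact hN t (not_lt.mp ht) _ (homogeneousComponent_isHomogeneous t f)
  · intro y
    choose g hg hgy using fun t => mem_gradedPiece.mp (y t).2
    refine ⟨Ideal.Quotient.mk I (∑ t, g t), ?_⟩
    funext t
    apply Subtype.ext
    rw [LinearMap.pi_apply, coe_gradedProjection_mk, ← hgy, map_sum]
    congr 1
    rw [Finset.sum_eq_single t]
    · rw [homogeneousComponent_of_mem ((mem_homogeneousSubmodule _ _).mpr (hg t)), if_pos rfl]
    · intro s _ hs
      rw [homogeneousComponent_of_mem ((mem_homogeneousSubmodule _ _).mpr (hg s)), if_neg]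
      exact fun h => hs (Fin.ext h.symm)
    · simp

/-- A graded quotient which vanishes above degree `s`, and whose socle is exactly its graded
piece of degree `s`, is presented by a functional on that graded piece. -/
lemma mem_iff_forall_gradedProjection_mul_eq_zero
    (hhom : ∀ f ∈ I, ∀ d : ℕ, homogeneousComponent d f ∈ I) {s N : ℕ}
    (hN : ∀ t, N ≤ t → ∀ f : MvPolynomial (Fin n) K, f.IsHomogeneous t → f ∈ I)
    (hs : socle K n I ≤ gradedPiece K n I s) (f : MvPolynomial (Fin n) K) :
    f ∈ I ↔ ∀ g, gradedProjection hhom s (Ideal.Quotient.mk I (f * g)) = 0 := by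
  constructor
  · intro hf g
    exact (gradedProjection_mk_eq_zero_iff hhom).mpr (hhom _ (I.mul_mem_right _ hf) _)
  · intro hf
    have key : ∀ k, (∀ g : MvPolynomial (Fin n) K, g.IsHomogeneous k → f * g ∈ I) → f ∈ I := by
      intro k
      induction k with
      | zero =>
        intro h
        simpa using h 1 (isHomogeneous_one _ _)
      | succ k ih =>
        intro h
        refine ih fun g hg => ?_
        have h1 : Ideal.Quotient.mk I (f * g) ∈ gradedPiece K n I s := by
          refine hs (mem_socle.mpr fun i => ?_)
          rw [← map_mul, Ideal.Quotient.eq_zero_iff_mem, mul_assoc]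
          exact h _ (hg.mul (isHomogeneous_X K i))
        have h2 := I.add_mem (sub_homogeneousComponent_mem hhom h1)
          ((gradedProjection_mk_eq_zero_iff hhom).mp (hf g))
        simpa using h2
    exact key N fun g hg => I.mul_mem_left _ (hN N le_rfl g hg)

lemma gradedPiece_le_socle {s : ℕ}
    (hN : ∀ f : MvPolynomial (Fin n) K, f.IsHomogeneous (s + 1) → f ∈ I) :
    gradedPiece K n I s ≤ socle K n I := by
  intro x hx
  obtain ⟨f, hf, rfl⟩ := mem_gradedPiece.mp hx
  refine mem_socle.mpr fun i => ?_
  rw [← map_mul, Ideal.Quotient.eq_zero_iff_mem]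
  exact hN _ (hf.mul (isHomogeneous_X K i))

lemma natCast_prime_ne_zero_of_ringChar_ne {p : ℕ} (hp : p.Prime) (h : ringChar K ≠ p) :
    (p : K) ≠ 0 := by
  intro h0
  have := (Nat.dvd_prime hp).mp (ringChar.dvd h0)
  exact this.elim (CharP.ringChar_ne_one) h

end GradedGorenstein

/-- Over an algebraically closed field `K` with `char K ≠ 2, 3`, every graded Gorenstein
quotient of `K[x₁,…,x₇]` with Hilbert function `(1,7,7,1)` is smoothable (with `d = 16`). -/
theorem gorenstein_1771_smoothable (K : Type) [Field K] [IsAlgClosed K]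
    (hchar2 : ringChar K ≠ 2) (hchar3 : ringChar K ≠ 3)
    (I : Ideal (MvPolynomial (Fin 7) K))
    (hhom : ∀ f ∈ I, ∀ d : ℕ, MvPolynomial.homogeneousComponent d f ∈ I)
    (h0 : Module.finrank K (gradedPiece K 7 I 0) = 1)
    (h1 : Module.finrank K (gradedPiece K 7 I 1) = 7)
    (h2 : Module.finrank K (gradedPiece K 7 I 2) = 7)
    (h3 : Module.finrank K (gradedPiece K 7 I 3) = 1)
    (hge : ∀ t : ℕ, 4 ≤ t → Module.finrank K (gradedPiece K 7 I t) = 0)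
    (hgor : Module.finrank K (socle K 7 I) = 1) :
    IsSmoothable K (MvPolynomial (Fin 7) K ⧸ I) 16 := by
  classical
  have hN : ∀ t, 4 ≤ t → ∀ f : MvPolynomial (Fin 7) K, f.IsHomogeneous t → f ∈ I :=
    fun t ht f => mem_of_finrank_gradedPiece_eq_zero (hge t ht)
  have := Module.finite_of_finrank_eq_succ hgor
  have hsoc : gradedPiece K 7 I 3 = socle K 7 I :=
    Submodule.eq_of_le_of_finrank_eq (gradedPiece_le_socle (hN 4 le_rfl)) (h3.trans hgor.symm)
  let E := LinearEquiv.ofBijective _ (bijective_pi_gradedProjection hhom hN)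
  have : Module.Finite K (MvPolynomial (Fin 7) K ⧸ I) := Module.Finite.equiv E.symm
  have hcard : Fintype.card (AffineCube ⊕ AffineCube) = 16 := by decide
  have hfin : Module.finrank K (MvPolynomial (Fin 7) K ⧸ I) = 16 := by
    rw [E.finrank_eq, Module.finrank_pi_fintype]
    simp [Fin.sum_univ_four, h0, h1, h2, h3]
  let bI : Module.Basis (AffineCube ⊕ AffineCube) K (MvPolynomial (Fin 7) K ⧸ I) :=
    (Module.finBasisOfFinrankEq K _ hfin).reindex (Fintype.equivFinOfCardEq hcard).symm
  let e : gradedPiece K 7 I 3 ≃ₗ[K] K :=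
    LinearEquiv.ofFinrankEq _ _ (by rw [h3, Module.finrank_self])
  let ε : MvPolynomial (Fin 7) K →ₗ[K] K :=
    e.toLinearMap ∘ₗ gradedProjection hhom 3 ∘ₗ (Ideal.Quotient.mkₐ K I).toLinearMap
  have hε_apply : ∀ f, ε f = e (gradedProjection hhom 3 (Ideal.Quotient.mk I f)) := fun _ => rfl
  have hε : ∀ f, f ∈ I ↔ ∀ g, ε (f * g) = 0 := by
    intro f
    rw [mem_iff_forall_gradedProjection_mul_eq_zero hhom hN hsoc.ge f]
    simp only [hε_apply, LinearEquiv.map_eq_zero_iff]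
  have hε_degree : ∀ m : Fin 7 →₀ ℕ, m.degree ≠ 3 → ε (MvPolynomial.monomial m 1) = 0 := by
    intro m hm
    rw [hε_apply, (gradedProjection_mk_eq_zero_iff hhom).mpr, map_zero]
    rw [MvPolynomial.homogeneousComponent_of_mem
      ((MvPolynomial.mem_homogeneousSubmodule _ _).mpr
        (MvPolynomial.isHomogeneous_monomial 1 rfl)), if_neg (Ne.symm hm)]
    exact I.zero_mem
  obtain ⟨φ₀, v₀, T, hT, m₀, m₁, m₂, m₃⟩ := AffineCube.exists_moments_eq (K := K)
    (by exact_mod_cast natCast_prime_ne_zero_of_ringChar_ne Nat.prime_two hchar2)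
    (by exact_mod_cast natCast_prime_ne_zero_of_ringChar_ne Nat.prime_three hchar3)
    (T := fun i j k => ε (MvPolynomial.X i * MvPolynomial.X j * MvPolynomial.X k))
    (fun i j k => by rw [mul_comm (MvPolynomial.X i)])
    (fun i j k => by rw [mul_right_comm])
  have := LaurentSeries.of_powerSeries_localization (R := K)
  obtain ⟨φ, v, M, hM, M₂, M₃, M₄⟩ :=
    exists_rescaled_moments (t := (PowerSeries.X : PowerSeries K)) m₀ m₁ m₂ m₃
  let res : PowerSeries K →ₐ[K] K :=
    { PowerSeries.constantCoeff (R := K) with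
      commutes' := fun x => PowerSeries.constantCoeff_C x }
  have hres : ∀ x, res x = PowerSeries.constantCoeff x := fun _ => rfl
  have hMε : ∀ m, res (M m) = ε (MvPolynomial.monomial m 1) := by
    intro m
    rw [hres]
    rcases lt_trichotomy m.degree 3 with h | h | h
    · rw [M₂ m h, map_zero, hε_degree m h.ne]
    · obtain ⟨i, m', rfl, h'⟩ := Finsupp.exists_eq_single_add_of_degree_eq_succ h
      obtain ⟨j, m'', rfl, h''⟩ := Finsupp.exists_eq_single_add_of_degree_eq_succ h'
      obtain ⟨k, m₀, rfl, hk⟩ := Finsupp.exists_eq_single_add_of_degree_eq_succ h''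
      obtain rfl := (Finsupp.degree_eq_zero_iff m₀).mp hk
      rw [add_zero, M₃, hT]
      congr 1
      simp only [MvPolynomial.X, MvPolynomial.monomial_mul, mul_one, add_assoc]
    · rw [PowerSeries.X_dvd_iff.mp (M₄ m h), hε_degree m h.ne']
  have := exists_flat_family (res := res) (t := PowerSeries.X)
    (fun x => PowerSeries.X_dvd_iff.symm)
    (fun x hx => PowerSeries.isUnit_iff_constantCoeff.mpr (isUnit_iff_ne_zero.mpr hx))
    bI hε hM hMε
  rwa [hcard] at this
end

section
/- Let K be an algebraically closed field of characteristic 0, and let A be a local Artinian Gorenstein K-algebra with residue field K and Hilbert function (1,7,7,1). Then A is smoothable (with d = 16). -/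
/-- The `K`-dimension of `mⁱ/mⁱ⁺¹`, where `m` is the maximal ideal of the local ring `A`. -/
noncomputable def assocGradedDim (K A : Type) [Field K] [CommRing A] [Algebra K A]
    [IsLocalRing A] (i : ℕ) : ℕ :=
  Module.finrank K
    (((IsLocalRing.maximalIdeal A ^ i).restrictScalars K) ⧸
      (Submodule.comap ((IsLocalRing.maximalIdeal A ^ i).restrictScalars K).subtype
        ((IsLocalRing.maximalIdeal A ^ (i + 1)).restrictScalars K)))

open PowerSeries in
/-- A system of cubic equations `∑ λ_p x_{pa} x_{pb} x_{pc} = T_{abc}` over `K[[X]]` can be solved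
by lifting a solution modulo `X` at which the linearised system is surjective. -/
theorem exists_powerSeries_cubic_solution {K P Q : Type*} [Field K] [Fintype P]
    (lam : P → K) (x₀ : P → Q → K)
    (hsurj : ∀ R : Q → Q → Q → K, (∀ a b c, R a b c = R b a c) → (∀ a b c, R a b c = R a c b) →
      ∃ h : P → Q → K, ∀ a b c, ∑ p, lam p *
        (x₀ p a * x₀ p b * h p c + x₀ p a * h p b * x₀ p c + h p a * x₀ p b * x₀ p c) = R a b c)
    (T : Q → Q → Q → K⟦X⟧)
    (hT₁ : ∀ a b c, T a b c = T b a c) (hT₂ : ∀ a b c, T a b c = T a c b)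
    (hT₀ : ∀ a b c, constantCoeff (T a b c) = ∑ p, lam p * (x₀ p a * x₀ p b * x₀ p c)) :
    ∃ x : P → Q → K⟦X⟧, (∀ p a, constantCoeff (x p a) = x₀ p a) ∧
      ∀ a b c, ∑ p, C (lam p) * (x p a * x p b * x p c) = T a b c := by
  classical
  let Φ : (P → Q → K⟦X⟧) → Q → Q → Q → K⟦X⟧ :=
    fun x a b c => ∑ p, C (lam p) * (x p a * x p b * x p c)
  let S : ℕ → (P → Q → K⟦X⟧) → Prop := fun n x =>
    (∀ p a, constantCoeff (x p a) = x₀ p a) ∧ ∀ a b c, X ^ (n + 1) ∣ Φ x a b c - T a b c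
  have step : ∀ n x, S n x → ∃ x', S (n + 1) x' ∧ ∀ p a, X ^ (n + 1) ∣ x' p a - x p a := by
    rintro n x ⟨hx₀, hx⟩
    obtain ⟨h, hh⟩ := hsurj (fun a b c => - coeff (n + 1) (Φ x a b c - T a b c))
      (fun a b c => by
        simp only [Φ, hT₁ a b c]
        congr 3
        exact Finset.sum_congr rfl fun p _ => by ring)
      (fun a b c => by
        simp only [Φ, hT₂ a b c]
        congr 3
        exact Finset.sum_congr rfl fun p _ => by ring)
    refine ⟨fun p a => x p a + X ^ (n + 1) * C (h p a), ⟨fun p a => ?_, fun a b c => ?_⟩,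
      fun p a => ⟨C (h p a), by ring⟩⟩
    · simp [hx₀]
    · have hz : ∀ p a, ∃ z, x p a = C (x₀ p a) + X * z := fun p a => by
        have : X ∣ x p a - C (x₀ p a) := by
          rw [X_dvd_iff]; simp [hx₀]
        obtain ⟨z, hz⟩ := this
        exact ⟨z, by rw [← hz]; ring⟩
      choose z hz using hz
      obtain ⟨r, hr⟩ := hx a b c
      have hr₀ : constantCoeff r = coeff (n + 1) (Φ x a b c - T a b c) := by
        rw [hr, coeff_X_pow_mul', if_pos le_rfl]; simp
      obtain ⟨r', hr'⟩ : X ∣ r - C (constantCoeff r) := by rw [X_dvd_iff]; simp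
      have hlin : ∑ p, C (lam p) * (C (x₀ p a) * C (x₀ p b) * C (h p c) +
          C (x₀ p a) * C (h p b) * C (x₀ p c) + C (h p a) * C (x₀ p b) * C (x₀ p c)) =
          - C (constantCoeff r) := by
        rw [hr₀, ← map_neg, ← hh a b c]
        simp only [map_sum, map_mul, map_add]
      have hsum : Φ (fun p a => x p a + X ^ (n + 1) * C (h p a)) a b c = Φ x a b c +
          X ^ (n + 1) * ∑ p, C (lam p) * (C (x₀ p a) * C (x₀ p b) * C (h p c) +
            C (x₀ p a) * C (h p b) * C (x₀ p c) + C (h p a) * C (x₀ p b) * C (x₀ p c)) +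
          X ^ (n + 2) * ∑ p, C (lam p) * (
            C (x₀ p a) * z p b * C (h p c) + z p a * x p b * C (h p c) +
            C (x₀ p a) * C (h p b) * z p c + z p a * C (h p b) * x p c +
            C (h p a) * C (x₀ p b) * z p c + C (h p a) * z p b * x p c +
            X ^ n * (x p a * C (h p b) * C (h p c) + C (h p a) * x p b * C (h p c) +
              C (h p a) * C (h p b) * x p c) +
            X ^ (n + n + 1) * (C (h p a) * C (h p b) * C (h p c))) := by
        simp only [Φ, Finset.mul_sum, ← Finset.sum_add_distrib]
        refine Finset.sum_congr rfl fun p _ => ?_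
        simp only [hz p a, hz p b, hz p c]
        ring
      rw [hsum, hlin]
      have : r = C (constantCoeff r) + X * r' := by rw [← hr']; ring
      refine ⟨r' + ∑ p, C (lam p) * (
            C (x₀ p a) * z p b * C (h p c) + z p a * x p b * C (h p c) +
            C (x₀ p a) * C (h p b) * z p c + z p a * C (h p b) * x p c +
            C (h p a) * C (x₀ p b) * z p c + C (h p a) * z p b * x p c +
            X ^ n * (x p a * C (h p b) * C (h p c) + C (h p a) * x p b * C (h p c) +
              C (h p a) * C (h p b) * x p c) +
            X ^ (n + n + 1) * (C (h p a) * C (h p b) * C (h p c))), ?_⟩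
      linear_combination hr + X ^ (n + 1) * this
  have start : S 0 fun p a => C (x₀ p a) := by
    refine ⟨fun p a => by simp, fun a b c => ?_⟩
    rw [zero_add, pow_one, X_dvd_iff]
    simp [Φ, hT₀]
  choose! f hfS hfd using step
  let s : ℕ → P → Q → K⟦X⟧ := fun n => Nat.rec (fun p a => C (x₀ p a)) f n
  have hs : ∀ n, S n (s n) := fun n => by
    induction n with
    | zero => exact start
    | succ n ih => exact hfS n _ ih
  have hsd : ∀ n p a, X ^ (n + 1) ∣ s (n + 1) p a - s n p a := fun n => hfd n _ (hs n)
  have hsd' : ∀ n k p a, X ^ (n + 1) ∣ s (n + k) p a - s n p a := fun n k p a => by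
    induction k with
    | zero => simp
    | succ k ih =>
      have h1 : X ^ (n + 1) ∣ s (n + k + 1) p a - s (n + k) p a :=
        (pow_dvd_pow X (by omega)).trans (hsd (n + k) p a)
      simpa [add_assoc] using dvd_add h1 ih
  let x : P → Q → K⟦X⟧ := fun p a => mk fun n => coeff n (s n p a)
  have hx : ∀ n p a, X ^ (n + 1) ∣ x p a - s n p a := fun n p a => by
    rw [X_pow_dvd_iff]
    intro m hm
    obtain ⟨k, rfl⟩ := Nat.exists_eq_add_of_le (Nat.lt_succ_iff.mp hm)
    have := X_pow_dvd_iff.mp (hsd' m k p a) m (Nat.lt_succ_self m)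
    simp only [x, map_sub, coeff_mk] at this ⊢
    rw [← neg_sub, this, neg_zero]
  refine ⟨x, fun p a => ?_, fun a b c => ?_⟩
  · simp [x, s]
  · have key : ∀ n, X ^ (n + 1) ∣ Φ x a b c - T a b c := fun n => by
      have h1 : X ^ (n + 1) ∣ Φ x a b c - Φ (s n) a b c := by
        rw [← Ideal.mem_span_singleton, ← Ideal.Quotient.eq]
        have : ∀ p a, Ideal.Quotient.mk (Ideal.span {(X : K⟦X⟧) ^ (n + 1)}) (x p a) =
            Ideal.Quotient.mk _ (s n p a) := fun p a => by
          rw [Ideal.Quotient.eq, Ideal.mem_span_singleton]; exact hx n p a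
        simp only [Φ, map_sum, map_mul, this]
      simpa using dvd_add h1 ((hs n).2 a b c)
    rw [← sub_eq_zero]
    ext n
    exact X_pow_dvd_iff.mp (key n) n (Nat.lt_succ_self n)

/-- The value at `b` of the character of `(ℤ/2)³ ≃ Fin 8` (with `xor` as addition) indexed
by `a`. -/
def xorChar (a b : Fin 8) : ℤ :=
  (-1) ^ (((a.val &&& b.val).testBit 0).toNat + ((a.val &&& b.val).testBit 1).toNat +
    ((a.val &&& b.val).testBit 2).toNat)

theorem xorChar_mul (p a b : Fin 8) : xorChar p a * xorChar p b = xorChar p (a ^^^ b) := by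
  revert p a b; decide

theorem xorChar_zero (p : Fin 8) : xorChar p 0 = 1 := by
  revert p; decide

theorem sum_xorChar (a : Fin 8) : ∑ p, xorChar p a = if a = 0 then 8 else 0 := by
  revert a; decide

theorem sum_xorChar_right (p : Fin 8) : ∑ a, xorChar p a = if p = 0 then 8 else 0 := by
  revert p; decide

theorem fin8_xor_eq_zero (a b : Fin 8) : a ^^^ b = 0 ↔ a = b := by
  revert a b; decide

theorem sum_xorChar_mul {K : Type*} [Field K] (d e : Fin 8) :
    ∑ p, (xorChar p d : K) * xorChar p e = if d = e then 8 else 0 := by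
  have := sum_xorChar (d ^^^ e)
  simp only [← xorChar_mul, fin8_xor_eq_zero] at this
  exact_mod_cast congrArg (Int.cast : ℤ → K) this

/-- The lines of the Fano plane of nonzero elements of `(ℤ/2)³`. -/
def fanoLine : Fin 7 → Fin 3 → Fin 8 :=
  ![![1, 2, 3], ![1, 4, 5], ![1, 6, 7], ![2, 4, 6], ![2, 5, 7], ![3, 4, 7], ![3, 5, 6]]

theorem fanoLine_xor (r : Fin 8) (k : Fin 7) :
    (r ^^^ fanoLine k 0) ^^^ (r ^^^ fanoLine k 1) = fanoLine k 2 ∧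
    (r ^^^ fanoLine k 0) ^^^ (r ^^^ fanoLine k 2) = fanoLine k 1 ∧
    (r ^^^ fanoLine k 1) ^^^ (r ^^^ fanoLine k 2) = fanoLine k 0 := by
  revert r k; decide

theorem xor_xor_fanoLine (r : Fin 8) (k : Fin 7) (i : Fin 3) :
    fanoLine k i ^^^ (r ^^^ fanoLine k i) = r := by
  revert r k i; decide

theorem exists_fanoLine (a b c : Fin 8) (hab : a ≠ b) (hac : a ≠ c) (hbc : b ≠ c) :
    ∃ k, let r := a ^^^ b ^^^ c
      let u := r ^^^ fanoLine k 0
      let v := r ^^^ fanoLine k 1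
      let w := r ^^^ fanoLine k 2
      (a = u ∧ b = v ∧ c = w) ∨ (a = u ∧ b = w ∧ c = v) ∨ (a = v ∧ b = u ∧ c = w) ∨
      (a = v ∧ b = w ∧ c = u) ∨ (a = w ∧ b = u ∧ c = v) ∨ (a = w ∧ b = v ∧ c = u) := by
  revert a b c
  decide +kernel

theorem exists_fanoLine_sum {K : Type*} [Field K] [CharZero K] (f : Fin 7 → K) :
    ∃ g : Fin 8 → K, ∀ k, g (fanoLine k 0) + g (fanoLine k 1) + g (fanoLine k 2) = f k := by
  refine ⟨fun d => (1 / 2) * (∑ k, if ∃ i, fanoLine k i = d then f k else 0) -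
    (1 / 6) * ∑ k, f k, fun k => ?_⟩
  have h : ∀ k k', (if ∃ i, fanoLine k i = fanoLine k' 0 then f k else 0) +
      (if ∃ i, fanoLine k i = fanoLine k' 1 then f k else 0) +
      (if ∃ i, fanoLine k i = fanoLine k' 2 then f k else 0) =
      f k + if k = k' then 2 * f k else 0 := by
    intro k k'
    have : (∃ i, fanoLine k i = fanoLine k' 0) ∧ (∃ i, fanoLine k i = fanoLine k' 1) ∧
          (∃ i, fanoLine k i = fanoLine k' 2) ∧ k = k' ∨
        (∃ i, fanoLine k i = fanoLine k' 0) ∧ (¬ ∃ i, fanoLine k i = fanoLine k' 1) ∧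
          (¬ ∃ i, fanoLine k i = fanoLine k' 2) ∧ k ≠ k' ∨
        (¬ ∃ i, fanoLine k i = fanoLine k' 0) ∧ (∃ i, fanoLine k i = fanoLine k' 1) ∧
          (¬ ∃ i, fanoLine k i = fanoLine k' 2) ∧ k ≠ k' ∨
        (¬ ∃ i, fanoLine k i = fanoLine k' 0) ∧ (¬ ∃ i, fanoLine k i = fanoLine k' 1) ∧
          (∃ i, fanoLine k i = fanoLine k' 2) ∧ k ≠ k' := by
      revert k k'; decide
    rcases this with ⟨h0, h1, h2, h3⟩ | ⟨h0, h1, h2, h3⟩ | ⟨h0, h1, h2, h3⟩ | ⟨h0, h1, h2, h3⟩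
    · rw [if_pos h0, if_pos h1, if_pos h2, if_pos h3]; ring
    all_goals simp only [h0, h1, h2, h3, if_true, if_false]; ring
  have h' := Finset.sum_congr (rfl : (Finset.univ : Finset (Fin 7)) = _) fun i _ => h i k
  simp only [Finset.sum_add_distrib, Finset.sum_ite_eq', Finset.mem_univ, if_true] at h'
  linear_combination (1 / 2) * h'

theorem exists_xor_sum {K : Type*} [Field K] [CharZero K] (R : Fin 8 → Fin 8 → Fin 8 → K)
    (hR₁ : ∀ a b c, R a b c = R b a c) (hR₂ : ∀ a b c, R a b c = R a c b) :
    ∃ g : Fin 8 → Fin 8 → K, ∀ a b c, a ≠ b → a ≠ c → b ≠ c →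
      g (a ^^^ b) c + g (a ^^^ c) b + g (b ^^^ c) a = R a b c := by
  choose G hG using fun r : Fin 8 => exists_fanoLine_sum fun k =>
    R (r ^^^ fanoLine k 0) (r ^^^ fanoLine k 1) (r ^^^ fanoLine k 2)
  refine ⟨fun d c => G (d ^^^ c) d, fun a b c hab hac hbc => ?_⟩
  have comm : ∀ a b : Fin 8, a ^^^ b = b ^^^ a := by decide
  obtain ⟨k, hk⟩ := exists_fanoLine a b c hab hac hbc
  generalize a ^^^ b ^^^ c = r at hk
  dsimp only at hk
  have key := hG r k
  have h2 := xor_xor_fanoLine r k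
  obtain ⟨e2, e1, e0⟩ := fanoLine_xor r k
  have e2' := (comm _ _).trans e2
  have e1' := (comm _ _).trans e1
  have e0' := (comm _ _).trans e0
  rcases hk with ⟨rfl, rfl, rfl⟩ | ⟨rfl, rfl, rfl⟩ | ⟨rfl, rfl, rfl⟩ | ⟨rfl, rfl, rfl⟩ |
    ⟨rfl, rfl, rfl⟩ | ⟨rfl, rfl, rfl⟩ <;>
  simp only [e0, e1, e2, e0', e1', e2', h2]
  · linear_combination key
  · rw [hR₂]; linear_combination key
  · rw [hR₁]; linear_combination key
  · rw [hR₂, hR₁]; linear_combination key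
  · rw [hR₁, hR₂]; linear_combination key
  · rw [hR₁, hR₂, hR₁]; linear_combination key

/-- The points of a self-associated configuration in `ℙ⁷`: the coordinate points and the rows
of the Hadamard matrix `xorChar`. -/
def hadamardPoint (K : Type*) [Field K] : Fin 8 ⊕ Fin 8 → Fin 8 → K
  | .inl q, a => if q = a then 1 else 0
  | .inr p, a => xorChar p a

theorem hadamardPoint_surjective {K : Type*} [Field K] [CharZero K] (lam : Fin 8 ⊕ Fin 8 → K)
    (hlam : ∀ p, lam p ≠ 0) (R : Fin 8 → Fin 8 → Fin 8 → K)
    (hR₁ : ∀ a b c, R a b c = R b a c) (hR₂ : ∀ a b c, R a b c = R a c b) :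
    ∃ h : Fin 8 ⊕ Fin 8 → Fin 8 → K, ∀ a b c, ∑ p, lam p *
      (hadamardPoint K p a * hadamardPoint K p b * h p c +
        hadamardPoint K p a * h p b * hadamardPoint K p c +
        h p a * hadamardPoint K p b * hadamardPoint K p c) = R a b c := by
  obtain ⟨g, hg⟩ := exists_xor_sum R hR₁ hR₂
  let hr : Fin 8 → Fin 8 → K := fun p c => (∑ e, xorChar p e * g e c) / (8 * lam (.inr p))
  have hχ : ∀ d c : Fin 8, ∑ p, lam (.inr p) * (xorChar p d * hr p c) = g d c := by
    intro d c
    have : ∀ p, lam (.inr p) * (xorChar p d * hr p c) =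
        ∑ e, (xorChar p d * xorChar p e : K) * (g e c / 8) := fun p => by
      have := hlam (.inr p)
      simp only [hr, Finset.sum_div, Finset.mul_sum]
      refine Finset.sum_congr rfl fun e _ => ?_
      field_simp
    simp only [this]
    rw [Finset.sum_comm]
    simp only [← Finset.sum_mul, sum_xorChar_mul, ite_mul, zero_mul, Finset.sum_ite_eq,
      Finset.mem_univ, if_true]
    ring
  have hχ' : ∀ a b c : Fin 8, ∑ p, lam (.inr p) * (xorChar p a * xorChar p b * hr p c) =
      g (a ^^^ b) c := fun a b c => by
    rw [← hχ]
    refine Finset.sum_congr rfl fun p _ => ?_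
    rw [← xorChar_mul]; push_cast; ring
  let R' : Fin 8 → Fin 8 → Fin 8 → K := fun a b c =>
    R a b c - (g (a ^^^ b) c + g (a ^^^ c) b + g (b ^^^ c) a)
  have comm : ∀ a b : Fin 8, a ^^^ b = b ^^^ a := by decide
  have hR'₁ : ∀ a b c, R' a b c = R' b a c := fun a b c => by
    simp only [R', hR₁ a b c, comm a b]; ring
  have hR'₂ : ∀ a b c, R' a b c = R' a c b := fun a b c => by
    simp only [R', hR₂ a b c, comm b c]; ring
  have hR' : ∀ a b c, a ≠ b → a ≠ c → b ≠ c → R' a b c = 0 := fun a b c h1 h2 h3 => by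
    simp only [R', hg a b c h1 h2 h3, sub_self]
  let hl : Fin 8 → Fin 8 → K := fun q c => R' q q c / (lam (.inl q) * if q = c then 3 else 1)
  refine ⟨Sum.elim hl hr, fun a b c => ?_⟩
  have hright : ∑ p, lam (.inr p) * (xorChar p a * xorChar p b * hr p c +
      xorChar p a * hr p b * xorChar p c + hr p a * xorChar p b * xorChar p c) =
      R a b c - R' a b c := by
    have : R a b c - R' a b c = g (a ^^^ b) c + g (a ^^^ c) b + g (b ^^^ c) a := by simp [R']
    rw [this, ← hχ' a b c, ← hχ' a c b, ← hχ' b c a, ← Finset.sum_add_distrib,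
      ← Finset.sum_add_distrib]
    exact Finset.sum_congr rfl fun p _ => by ring
  have hleft : ∑ q, lam (.inl q) * ((if q = a then 1 else 0) * (if q = b then 1 else 0) * hl q c +
      (if q = a then 1 else 0) * hl q b * (if q = c then 1 else 0) +
      hl q a * (if q = b then 1 else 0) * (if q = c then 1 else 0)) = R' a b c := by
    have : ∀ q, lam (.inl q) *
        ((if q = a then 1 else 0) * (if q = b then 1 else 0) * hl q c +
          (if q = a then 1 else 0) * hl q b * (if q = c then 1 else 0) +
          hl q a * (if q = b then 1 else 0) * (if q = c then 1 else 0)) =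
        (if q = a then (if q = b then lam (.inl q) * hl q c else 0) else 0) +
        (if q = a then (if q = c then lam (.inl q) * hl q b else 0) else 0) +
        (if q = b then (if q = c then lam (.inl q) * hl q a else 0) else 0) := fun q => by
      split_ifs <;> ring
    simp only [this, Finset.sum_add_distrib, Finset.sum_ite_eq', Finset.mem_univ, if_true]
    have ha := hlam (.inl a)
    have hb := hlam (.inl b)
    by_cases hab : a = b
    · subst hab
      by_cases hac : a = c
      · subst hac
        simp only [if_true, hl]
        field_simp
        norm_num
      · simp only [if_true, hl, hac, if_false]
        field_simp
        ring
    · by_cases hac : a = c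
      · subst hac
        simp only [if_true, hl, hab, Ne.symm hab, if_false]
        rw [hR'₂ a b a]
        field_simp
        ring
      · by_cases hbc : b = c
        · subst hbc
          simp only [if_true, hl, hab, Ne.symm hab, if_false]
          rw [hR'₁ a b b, hR'₂ b a b]
          field_simp
          ring
        · simp [hab, hac, hbc, hR' a b c hab hac hbc]
  simp only [Fintype.sum_sum_type, hadamardPoint, Sum.elim_inl, Sum.elim_inr]
  rw [hleft, hright]
  ring

open PowerSeries in
theorem exists_ringHom_powerSeries_of_isDiscreteValuationRing {K D : Type*} [Field K] [CommRing D]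
    [IsDomain D] [IsDiscreteValuationRing D] [Algebra K D]
    (hres : ∀ a : D, ∃ c : K, a - algebraMap K D c ∈ IsLocalRing.maximalIdeal D) :
    ∃ φ : D →ₐ[K] K⟦X⟧, Function.Injective φ ∧
      ∀ a ∈ IsLocalRing.maximalIdeal D, constantCoeff (φ a) = 0 := by
  obtain ⟨π, hπ⟩ := IsDiscreteValuationRing.exists_irreducible D
  have hmax : ∀ a, a ∈ IsLocalRing.maximalIdeal D ↔ π ∣ a := fun a => by
    rw [hπ.maximalIdeal_eq, Ideal.mem_span_singleton]
  have hπ0 : π ≠ 0 := hπ.ne_zero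
  let rel : D → K⟦X⟧ → Prop := fun a f => ∀ n, π ^ n ∣ a - Polynomial.aeval π (trunc n f)
  have hex : ∀ a, ∃ f, rel a f := by
    have : ∀ a : D, ∃ c : K, ∃ q : D, a = algebraMap K D c + π * q := fun a => by
      obtain ⟨c, hc⟩ := hres a
      obtain ⟨q, hq⟩ := (hmax _).mp hc
      exact ⟨c, q, by rw [← hq]; ring⟩
    choose c q hcq using this
    refine fun a => ⟨mk fun n => c (q^[n] a), fun n => ⟨q^[n] a, ?_⟩⟩
    induction n with
    | zero => simp
    | succ n ih =>
      rw [trunc_succ, map_add, ← sub_sub, ih, Function.iterate_succ_apply', Polynomial.aeval_monomial,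
        coeff_mk]
      have := hcq (q^[n] a)
      linear_combination π ^ n * this
  have huniq0 : ∀ f, rel 0 f → f = 0 := by
    intro f hf
    ext n
    induction n using Nat.strong_induction_on with
    | _ n ih =>
      have h0 : trunc n f = 0 := by
        ext m
        rw [coeff_trunc]
        split_ifs with h
        · simpa using ih m h
        · simp
      have h1 := hf (n + 1)
      rw [trunc_succ, h0, zero_add, Polynomial.aeval_monomial, zero_sub, dvd_neg, pow_succ,
        mul_comm (algebraMap K D _), mul_dvd_mul_iff_left (pow_ne_zero n hπ0)] at h1
      by_contra hne
      exact hπ.not_isUnit (isUnit_of_dvd_unit h1 ((IsUnit.mk0 _ hne).map (algebraMap K D)))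
  have hadd : ∀ a b f g, rel a f → rel b g → rel (a + b) (f + g) := fun a b f g hf hg n => by
    rw [map_add, map_add, add_sub_add_comm]
    exact dvd_add (hf n) (hg n)
  have hneg : ∀ a f, rel a f → rel (-a) (-f) := fun a f hf n => by
    rw [map_neg, map_neg, ← neg_sub', dvd_neg]
    exact hf n
  have huniq : ∀ a f g, rel a f → rel a g → f = g := fun a f g hf hg => by
    have := hadd _ _ _ _ hf (hneg _ _ hg)
    rw [add_neg_cancel] at this
    exact add_neg_eq_zero.mp (huniq0 _ this)
  have hmul : ∀ a b f g, rel a f → rel b g → rel (a * b) (f * g) := fun a b f g hf hg n => by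
    have h1 : (Polynomial.X : Polynomial K) ^ n ∣ trunc n f * trunc n g - trunc n (f * g) := by
      rw [Polynomial.X_pow_dvd_iff]
      intro d hd
      rw [Polynomial.coeff_sub, coeff_trunc, if_pos hd,
        coeff_mul_eq_coeff_trunc_mul_trunc _ _ hd, sub_eq_zero, ← Polynomial.coe_mul,
        Polynomial.coeff_coe]
    have h2 := map_dvd (Polynomial.aeval π) h1
    rw [map_pow, Polynomial.aeval_X, map_sub, map_mul] at h2
    have h3 := dvd_add (dvd_add (Dvd.dvd.mul_right (hf n) b)
      (Dvd.dvd.mul_left (hg n) (Polynomial.aeval π (trunc n f)))) h2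
    convert h3 using 1
    ring
  have hC : ∀ c : K, rel (algebraMap K D c) (C c) := fun c n => by
    rcases n with _ | n
    · simp
    · rw [trunc_C]; simp
  choose φ hφ using hex
  refine ⟨{ toFun := φ
            map_one' := huniq _ _ _ (hφ 1) (by simpa using hC 1)
            map_zero' := huniq _ _ _ (hφ 0) (by simpa using hC 0)
            map_mul' := fun a b => huniq _ _ _ (hφ _) (hmul _ _ _ _ (hφ a) (hφ b))
            map_add' := fun a b => huniq _ _ _ (hφ _) (hadd _ _ _ _ (hφ a) (hφ b))
            commutes' := fun c => huniq _ _ _ (hφ _) (hC c) }, ?_, ?_⟩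
  · refine (injective_iff_map_eq_zero _).mpr fun a ha => ?_
    have ha' : φ a = 0 := ha
    have : a ∈ ⨅ n, (IsLocalRing.maximalIdeal D) ^ n := by
      rw [Ideal.mem_iInf]
      intro n
      rw [hπ.maximalIdeal_eq, Ideal.span_singleton_pow, Ideal.mem_span_singleton]
      simpa [ha'] using hφ a n
    rwa [Ideal.iInf_pow_eq_bot_of_isLocalRing _ Ideal.IsPrime.ne_top'] at this
  · intro a ha
    have h1 := hφ a 1
    rw [trunc_one_left, Polynomial.aeval_C, pow_one, ← (hmax _).eq] at h1
    have h2 := sub_mem ha h1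
    rw [sub_sub_cancel] at h2
    rw [coeff_zero_eq_constantCoeff_apply] at h2
    change constantCoeff (φ a) = 0
    by_contra hne
    exact (IsLocalRing.mem_maximalIdeal _).mp h2 ((IsUnit.mk0 _ hne).map (algebraMap K D))

open Polynomial in
theorem exists_ringHom_laurentSeries_of_finite {K L : Type} [Field K] [IsAlgClosed K] [CharZero K]
    [Field L] [Algebra K[X] L] [Algebra (RatFunc K) L] [IsScalarTower K[X] (RatFunc K) L]
    [FiniteDimensional (RatFunc K) L] :
    ∃ (ψ : L →+* LaurentSeries K) (τ : PowerSeries K), PowerSeries.constantCoeff τ = 0 ∧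
      ψ (algebraMap K[X] L X) = algebraMap (PowerSeries K) (LaurentSeries K) τ ∧
      ∀ c, ψ (algebraMap K[X] L (C c)) =
        algebraMap (PowerSeries K) (LaurentSeries K) (PowerSeries.C c) := by
  let _ : Algebra K L := ((algebraMap K[X] L).comp C).toAlgebra
  have : IsScalarTower K K[X] L := .of_algebraMap_eq fun _ => rfl
  let O := integralClosure K[X] L
  have : CharZero (RatFunc K) :=
    charZero_of_injective_algebraMap (algebraMap K (RatFunc K)).injective
  have : IsDedekindDomain O := integralClosure.isDedekindDomain K[X] (RatFunc K) L
  have : IsFractionRing O L :=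
    integralClosure.isFractionRing_of_finite_extension (RatFunc K) L
  have hinj : Function.Injective (algebraMap K[X] L) := by
    rw [IsScalarTower.algebraMap_eq K[X] (RatFunc K) L]
    exact (algebraMap (RatFunc K) L).injective.comp (RatFunc.algebraMap_injective K)
  have hinjO : Function.Injective (algebraMap K[X] O) := by
    have : Function.Injective (algebraMap O L ∘ algebraMap K[X] O) := by
      rw [← RingHom.coe_comp, ← IsScalarTower.algebraMap_eq K[X] O L]; exact hinj
    exact this.of_comp
  have hXmax : (Ideal.span {(X : K[X])}).IsMaximal :=
    PrincipalIdealRing.isMaximal_of_irreducible irreducible_X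
  obtain ⟨P, hP, hPX⟩ := Ideal.exists_ideal_over_maximal_of_isIntegral (S := O)
    (Ideal.span {(X : K[X])}) (by
      rw [(RingHom.injective_iff_ker_eq_bot _).mp hinjO]; exact bot_le)
  have hXP : algebraMap K[X] O X ∈ P := by
    rw [← Ideal.mem_comap, hPX]; exact Ideal.mem_span_singleton_self X
  have hX0 : algebraMap K[X] (O ⧸ P) X = 0 := by
    rw [IsScalarTower.algebraMap_apply K[X] O (O ⧸ P)]
    exact Ideal.Quotient.eq_zero_iff_mem.mpr hXP
  have hP0 : P ≠ ⊥ := by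
    rintro rfl
    exact X_ne_zero (hinjO (by rw [map_zero]; exact hXP))
  have hres : ∀ a : O, ∃ c : K, a - algebraMap K O c ∈ P := by
    have hcomp : algebraMap K[X] (O ⧸ P) =
        (algebraMap K (O ⧸ P)).comp (evalRingHom (0 : K)) := by
      refine ringHom_ext (fun c => ?_) (by simp [hX0])
      simp only [RingHom.comp_apply, coe_evalRingHom, eval_C]
      exact (IsScalarTower.algebraMap_apply K K[X] (O ⧸ P) c).symm
    have hint : Algebra.IsIntegral K (O ⧸ P) := ⟨fun a => by
      obtain ⟨p, hp, hpa⟩ := (Algebra.IsIntegral.isIntegral (R := K[X]) a)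
      refine ⟨p.map (evalRingHom 0), hp.map _, ?_⟩
      rwa [eval₂_map, ← hcomp]⟩
    intro a
    obtain ⟨c, hc⟩ := (IsAlgClosed.algebraMap_bijective_of_isIntegral (k := K)
      (K := O ⧸ P)).2 (Ideal.Quotient.mk P a)
    exact ⟨c, Ideal.Quotient.eq.mp hc.symm⟩
  let D := Localization.AtPrime P
  have : IsDiscreteValuationRing D :=
    IsLocalization.AtPrime.isDiscreteValuationRing_of_dedekind_domain O hP0 D
  have hmem : ∀ a ∈ P, algebraMap O D a ∈ IsLocalRing.maximalIdeal D := fun a ha =>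
    (IsLocalization.AtPrime.to_map_mem_maximal_iff D P a).mpr ha
  obtain ⟨φ, hφ, hφ0⟩ := exists_ringHom_powerSeries_of_isDiscreteValuationRing (K := K) (D := D)
    (by
      intro d
      obtain ⟨a, b, rfl⟩ := IsLocalization.exists_mk'_eq P.primeCompl d
      obtain ⟨ca, hca⟩ := hres a
      obtain ⟨cb, hcb⟩ := hres b
      have hcb0 : cb ≠ 0 := by
        rintro rfl
        exact b.2 (by simpa using hcb)
      refine ⟨ca / cb, ?_⟩
      have hb : IsUnit (algebraMap O D b) := IsLocalization.map_units D b
      have h2 : (IsLocalization.mk' D a b - algebraMap K D (ca / cb)) * algebraMap O D b =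
          algebraMap O D (a - algebraMap K O (ca / cb) * b) := by
        rw [map_sub, map_mul, ← IsScalarTower.algebraMap_apply K O D,
          ← IsLocalization.mk'_spec D a b]
        ring
      refine (Ideal.mul_unit_mem_iff_mem _ hb).mp ?_
      rw [h2]
      refine hmem _ ?_
      have h1 : (a : O) - algebraMap K O (ca / cb) * b =
          (a - algebraMap K O ca) - algebraMap K O (ca / cb) * (b - algebraMap K O cb) := by
        rw [mul_sub, ← map_mul, div_mul_cancel₀ _ hcb0]; ring
      rw [h1]
      exact sub_mem hca (P.mul_mem_left _ hcb))
  let f : O →+* LaurentSeries K :=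
    (algebraMap (PowerSeries K) (LaurentSeries K)).comp
      ((φ : D →+* PowerSeries K).comp (algebraMap O D))
  have hf : Function.Injective f := by
    have h1 : Function.Injective (algebraMap O D) :=
      IsLocalization.injective D P.primeCompl_le_nonZeroDivisors
    have h2 : Function.Injective (algebraMap (PowerSeries K) (LaurentSeries K)) :=
      IsFractionRing.injective _ _
    exact h2.comp (hφ.comp h1)
  refine ⟨IsFractionRing.lift hf, φ (algebraMap O D (algebraMap K[X] O X)),
    hφ0 _ (hmem _ hXP), ?_, fun c => ?_⟩
  · rw [IsScalarTower.algebraMap_apply K[X] O L, IsFractionRing.lift_algebraMap]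
    rfl
  · rw [IsScalarTower.algebraMap_apply K[X] O L, IsFractionRing.lift_algebraMap]
    have h1 : algebraMap O D (algebraMap K[X] O (C c)) = algebraMap K D c := by
      rw [IsScalarTower.algebraMap_apply K O D]; rfl
    have h2 : φ (algebraMap O D (algebraMap K[X] O (C c))) = PowerSeries.C c := by
      rw [h1]; exact φ.commutes c
    exact congrArg (algebraMap (PowerSeries K) (LaurentSeries K)) h2

open Polynomial in
theorem exists_ringHom_laurentSeries_of_transcendental {K R : Type} [Field K] [IsAlgClosed K]
    [CharZero K] [CommRing R] [IsDomain R] [Algebra K R] [Algebra.FiniteType K R] (s : R)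
    (hs : Transcendental K s) :
    ∃ (ψ : R →+* LaurentSeries K) (τ : PowerSeries K), PowerSeries.constantCoeff τ = 0 ∧
      ψ s = algebraMap (PowerSeries K) (LaurentSeries K) τ ∧
      ∀ c, ψ (algebraMap K R c) =
        algebraMap (PowerSeries K) (LaurentSeries K) (PowerSeries.C c) := by
  let _ : Algebra K[X] R := (aeval s).toAlgebra
  have hX : algebraMap K[X] R X = s := aeval_X s
  have : IsScalarTower K K[X] R := .of_algebraMap_eq fun c => by
    simp [RingHom.algebraMap_toAlgebra]
  have hinj : Function.Injective (algebraMap K[X] R) := transcendental_iff_injective.mp hs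
  have : Algebra.FiniteType K[X] R := .of_restrictScalars_finiteType K K[X] R
  have : FaithfulSMul K[X] R := (faithfulSMul_iff_algebraMap_injective _ _).mpr hinj
  let T := TensorProduct K[X] (RatFunc K) R
  have : Nontrivial T := by
    let F := FractionRing R
    let g : RatFunc K →ₐ[K[X]] F := IsFractionRing.liftAlgHom (A := K[X]) (K := RatFunc K)
      (g := Algebra.ofId K[X] F) (by
        exact (FaithfulSMul.algebraMap_injective K[X] F))
    exact (Algebra.TensorProduct.lift g (Algebra.ofId R F |>.restrictScalars K[X])
      (fun _ _ => .all _ _)).toRingHom.domain_nontrivial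
  obtain ⟨M, hM⟩ := Ideal.exists_maximal T
  let L := T ⧸ M
  let _ : Field L := Ideal.Quotient.field M
  have : FiniteDimensional (RatFunc K) L := finite_of_finite_type_of_isJacobsonRing _ _
  obtain ⟨ψ, τ, hτ, hψ, hψC⟩ := exists_ringHom_laurentSeries_of_finite (K := K) (L := L)
  let g : R →ₐ[K[X]] L := (Ideal.Quotient.mkₐ K[X] M).comp
    (Algebra.TensorProduct.includeRight : R →ₐ[K[X]] T)
  refine ⟨ψ.comp g, τ, hτ, ?_, fun c => ?_⟩
  · rw [← hψ, ← g.commutes, hX]; rfl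
  · rw [← hψC, ← g.commutes, IsScalarTower.algebraMap_apply K K[X] R]; rfl

/-- A linear form annihilating the third moment of `hadamardPoint` weighted by
`hadamardWeight`. -/
def hadamardForm (K : Type*) [Field K] (a : Fin 8) : K := if a = 0 then 2 else 1

/-- Nonzero weights for which `hadamardForm` annihilates the third moment of `hadamardPoint`. -/
def hadamardWeight (K : Type*) [Field K] : Fin 8 ⊕ Fin 8 → K
  | .inl q => -8 / hadamardForm K q
  | .inr p => 1 / if p = 0 then 9 else 1

section
variable {K : Type*} [Field K] [CharZero K]

theorem hadamardWeight_ne_zero (p : Fin 8 ⊕ Fin 8) : hadamardWeight K p ≠ 0 := by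
  rcases p with q | p <;> simp only [hadamardWeight, hadamardForm] <;> split_ifs <;> norm_num

theorem hadamardForm_point (p : Fin 8 ⊕ Fin 8) :
    hadamardWeight K p * ∑ a, hadamardForm K a * hadamardPoint K p a =
      Sum.elim (fun _ => -8) (fun _ => 1) p := by
  rcases p with q | p
  · have : hadamardForm K q ≠ 0 := by simp only [hadamardForm]; split_ifs <;> norm_num
    simp [hadamardPoint, hadamardWeight, this]
  · have h : ∀ a, hadamardForm K a * hadamardPoint K (.inr p) a =
        (xorChar p a : K) + if a = 0 then (xorChar p a : K) else 0 := fun a => by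
      simp only [hadamardForm, hadamardPoint]; split_ifs <;> ring
    have h1 := congrArg (Int.cast : ℤ → K) (sum_xorChar_right p)
    push_cast at h1
    simp only [h, Finset.sum_add_distrib, h1, Finset.sum_ite_eq', Finset.mem_univ, if_true,
      xorChar_zero, Int.cast_one, hadamardWeight, Sum.elim_inr]
    split_ifs <;> norm_num

theorem hadamardForm_point_ne_zero (p : Fin 8 ⊕ Fin 8) :
    ∑ a, hadamardForm K a * hadamardPoint K p a ≠ 0 := by
  intro h
  have := hadamardForm_point (K := K) p
  rw [h, mul_zero] at this
  rcases p with q | p <;> simp at this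

theorem hadamardForm_contract (b c : Fin 8) :
    ∑ a, hadamardForm K a * ∑ p, hadamardWeight K p *
      (hadamardPoint K p a * hadamardPoint K p b * hadamardPoint K p c) = 0 := by
  have : ∀ p, ∑ a, hadamardForm K a * (hadamardWeight K p *
      (hadamardPoint K p a * hadamardPoint K p b * hadamardPoint K p c)) =
      Sum.elim (fun _ => -8) (fun _ => 1) p * (hadamardPoint K p b * hadamardPoint K p c) :=
    fun p => by
      rw [← hadamardForm_point, Finset.mul_sum, Finset.sum_mul]
      exact Finset.sum_congr rfl fun a _ => by ring
  simp only [Finset.mul_sum]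
  rw [Finset.sum_comm]
  rw [Finset.sum_congr rfl fun p _ => this p]
  simp only [Fintype.sum_sum_type, Sum.elim_inl, Sum.elim_inr, one_mul, hadamardPoint,
    sum_xorChar_mul, ← Finset.mul_sum]
  by_cases h : b = c <;> simp [h, eq_comm]

end

theorem transcendental_one_sub_powerSeries_X (K : Type*) [Field K] :
    Transcendental K (1 - PowerSeries.X : PowerSeries K) := by
  have h : Transcendental K (PowerSeries.X : PowerSeries K) := by
    rw [transcendental_iff_injective]
    have : (Polynomial.aeval (PowerSeries.X : PowerSeries K)) =
      (Polynomial.coeToPowerSeries.algHom K : Polynomial K →ₐ[K] PowerSeries K) := by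
      ext1; simp
    rw [this]
    intro p q hpq
    exact Polynomial.coe_injective K (by simpa using hpq)
  intro h'
  exact h (by simpa using isAlgebraic_one.sub h')

/-- Every symmetric cubic tensor in seven variables is the special value of a cubic tensor over
`K((t))` which is the third moment of `16` weighted points with vanishing lower moments. -/
theorem exists_laurentSeries_moments {K : Type} [Field K] [IsAlgClosed K] [CharZero K]
    (F : Fin 7 → Fin 7 → Fin 7 → K) (hF₁ : ∀ i j k, F i j k = F j i k)
    (hF₂ : ∀ i j k, F i j k = F i k j) :
    ∃ (μ : Fin 8 ⊕ Fin 8 → LaurentSeries K) (y : Fin 7 → Fin 8 ⊕ Fin 8 → LaurentSeries K)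
      (F' : Fin 7 → Fin 7 → Fin 7 → PowerSeries K),
      (∀ p, μ p ≠ 0) ∧ ∑ p, μ p = 0 ∧ (∀ i, ∑ p, μ p * y i p = 0) ∧
      (∀ i j, ∑ p, μ p * (y i p * y j p) = 0) ∧
      (∀ i j k, ∑ p, μ p * (y i p * y j p * y k p) =
        algebraMap (PowerSeries K) (LaurentSeries K) (F' i j k)) ∧
      ∀ i j k, PowerSeries.constantCoeff (F' i j k) = F i j k := by
  let l := hadamardForm K
  let lam := hadamardWeight K
  let x₀ := hadamardPoint K
  let G : Fin 8 → Fin 8 → Fin 8 → K := fun a b c => ∑ p, lam p * (x₀ p a * x₀ p b * x₀ p c)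
  let π : Fin 8 → Fin 7 → K := fun a i => Fin.cases (-1 / 2) (fun j => if i = j then 1 else 0) a
  let H : Fin 8 → Fin 8 → Fin 8 → K := fun a b c => ∑ i, ∑ j, ∑ k, π a i * π b j * π c k * F i j k
  have hπ : ∀ i, ∑ a, l a * π a i = 0 := fun i => by
    simp [Fin.sum_univ_succ (n := 7), l, hadamardForm, π, Fin.succ_ne_zero]
    norm_num
  have hH : ∀ i j k : Fin 7, H i.succ j.succ k.succ = F i j k := fun i j k => by
    simp [H, π]
  have hlH : ∀ b c, ∑ a, l a * H a b c = 0 := fun b c => by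
    have : ∑ a, l a * H a b c = ∑ i, (∑ a, l a * π a i) *
        ∑ j, ∑ k, π b j * π c k * F i j k := by
      simp only [H, Finset.mul_sum]
      rw [Finset.sum_comm]
      simp only [Finset.sum_mul]
      refine Finset.sum_congr rfl fun i _ => ?_
      rw [Finset.sum_comm]
      refine Finset.sum_congr rfl fun j _ => ?_
      rw [Finset.sum_comm]
      exact Finset.sum_congr rfl fun k _ => Finset.sum_congr rfl fun a _ => by ring
    simp [this, hπ]
  have hlG : ∀ b c, ∑ a, l a * G a b c = 0 := hadamardForm_contract
  have hG₁ : ∀ a b c, G a b c = G b a c := fun a b c => Finset.sum_congr rfl fun p _ => by ring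
  have hG₂ : ∀ a b c, G a b c = G a c b := fun a b c => Finset.sum_congr rfl fun p _ => by ring
  have hH₁ : ∀ a b c, H a b c = H b a c := fun a b c => by
    simp only [H]
    rw [Finset.sum_comm]
    refine Finset.sum_congr rfl fun i _ => Finset.sum_congr rfl fun j _ =>
      Finset.sum_congr rfl fun k _ => ?_
    rw [hF₁]; ring
  have hH₂ : ∀ a b c, H a b c = H a c b := fun a b c => by
    simp only [H]
    refine Finset.sum_congr rfl fun i _ => ?_
    rw [Finset.sum_comm]
    refine Finset.sum_congr rfl fun j _ => Finset.sum_congr rfl fun k _ => ?_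
    rw [hF₂]; ring
  obtain ⟨x, hx₀, hx⟩ := exists_powerSeries_cubic_solution lam x₀
    (hadamardPoint_surjective lam hadamardWeight_ne_zero)
    (fun a b c => PowerSeries.C (H a b c) +
      (1 - PowerSeries.X) * PowerSeries.C (G a b c - H a b c))
    (fun a b c => by rw [hG₁ a b c, hH₁ a b c]) (fun a b c => by rw [hG₂ a b c, hH₂ a b c])
    (fun a b c => by simp [G])
  have hunit : ∀ p, ∃ u : PowerSeries K, (∑ a, PowerSeries.C (l a) * x p a) * u = 1 := fun p => by
    rw [← isUnit_iff_exists_inv, PowerSeries.isUnit_iff_constantCoeff, isUnit_iff_ne_zero]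
    simpa [hx₀] using hadamardForm_point_ne_zero p
  choose u hu using hunit
  let gens : Set (PowerSeries K) := {1 - PowerSeries.X} ∪
    (Set.range (fun q : (Fin 8 ⊕ Fin 8) × Fin 8 => x q.1 q.2) ∪ Set.range u)
  let R := Algebra.adjoin K gens
  have : Algebra.FiniteType K R := Subalgebra.fg_iff_finiteType _ |>.mp <|
    Subalgebra.fg_def.mpr ⟨gens, (Set.finite_singleton _).union
      ((Set.finite_range _).union (Set.finite_range _)), rfl⟩
  let s : R := ⟨1 - PowerSeries.X, Algebra.subset_adjoin (Or.inl rfl)⟩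
  let x' : Fin 8 ⊕ Fin 8 → Fin 8 → R := fun p a =>
    ⟨x p a, Algebra.subset_adjoin (Or.inr (Or.inl ⟨(p, a), rfl⟩))⟩
  let u' : Fin 8 ⊕ Fin 8 → R := fun p => ⟨u p, Algebra.subset_adjoin (Or.inr (Or.inr ⟨p, rfl⟩))⟩
  have hs : Transcendental K s := fun h =>
    transcendental_one_sub_powerSeries_X K (h.algHom R.val)
  have hx' : ∀ a b c, ∑ p, algebraMap K R (lam p) * (x' p a * x' p b * x' p c) =
      algebraMap K R (H a b c) + s * algebraMap K R (G a b c - H a b c) := fun a b c =>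
    Subtype.val_injective (by simpa [x', s, ← PowerSeries.C_eq_algebraMap] using hx a b c)
  have hu' : ∀ p, (∑ a, algebraMap K R (l a) * x' p a) * u' p = 1 := fun p =>
    Subtype.val_injective (by simpa [x', u', ← PowerSeries.C_eq_algebraMap] using hu p)
  obtain ⟨ψ, τ, hτ, hψ, hψC⟩ := exists_ringHom_laurentSeries_of_transcendental s hs
  let κ : K →+* LaurentSeries K :=
    (algebraMap (PowerSeries K) (LaurentSeries K)).comp PowerSeries.C
  replace hψC : ∀ c, ψ (algebraMap K R c) = κ c := hψC
  let Y : Fin 8 ⊕ Fin 8 → Fin 8 → LaurentSeries K := fun p a => ψ (x' p a)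
  let U : Fin 8 ⊕ Fin 8 → LaurentSeries K := fun p => ψ (u' p)
  let ℓ : Fin 8 ⊕ Fin 8 → LaurentSeries K := fun p => ∑ a, κ (l a) * Y p a
  have hU : ∀ p, ℓ p * U p = 1 := fun p => by
    simpa [hψC] using congrArg ψ (hu' p)
  have hY : ∀ a b c, ∑ p, κ (lam p) * (Y p a * Y p b * Y p c) =
      κ (H a b c) + ψ s * κ (G a b c - H a b c) := fun a b c => by
    have := congrArg ψ (hx' a b c)
    simpa only [map_sum, map_mul, map_add, hψC] using this
  have h2 : ∀ b c, ∑ p, κ (lam p) * (ℓ p * Y p b * Y p c) = 0 := fun b c => by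
    have : ∑ p, κ (lam p) * (ℓ p * Y p b * Y p c) =
        ∑ a, κ (l a) * ∑ p, κ (lam p) * (Y p a * Y p b * Y p c) := by
      simp only [ℓ, Finset.mul_sum, Finset.sum_mul]
      rw [Finset.sum_comm]
      exact Finset.sum_congr rfl fun _ _ => Finset.sum_congr rfl fun _ _ => by ring
    have h3 : ∀ a, κ (l a) * (κ (H a b c) + ψ s * κ (G a b c - H a b c)) =
        κ (l a * H a b c) + ψ s * (κ (l a * G a b c) - κ (l a * H a b c)) := fun a => by
      simp only [map_mul, map_sub]; ring
    simp only [this, hY, h3, Finset.sum_add_distrib, ← Finset.mul_sum, Finset.sum_sub_distrib,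
      ← map_sum, hlH, hlG, map_zero, sub_zero, mul_zero, add_zero]
  have h1 : ∀ c, ∑ p, κ (lam p) * (ℓ p * ℓ p * Y p c) = 0 := fun c => by
    have : ∑ p, κ (lam p) * (ℓ p * ℓ p * Y p c) =
        ∑ b, κ (l b) * ∑ p, κ (lam p) * (ℓ p * Y p b * Y p c) := by
      simp only [Finset.mul_sum]
      rw [Finset.sum_comm]
      refine Finset.sum_congr rfl fun p _ => ?_
      nth_rw 2 [show ℓ p = ∑ a, κ (l a) * Y p a from rfl]
      simp only [Finset.mul_sum, Finset.sum_mul]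
      exact Finset.sum_congr rfl fun _ _ => by ring
    simp [this, h2]
  have h0 : ∑ p, κ (lam p) * (ℓ p * ℓ p * ℓ p) = 0 := by
    have : ∑ p, κ (lam p) * (ℓ p * ℓ p * ℓ p) =
        ∑ c, κ (l c) * ∑ p, κ (lam p) * (ℓ p * ℓ p * Y p c) := by
      simp only [Finset.mul_sum]
      rw [Finset.sum_comm]
      refine Finset.sum_congr rfl fun p _ => ?_
      nth_rw 3 [show ℓ p = ∑ a, κ (l a) * Y p a from rfl]
      simp only [Finset.mul_sum]
      exact Finset.sum_congr rfl fun _ _ => by ring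
    simp [this, h1]
  refine ⟨fun p => κ (lam p) * (ℓ p * ℓ p * ℓ p), fun i p => Y p i.succ * U p,
    fun i j k => PowerSeries.C (F i j k) +
      τ * PowerSeries.C (G i.succ j.succ k.succ - F i j k), fun p => ?_, h0, fun i => ?_,
    fun i j => ?_, fun i j k => ?_, fun i j k => ?_⟩
  · have := left_ne_zero_of_mul_eq_one (hU p)
    exact mul_ne_zero ((map_ne_zero κ).mpr (hadamardWeight_ne_zero p)) (by simp [this])
  · rw [← h1 i.succ]
    exact Finset.sum_congr rfl fun p _ => by
      linear_combination κ (lam p) * (ℓ p * ℓ p * Y p i.succ) * hU p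
  · rw [← h2 i.succ j.succ]
    exact Finset.sum_congr rfl fun p _ => by
      linear_combination κ (lam p) * (ℓ p * Y p i.succ * Y p j.succ) * (ℓ p * U p + 1) * hU p
  · rw [map_add, map_mul, ← hψ, ← hH i j k]
    refine Eq.trans ?_ (hY i.succ j.succ k.succ)
    exact Finset.sum_congr rfl fun p _ => by
      linear_combination κ (lam p) * (Y p i.succ * Y p j.succ * Y p k.succ) *
        ((ℓ p * U p) ^ 2 + ℓ p * U p + 1) * hU p
  · simp [hτ]

open PowerSeries in
/-- If `B` is a `K[[X]]`-algebra with a basis whose structure constants specialise to those of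
a basis of `A`, then `B/(X)B ≅ A`. -/
theorem nonempty_quotient_X_algEquiv {K A B ι : Type*} [Field K] [CommRing A] [Algebra K A]
    [CommRing B] [Algebra K⟦X⟧ B] [Algebra K B] [IsScalarTower K K⟦X⟧ B] [Fintype ι]
    (bA : Module.Basis ι K A) (bB : Module.Basis ι K⟦X⟧ B) (i₀ : ι) (hA₀ : bA i₀ = 1)
    (hB₀ : bB i₀ = 1) (c : ι → ι → ι → K⟦X⟧) (hB : ∀ i j, bB i * bB j = ∑ k, c i j k • bB k)
    (hA : ∀ i j, bA i * bA j = ∑ k, constantCoeff (c i j k) • bA k) :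
    Nonempty ((B ⧸ Ideal.span {algebraMap K⟦X⟧ B X}) ≃ₐ[K] A) := by
  let : Algebra K⟦X⟧ A := Algebra.compHom A (constantCoeff (R := K))
  have hsmul : ∀ (r : K⟦X⟧) (a : A), r • a = constantCoeff r • a := fun _ _ => rfl
  have : IsScalarTower K K⟦X⟧ A := ⟨fun x y z => by simp [hsmul, mul_smul]⟩
  let f := bB.constr K⟦X⟧ bA
  have hf : ∀ i, f (bB i) = bA i := bB.constr_basis K⟦X⟧ bA
  have hmul : (LinearMap.mul K⟦X⟧ B).compr₂ f = (LinearMap.mul K⟦X⟧ A).compl₁₂ f f := by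
    refine bB.ext fun i => bB.ext fun j => ?_
    simp [hf, hB, hA, hsmul]
  let g : B →ₐ[K⟦X⟧] A := AlgHom.ofLinearMap f (by rw [← hB₀, hf, hA₀])
    fun x y => LinearMap.congr_fun₂ hmul x y
  have hg : ∀ b, g b = ∑ i, constantCoeff (bB.repr b i) • bA i := fun b => by
    change f b = _
    rw [Module.Basis.constr_apply_fintype]; rfl
  have hsurj : Function.Surjective (g.restrictScalars K) := fun a =>
    ⟨∑ i, C (bA.repr a i) • bB i, by
      change g _ = a
      rw [map_sum]
      simp only [map_smul]
      change ∑ i, C (bA.repr a i) • f (bB i) = a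
      simp [hf, hsmul, bA.sum_repr]⟩
  have hker : Ideal.span {algebraMap K⟦X⟧ B X} = RingHom.ker (g.restrictScalars K) := by
    refine le_antisymm ?_ fun b hb => ?_
    · rw [Ideal.span_singleton_le_iff_mem, RingHom.mem_ker]
      change g (algebraMap K⟦X⟧ B X) = 0
      rw [AlgHom.commutes, Algebra.algebraMap_eq_smul_one, hsmul]; simp
    · have hb' : g b = 0 := hb
      rw [hg] at hb'
      have h0 := Fintype.linearIndependent_iff.mp bA.linearIndependent _ hb'
      choose z hz using fun i => X_dvd_iff.mpr (h0 i)
      rw [Ideal.mem_span_singleton]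
      refine ⟨∑ i, z i • bB i, ?_⟩
      rw [← Algebra.smul_def, Finset.smul_sum]
      conv_lhs => rw [← bB.sum_repr b]
      exact Finset.sum_congr rfl fun i _ => by rw [hz i, mul_smul]
  exact ⟨(Ideal.quotientEquivAlgOfEq K hker).trans
    (Ideal.quotientKerAlgEquivOfSurjective hsurj)⟩

open PowerSeries TensorProduct in
theorem etale_tensorProduct_of_basis {R L B E ι : Type*} [CommRing R] [CommRing L] [Algebra R L]
    [CommRing B] [Algebra R B] [CommRing E] [Algebra R E] [Algebra L E] [IsScalarTower R L E]
    [Algebra.Etale L E] (g : B →ₐ[R] E) (bB : Module.Basis ι R B) (bE : Module.Basis ι L E)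
    (h : ∀ i, g (bB i) = bE i) : Algebra.Etale L (L ⊗[R] B) := by
  let f : L ⊗[R] B →ₐ[L] E := AlgHom.liftEquiv R L B E g
  have hf : f.toLinearMap = ((bB.baseChange L).equiv bE (Equiv.refl ι)).toLinearMap :=
    (bB.baseChange L).ext fun i => by
      have := (bB.baseChange L).equiv_apply (b' := bE) i (Equiv.refl ι)
      rw [LinearEquiv.coe_coe, this]
      simp [f, h]
  have hbij : Function.Bijective f := by
    change Function.Bijective f.toLinearMap
    rw [hf]
    exact LinearEquiv.bijective _
  exact Algebra.Etale.of_equiv (AlgEquiv.ofBijective f hbij).symm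

open PowerSeries in
/-- An algebra is smoothable if its structure constants are the special values of power series
structure constants for some basis of a split étale algebra over `K((X))`. -/
theorem isSmoothable_of_basis {K A ι P : Type} [Field K] [CommRing A] [Algebra K A] [Fintype ι]
    [Fintype P] (bA : Module.Basis ι K A)
    (bE : Module.Basis ι (LaurentSeries K) (P → LaurentSeries K)) (i₀ : ι) (hA₀ : bA i₀ = 1) (hE₀ : bE i₀ = 1)
    (c : ι → ι → ι → K⟦X⟧)
    (hE : ∀ i j, bE i * bE j = ∑ k, algebraMap K⟦X⟧ (LaurentSeries K) (c i j k) • bE k)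
    (hA : ∀ i j, bA i * bA j = ∑ k, constantCoeff (c i j k) • bA k) :
    IsSmoothable K A (Fintype.card ι) := by
  let N := Submodule.span K⟦X⟧ (Set.range bE)
  have hli : LinearIndependent K⟦X⟧ bE := bE.linearIndependent.restrict_scalars' K⟦X⟧
  have hmem : ∀ i, bE i ∈ N := fun i => Submodule.subset_span ⟨i, rfl⟩
  have hE' : ∀ i j, bE i * bE j = ∑ k, c i j k • bE k := fun i j => by
    simp only [hE, algebraMap_smul]
  have hNN : N * N ≤ N := by
    rw [Submodule.span_mul_span, Submodule.span_le]
    rintro _ ⟨_, ⟨i, rfl⟩, _, ⟨j, rfl⟩, rfl⟩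
    change bE i * bE j ∈ N
    rw [hE']
    exact N.sum_mem fun k _ => N.smul_mem _ (hmem k)
  let B : Subalgebra K⟦X⟧ (P → LaurentSeries K) := N.toSubalgebra (hE₀ ▸ hmem i₀)
    fun x y hx hy => hNN (Submodule.mul_mem_mul hx hy)
  let bB : Module.Basis ι K⟦X⟧ B := Module.Basis.span hli
  have hbB : ∀ i, (bB i : P → LaurentSeries K) = bE i := fun i =>
    congrArg Subtype.val (Module.Basis.span_apply hli i)
  let algB : Algebra K B := Algebra.compHom B (C : K →+* K⟦X⟧)
  have : IsScalarTower K K⟦X⟧ B := IsScalarTower.of_algebraMap_eq' rfl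
  refine ⟨B, inferInstance, inferInstance, algB, this, .of_basis bB,
    Module.finrank_eq_card_basis bB, ?_, etale_tensorProduct_of_basis B.val bB bE hbB⟩
  exact nonempty_quotient_X_algEquiv bA bB i₀ hA₀ (Subtype.ext ((hbB i₀).trans hE₀)) c
    (fun i j => Subtype.ext (by simp [hbB, hE'])) hA

open PowerSeries in
/-- Rescaling a graded basis by large powers of `X` makes all structure constants of positive
weight divisible by `X`. -/
theorem exists_basis_rescale {K ι E : Type*} [Field K] [Fintype ι] [CommRing E]
    [Algebra (LaurentSeries K) E] (bE : Module.Basis ι (LaurentSeries K) E) (deg : ι → ℕ)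
    (S : ι → ι → ι → K)
    (hlt : ∀ i j k, deg i + deg j < deg k → bE.repr (bE i * bE j) k = 0)
    (heq : ∀ i j k, deg i + deg j = deg k → ∃ d : K⟦X⟧, constantCoeff d = S i j k ∧
      bE.repr (bE i * bE j) k = algebraMap K⟦X⟧ (LaurentSeries K) d)
    (hS : ∀ i j k, deg i + deg j ≠ deg k → S i j k = 0) :
    ∃ (b : Module.Basis ι (LaurentSeries K) E) (c : ι → ι → ι → K⟦X⟧),
      (∀ i, deg i = 0 → b i = bE i) ∧
      (∀ i j, b i * b j = ∑ k, algebraMap K⟦X⟧ (LaurentSeries K) (c i j k) • b k) ∧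
      ∀ i j k, constantCoeff (c i j k) = S i j k := by
  classical
  let κ := algebraMap K⟦X⟧ (LaurentSeries K)
  have hκ : κ X ≠ 0 := by
    rw [Ne, FaithfulSMul.algebraMap_eq_zero_iff]
    exact X_ne_zero
  obtain ⟨⟨_, m, rfl⟩, hm⟩ := IsLocalization.exist_integer_multiples_of_finite
    (Submonoid.powers (X : K⟦X⟧)) fun q : ι × ι × ι => bE.repr (bE q.1 * bE q.2.1) q.2.2
  have hc : ∀ i j k, ∃ c, constantCoeff c = S i j k ∧
      κ X ^ ((m + 1) * deg i) * κ X ^ ((m + 1) * deg j) * bE.repr (bE i * bE j) k =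
        κ c * κ X ^ ((m + 1) * deg k) := fun i j k => by
    rcases lt_trichotomy (deg i + deg j) (deg k) with h | h | h
    · exact ⟨0, by simp [hS i j k h.ne], by simp [hlt i j k h]⟩
    · obtain ⟨d, hd, hd'⟩ := heq i j k h
      exact ⟨d, hd, by rw [hd', ← h]; ring⟩
    · obtain ⟨n, hn⟩ := hm (i, j, k)
      obtain ⟨e, he⟩ := Nat.exists_eq_add_of_lt h
      refine ⟨X ^ ((m + 1) * e + 1) * n, by simp [hS i j k h.ne'], ?_⟩
      have hn' : κ n = κ X ^ m * bE.repr (bE i * bE j) k := by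
        rw [← map_pow, ← Algebra.smul_def]; exact hn
      rw [map_mul κ, hn', map_pow κ, ← pow_add, ← mul_add, he]
      ring
  choose c hc₀ hc using hc
  let w : ι → LaurentSeries K := fun i => κ X ^ ((m + 1) * deg i)
  have hw : ∀ i, IsUnit (w i) := fun i => (pow_ne_zero _ hκ).isUnit
  refine ⟨bE.isUnitSMul hw, c, fun i hi => ?_, fun i j => ?_, hc₀⟩
  · rw [Module.Basis.isUnitSMul_apply]
    simp [w, hi]
  · simp only [Module.Basis.isUnitSMul_apply, smul_mul_smul_comm, smul_smul]
    conv_lhs => rw [← bE.sum_repr (bE i * bE j), Finset.smul_sum]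
    exact Finset.sum_congr rfl fun k _ => by rw [smul_smul, hc]

open PowerSeries in
/-- Nondegeneracy of a cubic form is preserved under deformation. -/
theorem eq_zero_of_forall_sum_mul_eq_zero {K n : Type*} [Field K] [Fintype n] [DecidableEq n]
    (F : n → n → n → K⟦X⟧)
    (hF : ∀ c : n → K, (∀ j k, ∑ i, c i * constantCoeff (F i j k) = 0) → c = 0)
    (α : n → LaurentSeries K)
    (hα : ∀ j k, ∑ i, α i * algebraMap K⟦X⟧ (LaurentSeries K) (F i j k) = 0) : α = 0 := by
  let f : (n → K) →ₗ[K] (n × n → K) :=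
    Matrix.toLin' (Matrix.of fun q i => constantCoeff (F i q.1 q.2))
  obtain ⟨g, hg⟩ := f.exists_leftInverse_of_injective <| by
    rw [LinearMap.ker_eq_bot']
    refine fun c hc => hF c fun j k => ?_
    have := congrFun hc (j, k)
    simpa [f, Matrix.mulVec, dotProduct, mul_comm] using this
  let N := LinearMap.toMatrix' g
  let M : Matrix n n K⟦X⟧ := Matrix.of fun l i => ∑ q : n × n, C (N l q) * F i q.1 q.2
  have hM : M.map constantCoeff = 1 := by
    have h1 : N * (Matrix.of fun (q : n × n) i => constantCoeff (F i q.1 q.2)) = 1 := by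
      have := congrArg LinearMap.toMatrix' hg
      rwa [LinearMap.toMatrix'_comp, LinearMap.toMatrix'_id, LinearMap.toMatrix'_toLin'] at this
    rw [← h1]
    ext l i
    simp [M, Matrix.mul_apply]
  have hdet : M.det ≠ 0 := fun h => by
    have := congrArg Matrix.det hM
    rw [Matrix.det_one, ← RingHom.mapMatrix_apply, ← RingHom.map_det, h, map_zero] at this
    exact zero_ne_one this
  refine Matrix.eq_zero_of_mulVec_eq_zero
    (M := M.map (algebraMap K⟦X⟧ (LaurentSeries K))) ?_ ?_
  · rw [← RingHom.mapMatrix_apply, ← RingHom.map_det]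
    rwa [Ne, FaithfulSMul.algebraMap_eq_zero_iff]
  · ext1 l
    simp only [Matrix.mulVec, dotProduct, Matrix.map_apply, M, Matrix.of_apply, map_sum, map_mul,
      Finset.sum_mul, Pi.zero_apply]
    rw [Finset.sum_comm]
    refine Finset.sum_eq_zero fun q _ => ?_
    have := hα q.1 q.2
    rw [← mul_zero (algebraMap K⟦X⟧ (LaurentSeries K) (C (N l q))), ← this, Finset.mul_sum]
    exact Finset.sum_congr rfl fun _ _ => by ring

/-- A maximal isotropic independent family for the form `∑ μ_p x_p y_p` can be completed to a
basis by a dual family. -/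
theorem exists_basis_sumElim_of_isotropic {k n P : Type*} [Field k] [Fintype n] [DecidableEq n]
    [Fintype P] [DecidableEq P] (μ : P → k) (hμ : ∀ p, μ p ≠ 0) (f : n → P → k)
    (hf : LinearIndependent k f) (hiso : ∀ a b, ∑ p, μ p * (f a p * f b p) = 0)
    (hcard : Fintype.card P = Fintype.card n + Fintype.card n) :
    ∃ b : Module.Basis (n ⊕ n) k (P → k), (∀ a, b (.inl a) = f a) ∧
      ∀ x a, b.repr x (.inr a) = ∑ p, μ p * (x p * f a p) := by
  obtain ⟨g, hg⟩ := (Fintype.linearCombination k f).exists_leftInverse_of_injective <| by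
    rw [LinearMap.ker_eq_bot]
    exact linearIndependent_iff_injective_fintypeLinearCombination.mp hf
  let w : n → P → k := fun a p => (μ p)⁻¹ * g (Pi.single p 1) a
  have hw : ∀ a b, ∑ p, μ p * (w a p * f b p) = if a = b then 1 else 0 := fun a b => by
    have h1 : g (f b) = Pi.single b 1 := by
      have := LinearMap.congr_fun hg (Pi.single b 1)
      simpa [Fintype.linearCombination_apply_single] using this
    have h2 := congrFun h1 a
    rw [LinearMap.pi_apply_eq_sum_univ g (f b)] at h2
    simp only [Finset.sum_apply, Pi.smul_apply, smul_eq_mul, Pi.single_apply] at h2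
    rw [← h2]
    refine Finset.sum_congr rfl fun p _ => ?_
    have := hμ p
    simp only [w]
    rw [show (Pi.single p 1 : P → k) = fun j => if p = j then 1 else 0 by
      ext j; simp [Pi.single_apply, eq_comm]]
    field_simp
  let B : (P → k) → n → k := fun x a => ∑ p, μ p * (x p * f a p)
  have hBs : ∀ (α β : n → k) a, B (∑ i, α i • f i + ∑ i, β i • w i) a = β a := fun α β a => by
    have : B (∑ i, α i • f i + ∑ i, β i • w i) a =
        ∑ i, α i * ∑ p, μ p * (f i p * f a p) + ∑ i, β i * ∑ p, μ p * (w i p * f a p) := by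
      simp only [B, Pi.add_apply, Finset.sum_apply, Pi.smul_apply, smul_eq_mul, add_mul, mul_add,
        Finset.sum_add_distrib, Finset.mul_sum, Finset.sum_mul]
      congr 1 <;> rw [Finset.sum_comm] <;>
        exact Finset.sum_congr rfl fun _ _ => Finset.sum_congr rfl fun _ _ => by ring
    simp [this, hiso, hw]
  have hli : LinearIndependent k (Sum.elim f w) := by
    rw [Fintype.linearIndependent_iff]
    intro γ hγ
    simp only [Fintype.sum_sum_type, Sum.elim_inl, Sum.elim_inr] at hγ
    have hr : ∀ a, γ (.inr a) = 0 := fun a => by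
      rw [← hBs (fun i => γ (.inl i)) (fun i => γ (.inr i)) a, hγ]; simp [B]
    simp only [hr, zero_smul, Finset.sum_const_zero, add_zero] at hγ
    have hl := Fintype.linearIndependent_iff.mp hf _ hγ
    rintro (a | a)
    exacts [hl a, hr a]
  let b := basisOfLinearIndependentOfCardEqFinrank' (b := Sum.elim f w) hli (by simp [hcard])
  have hb : ∀ i, b i = Sum.elim f w i := fun i => by simp [b]
  refine ⟨b, fun a => by simp [hb], fun x a => ?_⟩
  conv_rhs => rw [← b.sum_repr x]
  simp only [Fintype.sum_sum_type, hb, Sum.elim_inl, Sum.elim_inr]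
  exact (hBs (fun i => b.repr x (.inl i)) (fun i => b.repr x (.inr i)) a).symm

/-- Structure constants of the algebra with basis `1, vᵢ, wᵢ, s` and products
`vᵢ vⱼ = ∑ Fᵢⱼₖ wₖ`, `vᵢ wⱼ = δᵢⱼ s`. -/
def cubicStructureConst {K n : Type*} [Field K] [DecidableEq n] (F : n → n → n → K) :
    Option n ⊕ Option n → Option n ⊕ Option n → Option n ⊕ Option n → K
  | .inl none, j, k => if j = k then 1 else 0
  | i, .inl none, k => if i = k then 1 else 0
  | .inl (some i), .inl (some j), .inr (some k) => F i j k
  | .inl (some i), .inr (some j), .inr none => if i = j then 1 else 0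
  | .inr (some i), .inl (some j), .inr none => if i = j then 1 else 0
  | _, _, _ => 0

/-- The degrees of the basis elements in `cubicStructureConst`. -/
def cubicDegree {n : Type*} : Option n ⊕ Option n → ℕ
  | .inl none => 0
  | .inl (some _) => 1
  | .inr (some _) => 2
  | .inr none => 3

theorem cubicStructureConst_eq_zero {K n : Type*} [Field K] [DecidableEq n] (F : n → n → n → K)
    (i j k : Option n ⊕ Option n) (h : cubicDegree i + cubicDegree j ≠ cubicDegree k) :
    cubicStructureConst F i j k = 0 := by
  rcases i with (_ | i) | (_ | i) <;> rcases j with (_ | j) | (_ | j) <;>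
    rcases k with (_ | k) | (_ | k) <;> simp_all [cubicDegree, cubicStructureConst]

open PowerSeries in
theorem isSmoothable_of_cubicStructureConst {K A : Type} [Field K] [IsAlgClosed K] [CharZero K]
    [CommRing A] [Algebra K A] (F : Fin 7 → Fin 7 → Fin 7 → K)
    (hF₁ : ∀ i j k, F i j k = F j i k) (hF₂ : ∀ i j k, F i j k = F i k j)
    (hF : ∀ c : Fin 7 → K, (∀ j k, ∑ i, c i * F i j k = 0) → c = 0)
    (bA : Module.Basis (Option (Fin 7) ⊕ Option (Fin 7)) K A) (h₁ : bA (.inl none) = 1)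
    (hA : ∀ i j, bA i * bA j = ∑ k, cubicStructureConst F i j k • bA k) :
    IsSmoothable K A 16 := by
  obtain ⟨μ, y, F', hμ, m0, m1, m2, m3, hF'⟩ := exists_laurentSeries_moments F hF₁ hF₂
  let f : Option (Fin 7) → Fin 8 ⊕ Fin 8 → LaurentSeries K := fun a => a.elim 1 y
  have hf : LinearIndependent (LaurentSeries K) f := by
    rw [Fintype.linearIndependent_iff]
    intro α hα
    simp only [Fintype.sum_option, f, Option.elim] at hα
    have hs : (fun i => α (some i)) = 0 := by
      refine eq_zero_of_forall_sum_mul_eq_zero F' (by simpa only [hF'] using hF) _ fun j k => ?_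
      have h := congrArg (fun x : Fin 8 ⊕ Fin 8 → LaurentSeries K =>
        ∑ p, μ p * (x p * y j p * y k p)) hα
      simp only [Pi.add_apply, Pi.smul_apply, Finset.sum_apply, smul_eq_mul, Pi.one_apply, mul_one,
        Pi.zero_apply, zero_mul, mul_zero, Finset.sum_const_zero] at h
      rw [← h]
      have e : ∀ p, μ p * ((α none + ∑ i, α (some i) * y i p) * y j p * y k p) =
          α none * (μ p * (y j p * y k p)) +
            ∑ i, α (some i) * (μ p * (y i p * y j p * y k p)) := fun p => by
        simp only [add_mul, mul_add, Finset.sum_mul, Finset.mul_sum]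
        congr 1
        · ring
        · exact Finset.sum_congr rfl fun _ _ => by ring
      simp only [e, Finset.sum_add_distrib, ← Finset.mul_sum, m2, mul_zero, zero_add]
      rw [Finset.sum_comm]
      simp only [← Finset.mul_sum, m3]
    have hs' : ∀ i, α (some i) = 0 := congrFun hs
    simp only [hs', zero_smul, Finset.sum_const_zero, add_zero] at hα
    have hn : α none = 0 := by simpa using congrFun hα (.inl 0)
    rintro (_ | i)
    exacts [hn, hs' i]
  have hiso : ∀ a b, ∑ p, μ p * (f a p * f b p) = 0 := by
    rintro (_ | i) (_ | j) <;> simp [f, m0, m1, m2]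
  obtain ⟨b, hb, hr⟩ := exists_basis_sumElim_of_isotropic μ hμ f hf hiso (by simp)
  have hb₁ : b (.inl none) = 1 := hb none
  have hb' : ∀ i, b (.inl (some i)) = y i := fun i => hb (some i)
  have hw : ∀ a c, ∑ p, μ p * (b (.inr a) p * f c p) = if a = c then 1 else 0 := fun a c => by
    rw [← hr, b.repr_self, Finsupp.single_apply]; simp
  have hw' : ∀ i j, ∑ p, μ p * (y i p * b (.inr (some j)) p) = if i = j then 1 else 0 :=
    fun i j => by
      have := hw (some j) (some i)
      simp only [f, Option.elim, Option.some.injEq] at this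
      simp only [mul_comm (y i _), this, eq_comm]
  have r₁ : b.repr 1 = Finsupp.single (.inl none) 1 := by rw [← hb₁, b.repr_self]
  have ry : ∀ i, b.repr (y i) = Finsupp.single (.inl (some i)) 1 := fun i => by
    rw [← hb', b.repr_self]
  have hrw : ∀ i j, b.repr (y i * b (.inr (some j))) (.inr none) = if i = j then 1 else 0 :=
    fun i j => by simp [hr, f, hw']
  have hrw' : ∀ i j, b.repr (b (.inr (some i)) * y j) (.inr none) = if i = j then 1 else 0 :=
    fun i j => by rw [mul_comm, hrw]; simp [eq_comm]
  obtain ⟨b', c, hb'₁, hmul, hc⟩ := exists_basis_rescale b cubicDegree (cubicStructureConst F)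
    (fun i j k h => by
      rcases i with (_ | i) | (_ | i) <;> rcases j with (_ | j) | (_ | j) <;>
        rcases k with (_ | k) | (_ | k) <;> simp [cubicDegree] at h <;>
        simp [hb₁, hb', hr, f, m1, m2, b.repr_self, r₁])
    (fun i j k h => by
      rcases i with (_ | i) | (_ | i) <;> rcases j with (_ | j) | (_ | j) <;>
        rcases k with (_ | k) | (_ | k) <;> simp [cubicDegree] at h <;>
      first
      | exact ⟨F' i j k, by rw [hF']; rfl, by simp only [hb', hr, f, Option.elim, Pi.mul_apply, m3]⟩
      | refine ⟨C (cubicStructureConst F _ _ _), constantCoeff_C _, ?_⟩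
        simp [hb₁, hb', cubicStructureConst, b.repr_self, Finsupp.single_apply, r₁, ry, hrw, hrw']
        try simp [eq_comm])
    (cubicStructureConst_eq_zero F)
  refine isSmoothable_of_basis bA b' (.inl none) h₁ ((hb'₁ _ rfl).trans hb₁) c hmul fun i j => ?_
  simpa only [hc] using hA i j

/-- A Gorenstein algebra with Hilbert function `(1, n, n, 1)` over a field of characteristic zero
has a basis in the normal form of `cubicStructureConst`. -/
theorem exists_basis_cubicStructureConst {K A : Type*} [Field K] [CharZero K] [CommRing A]
    [Algebra K A] [FiniteDimensional K A] {n : ℕ} (hA : Module.finrank K A = 2 * (n + 1))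
    (m : Ideal A) (h4 : m ^ 4 = ⊥) (hm2 : Module.finrank K ((m ^ 2).restrictScalars K) = n + 1)
    (u : Fin n → A) (hu : ∀ i, u i ∈ m)
    (hspan : ∀ x ∈ m, ∃ c : Fin n → K, x - ∑ i, c i • u i ∈ m ^ 2)
    (s : A) (hs : s ∈ m ^ 3) (hs0 : s ≠ 0)
    (hsoc : ∀ c, (∀ x ∈ m, c * x = 0) → ∃ r : K, c = r • s) :
    ∃ (F : Fin n → Fin n → Fin n → K)
      (b : Module.Basis (Option (Fin n) ⊕ Option (Fin n)) K A),
      (∀ i j k, F i j k = F j i k) ∧ (∀ i j k, F i j k = F i k j) ∧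
      (∀ c : Fin n → K, (∀ j k, ∑ i, c i * F i j k = 0) → c = 0) ∧ b (.inl none) = 1 ∧
      ∀ i j, b i * b j = ∑ k, cubicStructureConst F i j k • b k := by
  obtain ⟨φ, hφ⟩ : ∃ φ : A →ₗ[K] K, φ s = 1 := by
    by_contra! h
    refine hs0 ((Module.forall_dual_apply_eq_zero_iff K s).mp fun φ => ?_)
    by_contra h'
    exact h ((φ s)⁻¹ • φ) (by simp [h'])
  have h22 : ∀ x ∈ m ^ 2, ∀ y ∈ m ^ 2, x * y = 0 := fun x hx y hy => by
    have := Ideal.mul_mem_mul hx hy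
    rwa [← pow_add, h4, Ideal.mem_bot] at this
  have h31 : ∀ x ∈ m ^ 3, ∀ y ∈ m, x * y = 0 := fun x hx y hy => by
    have := Ideal.mul_mem_mul hx hy
    rwa [← pow_succ, h4, Ideal.mem_bot] at this
  have h21 : ∀ x ∈ m ^ 2, ∀ y ∈ m, x * y ∈ m ^ 3 := fun x hx y hy => by
    rw [pow_succ]; exact Ideal.mul_mem_mul hx hy
  have h32 : m ^ 3 ≤ m ^ 2 := Ideal.pow_le_pow_right (by norm_num)
  have h2' : m ^ 2 ≤ m := Ideal.pow_le_self (by norm_num)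
  have hsm : ∀ (I : Ideal A) (r : K) x, x ∈ I → r • x ∈ I := fun I r x hx =>
    (I.restrictScalars K).smul_mem r hx
  have hφ3 : ∀ c ∈ m ^ 3, c = φ c • s := fun c hc => by
    obtain ⟨r, rfl⟩ := hsoc c (h31 c hc)
    simp [hφ]
  have hker : ∀ c ∈ m ^ 2, (∀ i, φ (c * u i) = 0) → c = φ c • s := fun c hc h => by
    obtain ⟨r, rfl⟩ := hsoc c fun x hx => by
      obtain ⟨d, hd⟩ := hspan x hx
      have := h22 c hc _ hd
      rw [mul_sub, sub_eq_zero] at this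
      rw [this, Finset.mul_sum]
      refine Finset.sum_eq_zero fun i _ => ?_
      rw [mul_smul_comm, hφ3 _ (h21 c hc _ (hu i)), h i, zero_smul, smul_zero]
    simp [hφ]
  let M2 := (m ^ 2).restrictScalars K
  let T : M2 →ₗ[K] Fin n → K :=
    LinearMap.pi fun i => φ ∘ₗ LinearMap.mulRight K (u i) ∘ₗ M2.subtype
  have hT : Function.Surjective T := by
    rw [← LinearMap.range_eq_top]
    apply Submodule.eq_top_of_finrank_eq
    have h1 := T.finrank_range_add_finrank_ker
    have h2 : Module.finrank K (LinearMap.ker T) ≤ 1 :=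
      finrank_le_one ⟨⟨s, h32 hs⟩, by
        rw [LinearMap.mem_ker]; ext i
        simp [T, h31 s hs _ (hu i)]⟩ fun c => ⟨φ c.1.1, Subtype.ext (Subtype.ext
          (hker _ c.1.2 fun i => congrFun (LinearMap.mem_ker.mp c.2) i).symm)⟩
    have h3 := Submodule.finrank_le (LinearMap.range T)
    change Module.finrank K M2 = n + 1 at hm2
    simp only [Module.finrank_fin_fun] at h3 ⊢
    omega
  choose w₀ hw₀ using fun i : Fin n => hT (Pi.single i 1)
  let w : Fin n → A := fun i => (w₀ i : A) - φ (w₀ i) • s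
  have hw2 : ∀ i, w i ∈ m ^ 2 := fun i =>
    (m ^ 2).sub_mem (w₀ i).2 (hsm _ _ _ (h32 hs))
  have hφw : ∀ i, φ (w i) = 0 := fun i => by simp [w, hφ]
  have hwu : ∀ i j, φ (w i * u j) = if i = j then 1 else 0 := fun i j => by
    have : φ (w₀ i * u j) = (Pi.single i 1 : Fin n → K) j := congrFun (hw₀ i) j
    simp only [w, sub_mul, smul_mul_assoc, h31 s hs _ (hu j), smul_zero, sub_zero, this,
      Pi.single_apply, eq_comm]
  let v : Fin n → A := fun i => u i - (1 / 2 : K) • ∑ j, φ (u i * u j) • w j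
  have huv : ∀ i, u i - v i ∈ m ^ 2 := fun i => by
    simp only [v, sub_sub_cancel]
    exact hsm _ _ _ ((m ^ 2).sum_mem fun j _ => hsm _ _ _ (hw2 j))
  have hv : ∀ i, v i ∈ m := fun i => by
    have := m.sub_mem (hu i) (h2' (huv i))
    rwa [sub_sub_cancel] at this
  have h2v : ∀ c ∈ m ^ 2, ∀ i, c * v i = c * u i := fun c hc i => by
    have := h22 c hc _ (huv i)
    rw [mul_sub, sub_eq_zero] at this
    exact this.symm
  have hwv : ∀ i j, w i * v j = (if i = j then 1 else 0 : K) • s := fun i j => by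
    rw [h2v _ (hw2 i), hφ3 _ (h21 _ (hw2 i) _ (hu j)), hwu]
  have hvv : ∀ i j, φ (v i * v j) = 0 := fun i j => by
    have e : ∀ i j, φ ((∑ k, φ (u i * u k) • w k) * u j) = φ (u i * u j) := fun i j => by
      simp [Finset.sum_mul, hwu]
    have : v i * v j = u i * u j - (1 / 2 : K) • ((∑ k, φ (u i * u k) • w k) * u j) -
        (1 / 2 : K) • ((∑ k, φ (u j * u k) • w k) * u i) := by
      have h := h22 _ (huv i) _ (huv j)
      have hi : (1 / 2 : K) • (∑ k, φ (u i * u k) • w k) = u i - v i := by simp [v]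
      have hj : (1 / 2 : K) • (∑ k, φ (u j * u k) • w k) = u j - v j := by simp [v]
      rw [← smul_mul_assoc, ← smul_mul_assoc, hi, hj]
      linear_combination h
    rw [this, map_sub, map_sub, map_smul, map_smul, e, e, mul_comm (u j), smul_eq_mul]
    ring
  let F : Fin n → Fin n → Fin n → K := fun i j k => φ (v i * v j * v k)
  have hvvw : ∀ i j, v i * v j = ∑ k, F i j k • w k := fun i j => by
    have hmem : v i * v j - ∑ k, F i j k • w k ∈ m ^ 2 := by
      refine (m ^ 2).sub_mem ?_ ((m ^ 2).sum_mem fun j _ => hsm _ _ _ (hw2 j))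
      rw [pow_two]; exact Ideal.mul_mem_mul (hv i) (hv j)
    have := hker _ hmem fun l => by
      rw [← h2v _ hmem, sub_mul, Finset.sum_mul]
      simp [hwv, hφ, F]
    rw [← sub_eq_zero, this]
    simp [hvv, hφw]
  let e : Option (Fin n) ⊕ Option (Fin n) → A :=
    Sum.elim (fun a => a.elim 1 v) (fun a => a.elim s w)
  have hss : s * s = 0 := h22 _ (h32 hs) _ (h32 hs)
  have hsw : ∀ i, s * w i = 0 := fun i => h22 _ (h32 hs) _ (hw2 i)
  have hws : ∀ i, w i * s = 0 := fun i => h22 _ (hw2 i) _ (h32 hs)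
  have hww : ∀ i j, w i * w j = 0 := fun i j => h22 _ (hw2 i) _ (hw2 j)
  have hsv : ∀ i, s * v i = 0 := fun i => h31 _ hs _ (hv i)
  have hvs : ∀ i, v i * s = 0 := fun i => by rw [mul_comm, hsv]
  have hvw : ∀ i j, v i * w j = (if i = j then 1 else 0 : K) • s := fun i j => by
    rw [mul_comm, hwv]; simp only [eq_comm]
  have hli : LinearIndependent K e := by
    rw [Fintype.linearIndependent_iff]
    intro g hg
    simp only [Fintype.sum_sum_type, Fintype.sum_option, e, Sum.elim_inl, Sum.elim_inr,
      Option.elim] at hg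
    have g0 : g (.inl none) = 0 := by
      have := congrArg (fun x => φ (x * s)) hg
      simpa [add_mul, Finset.sum_mul, hvs, hws, hss, hφ] using this
    have g1 : ∀ i, g (.inl (some i)) = 0 := fun i => by
      have := congrArg (fun x => φ (x * w i)) hg
      simpa [add_mul, Finset.sum_mul, hvw, hww, hsw, hφ, g0] using this
    have g2 : ∀ i, g (.inr (some i)) = 0 := fun i => by
      have := congrArg (fun x => φ (x * v i)) hg
      simpa [add_mul, Finset.sum_mul, hwv, hsv, hφ, g0, g1] using this
    have g3 : g (.inr none) = 0 := by
      have := congrArg φ hg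
      simpa [hφ, g0, g1, g2] using this
    rintro ((_ | i) | (_ | i))
    exacts [g0, g1 i, g3, g2 i]
  let b := basisOfLinearIndependentOfCardEqFinrank' (b := e) hli (by simp [hA]; ring)
  have hb : ∀ i, b i = e i := fun i => by simp [b]
  refine ⟨F, b, fun i j k => by simp only [F, mul_comm (v i)],
    fun i j k => by simp only [F, mul_right_comm], fun c hc => ?_, by rw [hb]; rfl, fun i j => ?_⟩
  · let x := ∑ i, c i • v i
    have hxm : x ∈ m := m.sum_mem fun i _ => hsm _ _ _ (hv i)
    have hx : ∀ j, x * v j = 0 := fun j => by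
      simp only [x, Finset.sum_mul, smul_mul_assoc, hvvw, Finset.smul_sum, smul_smul]
      rw [Finset.sum_comm]
      simp only [← Finset.sum_smul, hc, zero_smul, Finset.sum_const_zero]
    have hx1 : ∀ y ∈ m, x * y ∈ m ^ 3 := fun y hy => by
      obtain ⟨d, hd⟩ := hspan y hy
      have hy2 : y - ∑ i, d i • v i ∈ m ^ 2 := by
        have := (m ^ 2).add_mem hd
          ((m ^ 2).sum_mem (t := Finset.univ) fun i _ => hsm _ (d i) _ (huv i))
        simpa [smul_sub, Finset.sum_sub_distrib] using this
      have e : x * ∑ i, d i • v i = 0 := by simp only [Finset.mul_sum, mul_smul_comm, hx,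
        smul_zero, Finset.sum_const_zero]
      have := h21 _ hy2 _ hxm
      rwa [mul_comm, mul_sub, e, sub_zero] at this
    have hx2 : ∀ y ∈ m ^ 2, x * y = 0 := fun y hy => by
      rw [pow_two] at hy
      refine Submodule.mul_induction_on hy (fun y hy z hz => ?_) fun y z hy hz => ?_
      · rw [← mul_assoc]; exact h31 _ (hx1 y hy) _ hz
      · rw [mul_add, hy, hz, add_zero]
    ext i
    have := congrArg φ (hx2 _ (hw2 i))
    simpa [x, Finset.sum_mul, hvw, hφ] using this
  · simp only [Fintype.sum_sum_type, Fintype.sum_option, hb]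
    rcases i with (_ | i) | (_ | i) <;> rcases j with (_ | j) | (_ | j) <;>
      simp [cubicStructureConst, e, hvvw, hvw, hwv, hvs, hsv, hww, hws, hsw, hss, ite_smul]

/-- Dimension count for nested subspaces `N ≤ M`. -/
theorem finite_and_finrank_eq_add {K V : Type*} [Field K] [AddCommGroup V] [Module K V]
    {M N : Submodule K V} (h : N ≤ M) (hN : Module.Finite K N)
    (hq : Module.finrank K (M ⧸ N.comap M.subtype) ≠ 0) :
    Module.Finite K M ∧
      Module.finrank K M = Module.finrank K (M ⧸ N.comap M.subtype) + Module.finrank K N := by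
  let e := Submodule.comapSubtypeEquivOfLe h
  have h1 : Module.Finite K (N.comap M.subtype) := Module.Finite.equiv e.symm
  have h2 : Module.Finite K (M ⧸ N.comap M.subtype) :=
    Module.finite_of_finrank_pos (Nat.pos_of_ne_zero hq)
  have h3 : Module.Finite K M := Module.Finite.of_submodule_quotient (N.comap M.subtype)
  refine ⟨h3, ?_⟩
  rw [← e.finrank_eq, Submodule.finrank_quotient_add_finrank]

/-- Over an algebraically closed field `K` of characteristic `0`, every local Artinian
Gorenstein `K`-algebra with residue field `K` and Hilbert function `(1,7,7,1)`
is smoothable (with `d = 16`). -/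
theorem local_gorenstein_1771_smoothable (K A : Type) [Field K] [IsAlgClosed K] [CharZero K]
    [CommRing A] [Algebra K A] [IsLocalRing A] [IsArtinianRing A]
    (h0 : Module.finrank K (A ⧸ IsLocalRing.maximalIdeal A) = 1)
    (h1 : assocGradedDim K A 1 = 7)
    (h2 : assocGradedDim K A 2 = 7)
    (h3 : assocGradedDim K A 3 = 1)
    (h4 : IsLocalRing.maximalIdeal A ^ 4 = ⊥)
    (hgor : Module.finrank K
      (((⊥ : Ideal A).colon (IsLocalRing.maximalIdeal A)).restrictScalars K) = 1) :
    IsSmoothable K A 16 := by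
  classical
  let m := IsLocalRing.maximalIdeal A
  let M : ℕ → Submodule K A := fun i => (m ^ i).restrictScalars K
  have hle : ∀ i, M (i + 1) ≤ M i := fun i => Ideal.pow_le_pow_right i.le_succ
  have f4 : Module.Finite K (M 4) ∧ Module.finrank K (M 4) = 0 := by
    have : M 4 = ⊥ := by
      change (m ^ 4).restrictScalars K = ⊥
      rw [h4]; rfl
    rw [this]
    exact ⟨inferInstance, finrank_bot K A⟩
  have f3 := finite_and_finrank_eq_add (hle 3) f4.1 (show assocGradedDim K A 3 ≠ 0 by simp [h3])
  have f2 := finite_and_finrank_eq_add (hle 2) f3.1 (show assocGradedDim K A 2 ≠ 0 by simp [h2])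
  have f1 := finite_and_finrank_eq_add (hle 1) f2.1 (show assocGradedDim K A 1 ≠ 0 by simp [h1])
  have d3 : Module.finrank K (M 3) = 1 := f3.2.trans (congrArg₂ (· + ·) h3 f4.2)
  have d2 : Module.finrank K (M 2) = 7 + 1 := f2.2.trans (congrArg₂ (· + ·) h2 d3)
  have d1 : Module.finrank K (M 1) = 7 + (7 + 1) := f1.2.trans (congrArg₂ (· + ·) h1 d2)
  have hM1 : M 1 = m.restrictScalars K := by simp only [M, pow_one]
  rw [hM1] at d1 f1
  have fA : Module.Finite K A := by
    have := f1.1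
    have : Module.Finite K (A ⧸ m) := Module.finite_of_finrank_pos (by rw [h0]; exact one_pos)
    have : Module.Finite K (A ⧸ m.restrictScalars K) :=
      Module.Finite.equiv (Submodule.Quotient.restrictScalarsEquiv K m).symm
    exact Module.Finite.of_submodule_quotient (m.restrictScalars K)
  have dA : Module.finrank K A = 2 * (7 + 1) := by
    rw [← Submodule.finrank_quotient_add_finrank (m.restrictScalars K), d1,
      (Submodule.Quotient.restrictScalarsEquiv K m).finrank_eq, h0]
  obtain ⟨u, hu, hspan⟩ : ∃ u : Fin 7 → A, (∀ i, u i ∈ m) ∧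
      ∀ x ∈ m, ∃ c : Fin 7 → K, x - ∑ i, c i • u i ∈ m ^ 2 := by
    let b := Module.finBasisOfFinrankEq K _ h1
    let q := ((M 2).comap (M 1).subtype).mkQ
    choose u hu using fun i => Submodule.mkQ_surjective _ (b i)
    refine ⟨fun i => u i, fun i => ?_, fun x hx => ?_⟩
    · exact Ideal.pow_le_self one_ne_zero (u i).2
    · let x' : M 1 := ⟨x, hM1 ▸ hx⟩
      have : q (x' - ∑ i, b.repr (q x') i • u i) = 0 := by
        rw [map_sub, map_sum, sub_eq_zero]
        simp only [map_smul]
        refine (b.sum_repr _).symm.trans (Finset.sum_congr rfl fun i _ => ?_)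
        rw [← hu]
      have := (Submodule.Quotient.mk_eq_zero _).mp this
      exact ⟨b.repr (q x'), by simpa [x', M] using this⟩
  let C := ((⊥ : Ideal A).colon (IsLocalRing.maximalIdeal A)).restrictScalars K
  have hC : ∀ c, c ∈ C ↔ ∀ x ∈ m, c * x = 0 := fun c => by
    change c ∈ (⊥ : Ideal A).colon _ ↔ _
    rw [Submodule.mem_colon]; rfl
  have hM3 : M 3 = C := by
    refine Submodule.eq_of_le_of_finrank_eq (fun c hc => (hC c).mpr fun x hx => ?_)
      (d3.trans hgor.symm)
    have := Ideal.mul_mem_mul (show c ∈ m ^ 3 from hc) hx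
    rwa [← pow_succ, h4, Ideal.mem_bot] at this
  obtain ⟨⟨s, hs⟩, hs0, hs1⟩ := finrank_eq_one_iff'.mp d3
  obtain ⟨F, b, hF₁, hF₂, hF, hb₁, hb⟩ := exists_basis_cubicStructureConst dA m h4 d2 u hu hspan s
    hs (fun h => hs0 (Subtype.ext h)) fun c hc => by
      obtain ⟨r, hr⟩ := hs1 ⟨c, hM3 ▸ (hC c).mpr hc⟩
      exact ⟨r, (congrArg Subtype.val hr).symm⟩
  exact isSmoothable_of_cubicStructureConst F hF₁ hF₂ hF b hb₁ hb
end
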